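/- arXiv:2506.20421 — 4 statements merged into one kernel-verified Lean document; each statement's English description precedes it below -/
import Mathlib

section
/- Let C be a plane geometric cycle (a simple polygon) whose vertices are points in the plane in general position. If C has exactly three principal points and these three principal points form a path in C (i.e., one of them is adjacent in C to the other two), then C has at most five vertices. -/
noncomputable section

/-- Points of the plane. -/
abbrev Pt : Type := ℝ × ℝ

/-- Signed side of point `p` with respect to the oriented line through `u` and `u'`
(the usual cross-product / determinant test). -/
def sideSign (u u' p : Pt) : ℝ :=
  (u'.1 - u.1) * (p.2 - u.2) - (u'.2 - u.2) * (p.1 - u.1)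

/-- `v` and `v'` lie on strictly opposite sides of the straight line through `u` and `u'`. -/
def StrictlyOppositeSides (u u' v v' : Pt) : Prop :=
  sideSign u u' v * sideSign u u' v' < 0

/-- A set of points is in general position: no three (distinct) points of it are collinear. -/
def GenPos (P : Set Pt) : Prop :=
  ∀ a ∈ P, ∀ b ∈ P, ∀ c ∈ P, a ≠ b → a ≠ c → b ≠ c →
    ¬ Collinear ℝ ({a, b, c} : Set Pt)

/-- `γ : ZMod t → Pt` is a plane cycle of length `t` for the coloring `φ`:
a cyclic sequence of `t ≥ 3` distinct points in which cyclically consecutive points have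
different colors, and in which two distinct edges meet exactly in their common endpoint
if they are cyclically consecutive, and not at all otherwise. -/
def IsPlaneCycle (φ : Pt → ℕ) (t : ℕ) (γ : ZMod t → Pt) : Prop :=
  3 ≤ t ∧ Function.Injective γ ∧
  (∀ i : ZMod t, φ (γ i) ≠ φ (γ (i + 1))) ∧
  ∀ i j : ZMod t, i ≠ j →
    (j = i + 1 →
      segment ℝ (γ i) (γ (i + 1)) ∩ segment ℝ (γ j) (γ (j + 1)) = ({γ (i + 1)} : Set Pt)) ∧
    (j ≠ i + 1 → i ≠ j + 1 →
      segment ℝ (γ i) (γ (i + 1)) ∩ segment ℝ (γ j) (γ (j + 1)) = (∅ : Set Pt))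

/-- A cycle is non-rainbow if some color appears on two of its points. -/
def NonRainbow (φ : Pt → ℕ) (t : ℕ) (γ : ZMod t → Pt) : Prop :=
  ∃ i j : ZMod t, i ≠ j ∧ φ (γ i) = φ (γ j)

/-- A set of points is in convex position (each point is a vertex of the convex hull). -/
def ConvexPosition (s : Set Pt) : Prop :=
  ∀ p ∈ s, p ∉ convexHull ℝ (s \ {p})

/-- An uncolored plane geometric cycle (simple polygon) of length `t`. -/
def IsPlaneCycleGeom (t : ℕ) (γ : ZMod t → Pt) : Prop :=
  3 ≤ t ∧ Function.Injective γ ∧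
  ∀ i j : ZMod t, i ≠ j →
    (j = i + 1 →
      segment ℝ (γ i) (γ (i + 1)) ∩ segment ℝ (γ j) (γ (j + 1)) = ({γ (i + 1)} : Set Pt)) ∧
    (j ≠ i + 1 → i ≠ j + 1 →
      segment ℝ (γ i) (γ (i + 1)) ∩ segment ℝ (γ j) (γ (j + 1)) = (∅ : Set Pt))

/-- `γ i` is a principal point of the cycle `γ`: the segment between its two neighbors meets
the union of the edges of the cycle only in those two neighbors. -/
def IsPrincipal (t : ℕ) (γ : ZMod t → Pt) (i : ZMod t) : Prop :=
  segment ℝ (γ (i - 1)) (γ (i + 1)) ∩ (⋃ j : ZMod t, segment ℝ (γ j) (γ (j + 1))) ⊆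
    ({γ (i - 1), γ (i + 1)} : Set Pt)

set_option linter.unusedSimpArgs false
set_option linter.unusedVariables false
set_option linter.unusedTactic false
set_option linter.unreachableTactic false
/-- proper crossing of segments `ab` and `cd` -/
def Xc (a b c d : Pt) : Prop :=
  sideSign a b c * sideSign a b d < 0 ∧ sideSign c d a * sideSign c d b < 0

open Classical in
def gg (a b x : Pt) : ZMod 2 :=
  if (a.1 ≤ x.1 ∧ x.1 < b.1 ∧ 0 < sideSign a b x) ∨
     (b.1 ≤ x.1 ∧ x.1 < a.1 ∧ sideSign a b x < 0) then 1 else 0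

open Classical in
def hh (x y a : Pt) : ZMod 2 :=
  if (x.1 < a.1 ∧ a.1 ≤ y.1 ∧ sideSign x y a < 0) ∨
     (y.1 < a.1 ∧ a.1 ≤ x.1 ∧ 0 < sideSign x y a) then 1 else 0

lemma ss_swap (a b c : Pt) : sideSign b a c = - sideSign a b c := by
  unfold sideSign; ring

lemma ss_rot (a b c : Pt) : sideSign b c a = sideSign a b c := by
  unfold sideSign; ring

lemma ss_swap2 (a b c : Pt) : sideSign a c b = - sideSign a b c := by
  unfold sideSign; ring

lemma gg_symm (a b x : Pt) : gg a b x = gg b a x := by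
  unfold gg
  rw [ss_swap a b x]
  congr 1
  apply propext
  constructor <;> (rintro (⟨h1, h2, h3⟩ | ⟨h1, h2, h3⟩)) <;> [right; left; right; left] <;>
    exact ⟨h1, h2, by linarith⟩

lemma hh_symm (x y a : Pt) : hh x y a = hh y x a := by
  unfold hh
  rw [ss_swap x y a]
  congr 1
  apply propext
  constructor <;> (rintro (⟨h1, h2, h3⟩ | ⟨h1, h2, h3⟩)) <;> [right; left; right; left] <;>
    exact ⟨h1, h2, by linarith⟩

/-- point strictly inside a triangle -/
def InT (a b c z : Pt) : Prop :=
  (0 < sideSign a b z ∧ 0 < sideSign b c z ∧ 0 < sideSign c a z) ∨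
  (sideSign a b z < 0 ∧ sideSign b c z < 0 ∧ sideSign c a z < 0)

lemma sg4 (s A : ℝ) (h : s ≠ 0) :
    (s < 0 ∧ A ≤ 0 ∧ 0 ≤ s * A) ∨ (s < 0 ∧ 0 < A ∧ s * A < 0) ∨
    (0 < s ∧ A ≤ 0 ∧ s * A ≤ 0) ∨ (0 < s ∧ 0 < A ∧ 0 < s * A) := by
  rcases lt_or_gt_of_ne h with k1 | k1 <;> rcases le_or_gt A 0 with kA | kA
  · exact Or.inl ⟨k1, kA, mul_nonneg_of_nonpos_of_nonpos k1.le kA⟩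
  · exact Or.inr (Or.inl ⟨k1, kA, mul_neg_of_neg_of_pos k1 kA⟩)
  · exact Or.inr (Or.inr (Or.inl ⟨k1, kA, mul_nonpos_of_nonneg_of_nonpos k1.le kA⟩))
  · exact Or.inr (Or.inr (Or.inr ⟨k1, kA, mul_pos k1 kA⟩))

open Classical in
lemma gg_tri (a b c z : Pt) (h1 : sideSign a b z ≠ 0) (h2 : sideSign b c z ≠ 0)
    (h3 : sideSign c a z ≠ 0) :
    gg a b z + gg b c z + gg c a z = if InT a b c z then 1 else 0 := by
  have rel : sideSign b c z * (a.1 - z.1) + sideSign c a z * (b.1 - z.1)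
      + sideSign a b z * (c.1 - z.1) = 0 := by unfold sideSign; ring
  have hd : a.1 - z.1 = 0 → b.1 - z.1 = 0 → sideSign a b z = 0 := by
    intro h h'
    have : a.1 = z.1 := by linarith
    have : b.1 = z.1 := by linarith
    unfold sideSign; simp [*]
  unfold gg InT
  have e : ∀ q : Pt, (q.1 ≤ z.1 ↔ q.1 - z.1 ≤ 0) ∧ (z.1 < q.1 ↔ 0 < q.1 - z.1) := by
    intro q; constructor <;> constructor <;> intro h <;> linarith
  simp only [(e _).1, (e _).2]
  generalize sideSign a b z = s1 at *
  generalize sideSign b c z = s2 at *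
  generalize sideSign c a z = s3 at *
  generalize a.1 - z.1 = A at *
  generalize b.1 - z.1 = B at *
  generalize c.1 - z.1 = C at *
  clear e
  have hz : A ≤ 0 → B ≤ 0 → (s2 * A = 0) → (s3 * B = 0) → False := by
    intro _ _ e1 e2
    rcases mul_eq_zero.1 e1 with e | e
    · exact h2 e
    rcases mul_eq_zero.1 e2 with e' | e'
    · exact h3 e'
    exact h1 (hd e e')
  clear hd
  rcases sg4 s1 C h1 with ⟨k1, kC, m1⟩ | ⟨k1, kC, m1⟩ | ⟨k1, kC, m1⟩ | ⟨k1, kC, m1⟩ <;>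
  rcases sg4 s2 A h2 with ⟨k2, kA, m2⟩ | ⟨k2, kA, m2⟩ | ⟨k2, kA, m2⟩ | ⟨k2, kA, m2⟩ <;>
  rcases sg4 s3 B h3 with ⟨k3, kB, m3⟩ | ⟨k3, kB, m3⟩ | ⟨k3, kB, m3⟩ | ⟨k3, kB, m3⟩ <;>
  simp only [k1, k2, k3, kA, kB, kC, not_lt_of_gt, not_lt_of_ge, not_le_of_gt, gt_iff_lt, true_and, and_true, false_and, and_false, or_false, false_or, or_true, true_or, or_self, if_true, if_false, add_zero, zero_add] <;>
  first
  | rfl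
  | decide
  | (exfalso; linarith)
  | (exfalso; exact hz kA kB (by linarith) (by linarith))

set_option maxHeartbeats 2000000 in
open Classical in
lemma four_aux (a b x y : Pt) (h1 : sideSign a b x ≠ 0) (h2 : sideSign a b y ≠ 0)
    (h3 : sideSign x y a ≠ 0) (h4 : sideSign x y b ≠ 0) (hab : a.1 ≤ b.1) (hxy : x.1 ≤ y.1) :
    gg a b x + gg a b y + hh x y a + hh x y b = if Xc a b x y then 1 else 0 := by
  have r1 : sideSign a b x - sideSign a b y = sideSign x y b - sideSign x y a := by
    unfold sideSign; ring
  have r2 : sideSign x y b * a.1 - sideSign x y a * b.1 + sideSign a b y * x.1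
      - sideSign a b x * y.1 = 0 := by unfold sideSign; ring
  have hd : a.1 = b.1 → b.1 = x.1 → sideSign a b x = 0 := by
    intro h h'; unfold sideSign; simp [*]
  have hd2 : a.1 = b.1 → b.1 = y.1 → sideSign a b y = 0 := by
    intro h h'; unfold sideSign; simp [*]
  have hd3 : x.1 = y.1 → y.1 = a.1 → sideSign x y a = 0 := by
    intro h h'; unfold sideSign; simp [*]
  have hd4 : x.1 = y.1 → y.1 = b.1 → sideSign x y b = 0 := by
    intro h h'; unfold sideSign; simp [*]
  have hX : Xc a b x y ↔ (0 < sideSign a b x ↔ sideSign a b y < 0) ∧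
    (0 < sideSign x y a ↔ sideSign x y b < 0) := by
    unfold Xc
    rw [mul_neg_iff, mul_neg_iff]
    rcases lt_or_gt_of_ne h1 with k1 | k1 <;> rcases lt_or_gt_of_ne h2 with k2 | k2 <;>
    rcases lt_or_gt_of_ne h3 with k3 | k3 <;> rcases lt_or_gt_of_ne h4 with k4 | k4 <;>
    simp [k1, k2, k3, k4, not_lt_of_gt]
  simp only [hX]
  unfold gg hh
  generalize sideSign a b x = s1 at *
  generalize sideSign a b y = s2 at *
  generalize sideSign x y a = s3 at *
  generalize sideSign x y b = s4 at *
  generalize a.1 = A at *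
  generalize b.1 = B at *
  generalize x.1 = X at *
  generalize y.1 = Y at *
  clear hX
  have C1 : ∀ c, s4 * (A - c) - s3 * (B - c) + s2 * (X - c) - s1 * (Y - c) = 0 := by
    intro c; linear_combination r2 + c * r1
  have cA := C1 A
  have cB := C1 B
  have cX := C1 X
  have cY := C1 Y
  clear C1
  have nAB := not_lt_of_ge hab
  have nXY := not_lt_of_ge hxy
  rcases le_or_gt A X with u1 | u1 <;> rcases le_or_gt B X with u2 | u2 <;>
  rcases le_or_gt A Y with u3 | u3 <;> rcases le_or_gt B Y with u4 | u4 <;>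
  (try (exfalso; linarith)) <;>
  rcases lt_or_gt_of_ne h1 with k1 | k1 <;> rcases lt_or_gt_of_ne h2 with k2 | k2 <;>
  rcases lt_or_gt_of_ne h3 with k3 | k3 <;> rcases lt_or_gt_of_ne h4 with k4 | k4 <;>
  (try (exfalso; linarith)) <;>
  simp only [u1, u2, u3, u4, k1, k2, k3, k4, not_lt_of_gt, not_lt_of_ge, not_le_of_gt, true_and, and_true, false_and, and_false, or_false, false_or, or_true, true_or, or_self, if_true, if_false, add_zero, zero_add, iff_self, iff_true, true_iff, iff_false, false_iff, not_true, not_false_iff] <;>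
  first
  | rfl
  | decide
  | (exfalso; nlinarith)
  | (exfalso; rcases eq_or_lt_of_le hab with e1 | e1 <;> rcases eq_or_lt_of_le u2 with e2 | e2 <;>
      first | exact h1 (hd e1 e2) | nlinarith)

lemma Xc_swap1 (a b c d : Pt) : Xc b a c d ↔ Xc a b c d := by
  unfold Xc
  rw [ss_swap a b c, ss_swap a b d]
  constructor <;> rintro ⟨h1, h2⟩ <;> constructor <;> linarith

lemma Xc_comm (a b c d : Pt) : Xc c d a b ↔ Xc a b c d := by
  unfold Xc
  exact and_comm

lemma Xc_swap2 (a b c d : Pt) : Xc a b d c ↔ Xc a b c d := by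
  rw [Xc_comm, Xc_swap1, Xc_comm]

open Classical in
lemma four (a b x y : Pt) (h1 : sideSign a b x ≠ 0) (h2 : sideSign a b y ≠ 0)
    (h3 : sideSign x y a ≠ 0) (h4 : sideSign x y b ≠ 0) :
    gg a b x + gg a b y + hh x y a + hh x y b = if Xc a b x y then 1 else 0 := by
  have n : ∀ p q r : Pt, sideSign p q r ≠ 0 → sideSign q p r ≠ 0 := by
    intro p q r h; rw [ss_swap]; exact neg_ne_zero.2 h
  rcases le_total a.1 b.1 with hab | hab <;> rcases le_total x.1 y.1 with hxy | hxy
  · exact four_aux a b x y h1 h2 h3 h4 hab hxy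
  · have := four_aux a b y x h2 h1 (n _ _ _ h3) (n _ _ _ h4) hab hxy
    simp only [Xc_swap2 a b x y, hh_symm y x] at this
    rw [← this]; ring
  · have := four_aux b a x y (n _ _ _ h1) (n _ _ _ h2) h4 h3 hab hxy
    simp only [Xc_swap1 a b, gg_symm b a] at this
    rw [← this]; ring
  · have := four_aux b a y x (n _ _ _ h2) (n _ _ _ h1) (n _ _ _ h4) (n _ _ _ h3) hab hxy
    simp only [Xc_swap1 a b, Xc_swap2 a b, gg_symm b a, hh_symm y x] at this
    rw [← this]; ring

lemma gg_right (a b v : Pt) (ha : a.1 ≤ v.1) (hb : b.1 ≤ v.1) : gg a b v = 0 := by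
  unfold gg
  rw [if_neg]
  rintro (⟨_, h, _⟩ | ⟨_, h, _⟩) <;> linarith

lemma G1core (u1 u2 y1 y2 z1 z2 : ℝ) (hu1 : 0 < u1) (hu2 : 0 < u2) (hs : u1 + u2 < 1)
    (hq : u1 * y2 - u2 * y1 < 0) (hq' : 0 < u1 * z2 - u2 * z1)
    (hM : 0 < y1 * z2 - y2 * z1)
    (hM' : y1 * z2 - y2 * z1 < (u1 * z2 - u2 * z1) - (u1 * y2 - u2 * y1))
    (hy : y2 ≠ 0) (hsy : y1 + y2 < u1 + u2) (hn : ¬ (0 < y1 ∧ 0 < y2)) :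
    y2 < 0 ∧ 0 < z2 ∧ y1 * z2 - y2 * z1 - (z2 - y2) < 0 := by
  have hy2 : y2 < 0 := by
    rcases lt_or_gt_of_ne hy with h | h
    · exact h
    · exfalso; apply hn
      refine ⟨?_, h⟩
      have : 0 < u2 * y1 := by nlinarith
      exact (mul_pos_iff_of_pos_left hu2).1 this
  set q := u1 * y2 - u2 * y1 with hqd
  set q' := u1 * z2 - u2 * z1 with hqd'
  set M := y1 * z2 - y2 * z1 with hMd
  have i2 : q' * y2 - q * z2 = u2 * M := by rw [hqd, hqd', hMd]; ring
  have i1 : q' * y1 - q * z1 = u1 * M := by rw [hqd, hqd', hMd]; ring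
  have hz2 : 0 < z2 := by
    have : 0 < (-q) * z2 := by nlinarith [mul_pos hu2 hM, mul_pos_of_neg_of_neg (neg_neg_of_pos hq') hy2]
    exact (mul_pos_iff_of_pos_left (by linarith)).1 this
  refine ⟨hy2, hz2, ?_⟩
  set s := y1 + y2 with hsd
  set s' := z1 + z2 with hsd'
  set σ := u1 + u2 with hσ
  have hσ0 : 0 < σ := by positivity
  have hMs : M = s * z2 - y2 * s' := by rw [hMd, hsd, hsd']; ring
  have key : q' * (s - σ) - q * (s' - σ) < 0 := by
    have : q' * s - q * s' = σ * M := by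
      rw [hsd, hsd', hσ]; linear_combination i1 + i2
    nlinarith [mul_lt_mul_of_pos_left hM' hσ0]
  have goal : z2 * (s - σ) - y2 * (s' - σ) < 0 := by
    rcases le_or_gt s' σ with h | h
    · nlinarith [mul_pos hz2 (sub_pos.2 hsy), mul_nonneg (neg_nonneg.2 hy2.le) (sub_nonneg.2 h)]
    · have e1 : z2 * (q' * (s - σ) - q * (s' - σ)) < 0 := mul_neg_of_pos_of_neg hz2 key
      have e2 : 0 < (q' * y2 - q * z2) * (s' - σ) := by
        rw [i2]; exact mul_pos (mul_pos hu2 hM) (by linarith)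
      have : q' * (z2 * (s - σ) - y2 * (s' - σ)) < 0 := by nlinarith
      by_contra hc
      push Not at hc
      nlinarith [mul_nonneg hq'.le hc]
  have : 0 < (1 - σ) * (z2 - y2) := mul_pos (by linarith) (by linarith)
  nlinarith

lemma G1half (a v c u y z : Pt) (u1 u2 y1 y2 z1 z2 : ℝ) (hD : sideSign v a c ≠ 0)
    (eu : u = v + u1 • (a - v) + u2 • (c - v)) (ey : y = v + y1 • (a - v) + y2 • (c - v))
    (ez : z = v + z1 • (a - v) + z2 • (c - v))
    (hu1 : 0 < u1) (hu2 : 0 < u2) (hs : u1 + u2 < 1)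
    (hq : u1 * y2 - u2 * y1 < 0) (hq' : 0 < u1 * z2 - u2 * z1)
    (hM : 0 < y1 * z2 - y2 * z1)
    (hM' : y1 * z2 - y2 * z1 < (u1 * z2 - u2 * z1) - (u1 * y2 - u2 * y1))
    (hy : y2 ≠ 0) (hsy : y1 + y2 < u1 + u2) (hn : ¬ (0 < y1 ∧ 0 < y2)) : Xc v a y z := by
  obtain ⟨k1, k2, k3⟩ := G1core u1 u2 y1 y2 z1 z2 hu1 hu2 hs hq hq' hM hM' hy hsy hn
  have D2 : 0 < sideSign v a c ^ 2 := by positivity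
  constructor
  · have e : sideSign v a y * sideSign v a z = sideSign v a c ^ 2 * (y2 * z2) := by
      subst ey ez; unfold sideSign; simp; ring
    rw [e]; exact mul_neg_of_pos_of_neg D2 (mul_neg_of_neg_of_pos k1 k2)
  · have e : sideSign y z v * sideSign y z a = sideSign v a c ^ 2 *
      ((y1 * z2 - y2 * z1) * (y1 * z2 - y2 * z1 - (z2 - y2))) := by
      subst ey ez; unfold sideSign; simp; ring
    rw [e]; exact mul_neg_of_pos_of_neg D2 (mul_neg_of_pos_of_neg hM k3)

lemma coords (v a c w : Pt) (hD : sideSign v a c ≠ 0) :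
    w = v + (sideSign v w c / sideSign v a c) • (a - v) + (sideSign v a w / sideSign v a c) • (c - v) := by
  have e1 : w.1 = v.1 + (sideSign v w c / sideSign v a c) * (a.1 - v.1)
      + (sideSign v a w / sideSign v a c) * (c.1 - v.1) := by
    field_simp; unfold sideSign; ring
  have e2 : w.2 = v.2 + (sideSign v w c / sideSign v a c) * (a.2 - v.2)
      + (sideSign v a w / sideSign v a c) * (c.2 - v.2) := by
    field_simp; unfold sideSign; ring
  ext
  · simpa using e1
  · simpa using e2

lemma inT_coords (a v c w : Pt) (w1 w2 : ℝ) (hD : sideSign v a c ≠ 0)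
    (e : w = v + w1 • (a - v) + w2 • (c - v)) :
    InT a v c w ↔ (0 < w1 ∧ 0 < w2 ∧ w1 + w2 < 1) := by
  have e1 : sideSign a v w = - (sideSign v a c) * w2 := by
    subst e; unfold sideSign; simp; ring
  have e2 : sideSign v c w = - (sideSign v a c) * w1 := by
    subst e; unfold sideSign; simp; ring
  have e3 : sideSign c a w = - (sideSign v a c) * (1 - w1 - w2) := by
    subst e; unfold sideSign; simp; ring
  unfold InT
  rw [e1, e2, e3]
  rcases lt_or_gt_of_ne hD with h | h
  · have h' : 0 < - sideSign v a c := by linarith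
    simp only [mul_pos_iff_of_pos_left h', mul_neg_iff, not_lt_of_gt h', h', true_and, false_and, or_false]
    constructor
    · rintro (⟨a1, a2, a3⟩ | ⟨a1, a2, a3⟩)
      · exact ⟨a2, a1, by linarith⟩
      · exfalso; linarith
    · rintro ⟨a1, a2, a3⟩; exact Or.inl ⟨a2, a1, by linarith⟩
  · have h' : - sideSign v a c < 0 := by linarith
    simp only [mul_pos_iff, mul_neg_iff, not_lt_of_gt h', h', true_and, false_and, or_false, false_or]
    constructor
    · rintro (⟨a1, a2, a3⟩ | ⟨a1, a2, a3⟩)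
      · exfalso; linarith
      · exact ⟨a2, a1, by linarith⟩
    · rintro ⟨a1, a2, a3⟩; exact Or.inr ⟨a2, a1, by linarith⟩

lemma G1 (a v c u y z : Pt) (hD : sideSign v a c ≠ 0) (hu : InT a v c u)
    (hX : Xc v u y z) (h1 : ¬ Xc v a y z) (h2 : ¬ Xc v c y z)
    (hya : y = a ∨ sideSign v a y ≠ 0) (hyc : y = c ∨ sideSign v c y ≠ 0)
    (hza : z = a ∨ sideSign v a z ≠ 0) (hzc : z = c ∨ sideSign v c z ≠ 0)
    (hy : ¬ (InT a v c y ∧ |sideSign a c u| < |sideSign a c y|))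
    (hz : ¬ (InT a v c z ∧ |sideSign a c u| < |sideSign a c z|)) : False := by
  have eu := coords v a c u hD
  have ey := coords v a c y hD
  have ez := coords v a c z hD
  have sc : ∀ w : Pt, sideSign v c w = - sideSign v w c := fun w => ss_swap2 v w c
  have fa1 : y = a ∨ sideSign v a y / sideSign v a c ≠ 0 := hya.imp_right (fun h => div_ne_zero h hD)
  have fa2 : z = a ∨ sideSign v a z / sideSign v a c ≠ 0 := hza.imp_right (fun h => div_ne_zero h hD)
  have fc1 : y = c ∨ sideSign v y c / sideSign v a c ≠ 0 := hyc.imp_right (fun h => div_ne_zero (by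
    rw [sc] at h; exact neg_ne_zero.1 h) hD)
  have fc2 : z = c ∨ sideSign v z c / sideSign v a c ≠ 0 := hzc.imp_right (fun h => div_ne_zero (by
    rw [sc] at h; exact neg_ne_zero.1 h) hD)
  have ga : sideSign v a a = 0 := by unfold sideSign; ring
  have gc : sideSign v c c = 0 := by unfold sideSign; ring
  have sa : ∀ w, w = a → sideSign v w c / sideSign v a c = 1 := by
    rintro w rfl; exact div_self hD
  have sb : ∀ w, w = c → sideSign v a w / sideSign v a c = 1 := by
    rintro w rfl; exact div_self hD
  have sa' : ∀ w, w = a → sideSign v a w / sideSign v a c = 0 := by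
    rintro w rfl; rw [ga]; simp
  have sb' : ∀ w, w = c → sideSign v w c / sideSign v a c = 0 := by
    rintro w rfl; rw [gc]; simp
  have ty1 := sa y
  have ty2 := sa' y
  have ty3 := sb y
  have ty4 := sb' y
  have tz1 := sa z
  have tz2 := sa' z
  have tz3 := sb z
  have tz4 := sb' z
  clear sa sb sa' sb'
  generalize sideSign v u c / sideSign v a c = u1 at *
  generalize sideSign v a u / sideSign v a c = u2 at *
  generalize sideSign v y c / sideSign v a c = y1 at *
  generalize sideSign v a y / sideSign v a c = y2 at *
  generalize sideSign v z c / sideSign v a c = z1 at *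
  generalize sideSign v a z / sideSign v a c = z2 at *
  clear hya hyc hza hzc
  rw [inT_coords a v c u u1 u2 hD eu] at hu
  rw [inT_coords a v c y y1 y2 hD ey] at hy
  rw [inT_coords a v c z z1 z2 hD ez] at hz
  obtain ⟨hu1, hu2, hs⟩ := hu
  have lam : ∀ w w1 w2, w = v + w1 • (a - v) + w2 • (c - v) → sideSign a c w = - sideSign v a c * (w1 + w2 - 1) := by
    intro w w1 w2 e; rw [e]; unfold sideSign; simp; ring
  have D2 : 0 < sideSign v a c ^ 2 := by positivity
  have Dp : 0 < |sideSign v a c| := abs_pos.2 hD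
  have nn : ∀ w w1 w2, w = v + w1 • (a - v) + w2 • (c - v) → 
     ¬ ((0 < w1 ∧ 0 < w2 ∧ w1 + w2 < 1) ∧ |sideSign a c u| < |sideSign a c w|) → w1 + w2 < u1 + u2 → ¬ (0 < w1 ∧ 0 < w2) := by
    rintro w w1 w2 e h hlt ⟨p1, p2⟩
    apply h
    refine ⟨⟨p1, p2, by linarith⟩, ?_⟩
    rw [lam u u1 u2 eu, lam w w1 w2 e, abs_mul, abs_mul, abs_neg, abs_of_neg (by linarith : u1 + u2 - 1 < 0), abs_of_neg (by linarith : w1 + w2 - 1 < 0)]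
    exact mul_lt_mul_of_pos_left (by linarith) Dp
  have ny := nn y y1 y2 ey hy
  have nz := nn z z1 z2 ez hz
  clear nn
  have hX1 : (u1 * y2 - u2 * y1) * (u1 * z2 - u2 * z1) < 0 := by
    have e : sideSign v u y * sideSign v u z = sideSign v a c ^ 2 *
      ((u1 * y2 - u2 * y1) * (u1 * z2 - u2 * z1)) := by
      rw [eu, ey, ez]; unfold sideSign; simp; ring
    have := hX.1
    rw [e] at this
    exact (pos_iff_neg_of_mul_neg this).1 D2
  have hX2 : (y1 * z2 - y2 * z1) * (y1 * z2 - y2 * z1 - ((u1 * z2 - u2 * z1) - (u1 * y2 - u2 * y1))) < 0 := by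
    have e : sideSign y z v * sideSign y z u = sideSign v a c ^ 2 *
      ((y1 * z2 - y2 * z1) * (y1 * z2 - y2 * z1 - ((u1 * z2 - u2 * z1) - (u1 * y2 - u2 * y1)))) := by
      rw [eu, ey, ez]; unfold sideSign; simp; ring
    have := hX.2
    rw [e] at this
    exact (pos_iff_neg_of_mul_neg this).1 D2
  have hD' : sideSign v c a ≠ 0 := by rw [ss_swap2]; exact neg_ne_zero.2 hD
  have eu' : u = v + u2 • (c - v) + u1 • (a - v) := by rw [eu]; abel
  have ey' : y = v + y2 • (c - v) + y1 • (a - v) := by rw [ey]; abel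
  have ez' : z = v + z2 • (c - v) + z1 • (a - v) := by rw [ez]; abel
  have r2y : y1 + y2 < u1 + u2 → y2 ≠ 0 := by
    intro h; rcases fa1 with e | e
    · rw [ty1 e, ty2 e] at h; linarith
    · exact e
  have r1y : y1 + y2 < u1 + u2 → y1 ≠ 0 := by
    intro h; rcases fc1 with e | e
    · rw [ty3 e, ty4 e] at h; linarith
    · exact e
  have r2z : z1 + z2 < u1 + u2 → z2 ≠ 0 := by
    intro h; rcases fa2 with e | e
    · rw [tz1 e, tz2 e] at h; linarith
    · exact e
  have r1z : z1 + z2 < u1 + u2 → z1 ≠ 0 := by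
    intro h; rcases fc2 with e | e
    · rw [tz3 e, tz4 e] at h; linarith
    · exact e
  have sums : (u1 * z2 - u2 * z1) * (y1 + y2) - (u1 * y2 - u2 * y1) * (z1 + z2) =
    (u1 + u2) * (y1 * z2 - y2 * z1) := by ring
  clear ty1 ty2 ty3 ty4 tz1 tz2 tz3 tz4 fa1 fa2 fc1 fc2 eu ga gc sc hX lam
  have hσ0 : 0 < u1 + u2 := by positivity
  rcases mul_neg_iff.1 hX1 with ⟨q1, q2⟩ | ⟨q1, q2⟩
  · -- y on the c side
    rcases mul_neg_iff.1 hX2 with ⟨m1, m2⟩ | ⟨m1, m2⟩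
    · exfalso; linarith
    have hor : y1 + y2 < u1 + u2 ∨ z1 + z2 < u1 + u2 := by
      by_contra hc; push Not at hc; obtain ⟨c1, c2⟩ := hc
      nlinarith [mul_nonneg q1.le (sub_nonneg.2 c2), mul_nonneg (neg_nonneg.2 q2.le) (sub_nonneg.2 c1), mul_pos hσ0 m2]
    rcases hor with h | h
    · apply h2
      exact G1half c v a u y z u2 u1 y2 y1 z2 z1 hD' eu' ey' ez' hu2 hu1 (by linarith) (by linarith) (by linarith) (by linarith) (by linarith) (r1y h) (by linarith) (fun hh => ny h ⟨hh.2, hh.1⟩)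
    · apply h1
      rw [← Xc_swap2]
      have eu : u = v + u1 • (a - v) + u2 • (c - v) := by rw [eu']; abel
      exact G1half a v c u z y u1 u2 z1 z2 y1 y2 hD eu ez ey hu1 hu2 (by linarith) (by linarith) (by linarith) (by linarith) (by linarith) (r2z h) (by linarith) (nz h)
  · rcases mul_neg_iff.1 hX2 with ⟨m1, m2⟩ | ⟨m1, m2⟩
    swap
    · exfalso; linarith
    have hor : y1 + y2 < u1 + u2 ∨ z1 + z2 < u1 + u2 := by
      by_contra hc; push Not at hc; obtain ⟨c1, c2⟩ := hc
      nlinarith [mul_nonneg q2.le (sub_nonneg.2 c1), mul_nonneg (neg_nonneg.2 q1.le) (sub_nonneg.2 c2), mul_neg_of_pos_of_neg hσ0 m2]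
    rcases hor with h | h
    · apply h1
      have eu : u = v + u1 • (a - v) + u2 • (c - v) := by rw [eu']; abel
      exact G1half a v c u y z u1 u2 y1 y2 z1 z2 hD eu ey ez hu1 hu2 (by linarith) (by linarith) (by linarith) (by linarith) (by linarith) (r2y h) (by linarith) (ny h)
    · apply h2
      rw [← Xc_swap2]
      exact G1half c v a u z y u2 u1 z2 z1 y2 y1 hD' eu' ez' ey' hu2 hu1 (by linarith) (by linarith) (by linarith) (by linarith) (by linarith) (r1z h) (by linarith) (fun hh => nz h ⟨hh.2, hh.1⟩)

def GPs (V : Set Pt) : Prop :=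
  ∀ a ∈ V, ∀ b ∈ V, ∀ c ∈ V, a ≠ b → a ≠ c → b ≠ c → sideSign a b c ≠ 0

lemma Xc_ne (a b c d : Pt) (h : Xc a b c d) : a ≠ c ∧ a ≠ d ∧ b ≠ c ∧ b ≠ d := by
  unfold Xc at h
  refine ⟨?_, ?_, ?_, ?_⟩ <;> rintro rfl <;> obtain ⟨h1, h2⟩ := h <;> unfold sideSign at h1 <;> ring_nf at h1 <;> simp at h1

lemma two0 : (2 : ZMod 2) = 0 := rfl

open Classical in
lemma gfour {V : Set Pt} (hG : GPs V) {a b x y : Pt} (ha : a ∈ V) (hb : b ∈ V) (hx : x ∈ V) (hy : y ∈ V)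
    (h1 : a ≠ b) (h2 : a ≠ x) (h3 : a ≠ y) (h4 : b ≠ x) (h5 : b ≠ y) (h6 : x ≠ y) :
    gg a b x + gg a b y + hh x y a + hh x y b = if Xc a b x y then 1 else 0 :=
  four a b x y (hG _ ha _ hb _ hx h1 h2 h4) (hG _ ha _ hb _ hy h1 h3 h5)
    (hG _ hx _ hy _ ha h6 h2.symm h3.symm) (hG _ hx _ hy _ hb h6 h4.symm h5.symm)

open Classical in
lemma ggt {V : Set Pt} (hG : GPs V) {a b c z : Pt} (ha : a ∈ V) (hb : b ∈ V) (hc : c ∈ V) (hz : z ∈ V)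
    (h1 : a ≠ b) (h2 : a ≠ c) (h3 : b ≠ c) (h4 : a ≠ z) (h5 : b ≠ z) (h6 : c ≠ z) :
    gg a b z + gg b c z + gg c a z = if InT a b c z then 1 else 0 :=
  gg_tri a b c z (hG _ ha _ hb _ hz h1 h4 h5) (hG _ hb _ hc _ hz h3 h5 h6)
    (hG _ hc _ ha _ hz h2.symm h6 h4)

lemma G2 {V : Set Pt} (hG : GPs V) {a v c y z : Pt} (ha : a ∈ V) (hv : v ∈ V) (hc : c ∈ V)
    (hy : y ∈ V) (hz : z ∈ V) (h1 : a ≠ v) (h2 : a ≠ c) (h3 : v ≠ c) (h4 : y ≠ z)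
    (hvy : v ≠ y) (hvz : v ≠ z) (hX : Xc a c y z) (hX1 : ¬ Xc a v y z) (hX2 : ¬ Xc v c y z)
    (ny : ¬ InT a v c y) (nz : ¬ InT a v c z) : False := by
  obtain ⟨e1, e2, e3, e4⟩ := Xc_ne _ _ _ _ hX
  have f1 := gfour hG ha hv hy hz h1 e1 e2 hvy hvz h4
  have f2 := gfour hG hv hc hy hz h3 hvy hvz e3 e4 h4
  have f3 := gfour hG hc ha hy hz h2.symm e3 e4 e1 e2 h4
  have t1 := ggt hG ha hv hc hy h1 h2 h3 e1 hvy e3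
  have t2 := ggt hG ha hv hc hz h1 h2 h3 e2 hvz e4
  rw [if_neg hX1] at f1
  rw [if_neg hX2] at f2
  rw [if_pos ((Xc_swap1 _ _ _ _).2 hX)] at f3
  rw [if_neg ny] at t1
  rw [if_neg nz] at t2
  have : (0 : ZMod 2) = 1 := by
    linear_combination f1 + f2 + f3 - t1 - t2 - (hh y z a + hh y z v + hh y z c) * two0
  exact absurd this (by decide)

lemma InT_sgn (a v c u : Pt) (h : InT a v c u) :
    0 < sideSign a v c * sideSign a v u ∧ 0 < sideSign a v c * sideSign v c u ∧
    0 < sideSign a v c * sideSign c a u := by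
  have e : sideSign a v c = sideSign a v u + sideSign v c u + sideSign c a u := by
    unfold sideSign; ring
  rcases h with ⟨h1, h2, h3⟩ | ⟨h1, h2, h3⟩
  · have : 0 < sideSign a v c := by linarith
    exact ⟨mul_pos this h1, mul_pos this h2, mul_pos this h3⟩
  · have : sideSign a v c < 0 := by linarith
    exact ⟨mul_pos_of_neg_of_neg this h1, mul_pos_of_neg_of_neg this h2, mul_pos_of_neg_of_neg this h3⟩

lemma InT_ne (a v c u : Pt) (h : InT a v c u) : a ≠ u ∧ v ≠ u ∧ c ≠ u := by
  obtain ⟨h1, h2, h3⟩ := InT_sgn a v c u h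
  refine ⟨?_, ?_, ?_⟩ <;> rintro rfl <;> unfold sideSign at h1 h2 h3 <;> ring_nf at h1 h2 h3 <;> simp at h1 h2 h3

lemma InT_rot (a v c u : Pt) : InT v c a u ↔ InT a v c u := by
  unfold InT; tauto

lemma InT_flip (a v c u : Pt) : InT c v a u ↔ InT a v c u := by
  unfold InT
  rw [ss_swap v c, ss_swap a v, ss_swap c a]
  constructor <;> rintro (⟨h1, h2, h3⟩ | ⟨h1, h2, h3⟩) <;>
  first
  | (left; exact ⟨by linarith, by linarith, by linarith⟩)
  | (right; exact ⟨by linarith, by linarith, by linarith⟩)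

lemma sm1 (a v c u : Pt) (h : InT a v c u) : ¬ Xc u c a v := by
  obtain ⟨h1, h2, h3⟩ := InT_sgn a v c u h
  rintro ⟨_, h⟩
  linarith

lemma sm2 (a v c u : Pt) (h : InT a v c u) : ¬ Xc u a v c := by
  rw [← Xc_swap2]
  exact sm1 c v a u ((InT_flip _ _ _ _).2 h)

lemma sm3 (a v c u : Pt) (h : InT a v c u) : ¬ Xc c a v u := by
  obtain ⟨h1, h2, h3⟩ := InT_sgn a v c u h
  rintro ⟨h, _⟩
  rw [ss_rot v c a, ss_rot a v c] at h
  linarith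

lemma sm4 (a v c u : Pt) (h : InT a v c u) : ¬ InT v c u a := by
  obtain ⟨h1, h2, h3⟩ := InT_sgn a v c u h
  intro h'
  obtain ⟨g1, g2, g3⟩ := InT_sgn v c u a h'
  have e1 : sideSign v c a = sideSign a v c := ss_rot a v c
  have e2 : sideSign u v a = - sideSign a v u := by unfold sideSign; ring
  rw [e1] at g1
  rw [e2] at g3
  have p1 : 0 < sideSign a v c ^ 2 * (sideSign v c u * sideSign a v u) := by nlinarith [mul_pos h1 h2]
  have p2 : sideSign v c u * sideSign a v u < 0 := by linarith
  nlinarith [sq_nonneg (sideSign a v c), mul_nonneg (sq_nonneg (sideSign a v c)) (neg_nonneg.2 p2.le)]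

lemma sm5 (a v c u : Pt) (h : InT a v c u) : ¬ InT a v u c := by
  intro h'
  apply sm4 c v a u ((InT_flip _ _ _ _).2 h)
  rw [InT_rot]
  rw [InT_flip, InT_rot]
  exact (InT_rot _ _ _ _).1 h'

def pth (w : ℕ → Pt) (i j : ℕ) (z : Pt) : ZMod 2 :=
  ∑ x ∈ Finset.Ico i j, gg (w x) (w (x + 1)) z

def pq (w : ℕ → Pt) (i j : ℕ) (z : Pt) : ZMod 2 := pth w i j z + gg (w j) (w i) z

lemma pth_succ (w : ℕ → Pt) (i j : ℕ) (h : i ≤ j) (z : Pt) :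
    pth w i (j + 1) z = pth w i j z + gg (w j) (w (j + 1)) z := by
  unfold pth; rw [Finset.sum_Ico_succ_top h]

lemma pth_first (w : ℕ → Pt) (i j : ℕ) (h : i < j) (z : Pt) :
    pth w i j z = gg (w i) (w (i + 1)) z + pth w (i + 1) j z := by
  unfold pth; rw [Finset.sum_eq_sum_Ico_succ_bot h]

lemma pth_add (w : ℕ → Pt) (i j k : ℕ) (h : i ≤ j) (h' : j ≤ k) (z : Pt) :
    pth w i k z = pth w i j z + pth w j k z := by
  unfold pth; rw [Finset.sum_Ico_consecutive _ h h']

lemma pth_self (w : ℕ → Pt) (i : ℕ) (z : Pt) : pth w i i z = 0 := by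
  unfold pth; simp

lemma Dpath {V : Set Pt} (hG : GPs V) (w : ℕ → Pt) (i j : ℕ) (hij : i ≤ j) {y z : Pt} (hy : y ∈ V)
    (hz : z ∈ V) (hyz : y ≠ z) (hw : ∀ x, i ≤ x → x ≤ j → w x ∈ V ∧ w x ≠ y ∧ w x ≠ z)
    (hs : ∀ x, i ≤ x → x < j → w x ≠ w (x + 1) ∧ ¬ Xc (w x) (w (x + 1)) y z) :
    pth w i j y + pth w i j z = hh y z (w i) + hh y z (w j) := by
  induction j, hij using Nat.le_induction with
  | base => rw [pth_self, pth_self]; linear_combination - hh y z (w i) * two0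
  | succ j hij ih =>
    have ih := ih (fun x h h' => hw x h (by omega)) (fun x h h' => hs x h (by omega))
    rw [pth_succ _ _ _ hij, pth_succ _ _ _ hij]
    obtain ⟨a1, a2, a3⟩ := hw j hij (by omega)
    obtain ⟨b1, b2, b3⟩ := hw (j + 1) (by omega) le_rfl
    obtain ⟨c1, c2⟩ := hs j hij (by omega)
    have := gfour hG a1 b1 hy hz c1 a2 a3 b2 b3 hyz
    rw [if_neg c2] at this
    linear_combination ih + this - hh y z (w (j + 1)) * two0

open Classical in
lemma Dclosed {V : Set Pt} (hG : GPs V) (w : ℕ → Pt) (i j : ℕ) (hij : i ≤ j) {y z : Pt} (hy : y ∈ V)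
    (hz : z ∈ V) (hyz : y ≠ z) (hw : ∀ x, i ≤ x → x ≤ j → w x ∈ V ∧ w x ≠ y ∧ w x ≠ z)
    (hs : ∀ x, i ≤ x → x < j → w x ≠ w (x + 1) ∧ ¬ Xc (w x) (w (x + 1)) y z) (hne : w i ≠ w j) :
    pq w i j y + pq w i j z = if Xc (w j) (w i) y z then 1 else 0 := by
  have h1 := Dpath hG w i j hij hy hz hyz hw hs
  obtain ⟨a1, a2, a3⟩ := hw i le_rfl hij
  obtain ⟨b1, b2, b3⟩ := hw j hij le_rfl
  have := gfour hG b1 a1 hy hz hne.symm b2 b3 a2 a3 hyz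
  unfold pq
  rw [← this]
  linear_combination h1

lemma pth_right (w : ℕ → Pt) (i j : ℕ) (v : Pt) (h : ∀ x, (w x).1 ≤ v.1) : pth w i j v = 0 := by
  unfold pth
  exact Finset.sum_eq_zero (fun x _ => gg_right _ _ _ (h _) (h _))

lemma pq_right (w : ℕ → Pt) (i j : ℕ) (v : Pt) (h : ∀ x, (w x).1 ≤ v.1) : pq w i j v = 0 := by
  unfold pq
  rw [pth_right _ _ _ _ h, gg_right _ _ _ (h _) (h _), add_zero]

lemma gg_cancel (a b z : Pt) : gg a b z + gg b a z = 0 := by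
  rw [gg_symm b a]; linear_combination gg a b z * two0

lemma zm2 (a b : ZMod 2) (h : a + b = 0) (hb : b = 0) : a = 0 := by rw [hb, add_zero] at h; exact h

lemma zm2' (a b : ZMod 2) (h : a + b = 0) (hb : a = 0) : b = 0 := by rw [hb, zero_add] at h; exact h

set_option maxHeartbeats 1000000 in
lemma Split {V : Set Pt} (hG : GPs V) (hV : V.Finite) (E : Pt → Pt → Prop) (w : ℕ → Pt) (N n : ℕ)
    (hN : 4 ≤ N) (hwV : ∀ x, w x ∈ V) (hper : ∀ x, w (x + N) = w x)
    (hinj : ∀ x y, x < y → y < x + N → w x ≠ w y)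
    (hEV : ∀ y z, E y z → y ∈ V ∧ z ∈ V ∧ y ≠ z) (hEs : ∀ y z, E y z → E z y)
    (hWC : ∀ x y z, E y z → ¬ Xc (w x) (w (x + 1)) y z)
    (hWW : ∀ x y, ¬ Xc (w x) (w (x + 1)) (w y) (w (y + 1)))
    (hEW : ∀ r, n ≤ r → r < n + N → E (w (n + 1)) (w r) → w r = w n ∨ w r = w (n + 2))
    (hpk : ∀ y ∈ V, (∀ r, n ≤ r → r < n + N → w r ≠ y) → pth w n (n + N) y = 0)
    (hmax : ∀ x, (w x).1 ≤ (w (n + 1)).1) :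
    ∃ x y, (x = n ∨ x = n + 1) ∧ x + 2 ≤ y ∧ y + 2 ≤ x + N ∧
      (∀ a b, E a b → ¬ Xc (w x) (w y) a b) ∧
      (∀ r, y < r → r < x + N → pq w x y (w r) = 0) ∧
      (∀ r, x < r → r < y → pq w y (x + N) (w r) = 0) := by
  classical
  have hvm : w (n + N) = w n := hper n
  have hv1 : w (n + 1 + N) = w (n + 1) := hper (n + 1)
  have d01 : w n ≠ w (n + 1) := hinj _ _ (by omega) (by omega)
  have d02 : w n ≠ w (n + 2) := hinj _ _ (by omega) (by omega)
  have d12 : w (n + 1) ≠ w (n + 2) := hinj _ _ (by omega) (by omega)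
  have mm := hwV n
  have mv := hwV (n + 1)
  have mp := hwV (n + 2)
  -- f_U
  have fU : ∀ z, pq w n (n + 2) z = gg (w n) (w (n + 1)) z + gg (w (n + 1)) (w (n + 2)) z + gg (w (n + 2)) (w n) z := by
    intro z; unfold pq
    rw [pth_succ w n (n + 1) (by omega), pth_succ w n n le_rfl, pth_self]; ring
  have fW : ∀ z, pth w n (n + N) z = pq w n (n + 2) z + pq w (n + 2) (n + N) z := by
    intro z; rw [pth_add w n (n + 2) (n + N) (by omega) (by omega)]
    unfold pq
    rw [hvm]
    linear_combination - gg_cancel (w (n + 2)) (w n) z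
  have fW' : pq w (n + 2) (n + N) (w (n + 1)) = 0 := pq_right _ _ _ _ hmax
  have chainD : ∀ r, n + 2 ≤ r → r ≤ n + N → w r ≠ w (n + 1) := by
    intro r h1 h2 h
    exact hinj (n + 1) r (by omega) (by omega) h.symm
  have dd : ∀ x, w x ≠ w (x + 1) := fun x => hinj _ _ (by omega) (by omega)
  have ndN : w (n + 2) ≠ w (n + N) := by rw [hvm]; exact d02.symm
  by_cases hin : ∃ u ∈ V, InT (w n) (w (n + 1)) (w (n + 2)) u
  swap
  · push Not at hin
    have key : ∀ z, E (w (n + 1)) z → ¬ Xc (w n) (w (n + 2)) (w (n + 1)) z := by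
      intro z hE hX
      obtain ⟨_, hz, hne⟩ := hEV _ _ hE
      obtain ⟨_, e2, _, e4⟩ := Xc_ne _ _ _ _ hX
      have hout : ∀ r, n ≤ r → r < n + N → w r ≠ z := by
        intro r h1 h2 h
        subst h
        rcases hEW r h1 h2 hE with h | h
        · exact e2 h.symm
        · exact e4 h.symm
      have t0 := hpk z hz hout
      rw [fW, fU, ggt hG mm mv mp hz d01 d02 d12 e2 hne e4, if_neg (hin z hz)] at t0
      have t1 := Dclosed hG w (n + 2) (n + N) (by omega) mv hz hne (by
        intro x h1 h2
        refine ⟨hwV x, chainD x h1 h2, ?_⟩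
        rcases Nat.lt_or_ge x (n + N) with h | h
        · exact hout x (by omega) h
        · have : x = n + N := by omega
          rw [this, hvm]; exact e2) (fun x _ _ => ⟨dd x, hWC x _ _ hE⟩) ndN
      rw [hvm, if_pos hX, fW'] at t1
      rw [zero_add] at t0 t1
      rw [t0] at t1
      exact absurd t1 (by decide)
    refine ⟨n, n + 2, Or.inl rfl, le_rfl, by omega, ?_, ?_, ?_⟩
    · intro y z hE hX
      obtain ⟨hy, hz, hne⟩ := hEV _ _ hE
      by_cases c1 : y = w (n + 1)
      · subst c1; exact key z hE hX
      by_cases c2 : z = w (n + 1)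
      · subst c2; exact key y (hEs _ _ hE) ((Xc_swap2 _ _ _ _).2 hX)
      exact G2 hG mm mv mp hy hz d01 d02 d12 hne (Ne.symm c1) (Ne.symm c2) hX (hWC n _ _ hE)
        (hWC (n + 1) _ _ hE) (hin y hy) (hin z hz)
    · intro r h1 h2
      rw [fU, ggt hG mm mv mp (hwV r) d01 d02 d12 (hinj _ _ (by omega) (by omega)) (hinj _ _ (by omega) (by omega)) (hinj _ _ (by omega) (by omega)), if_neg (hin _ (hwV r))]
    · intro r h1 h2
      have : r = n + 1 := by omega
      subst this; exact fW'
  · -- choose u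
    let S : Set Pt := {u ∈ V | InT (w n) (w (n + 1)) (w (n + 2)) u}
    have hS : S.Finite := hV.subset (fun u h => h.1)
    have hSn : S.Nonempty := by obtain ⟨u, h1, h2⟩ := hin; exact ⟨u, h1, h2⟩
    obtain ⟨u, ⟨hu, hI⟩, hum⟩ := Set.exists_max_image S (fun q => |sideSign (w n) (w (n + 2)) q|) hS hSn
    obtain ⟨e1, e2, e3⟩ := InT_ne _ _ _ _ hI
    have lamc : ∀ y ∈ V, ¬ (InT (w n) (w (n + 1)) (w (n + 2)) y ∧
        |sideSign (w n) (w (n + 2)) u| < |sideSign (w n) (w (n + 2)) y|) := by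
      rintro y hy ⟨h1, h2⟩
      have := hum y ⟨hy, h1⟩
      exact absurd this (not_le.2 h2)
    have hD : sideSign (w (n + 1)) (w n) (w (n + 2)) ≠ 0 := hG _ mv _ mm _ mp d01.symm d12 d02
    have noX : ∀ y ∈ V, ∀ z ∈ V, ¬ Xc (w n) (w (n + 1)) y z → ¬ Xc (w (n + 1)) (w (n + 2)) y z →
        ¬ Xc (w (n + 1)) u y z := by
      intro y hy z hz h1 h2 hX
      obtain ⟨g1, g2, _, _⟩ := Xc_ne _ _ _ _ hX
      refine G1 (w n) (w (n + 1)) (w (n + 2)) u y z hD hI hX (by rwa [Xc_swap1]) h2 ?_ ?_ ?_ ?_ (lamc y hy) (lamc z hz)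
      · by_cases h : y = w n
        · exact Or.inl h
        · exact Or.inr (hG _ mv _ mm _ hy d01.symm g1 (Ne.symm h))
      · by_cases h : y = w (n + 2)
        · exact Or.inl h
        · exact Or.inr (hG _ mv _ mp _ hy d12 g1 (Ne.symm h))
      · by_cases h : z = w n
        · exact Or.inl h
        · exact Or.inr (hG _ mv _ mm _ hz d01.symm g2 (Ne.symm h))
      · by_cases h : z = w (n + 2)
        · exact Or.inl h
        · exact Or.inr (hG _ mv _ mp _ hz d12 g2 (Ne.symm h))
    have noXW : ∀ x, ¬ Xc (w (n + 1)) u (w x) (w (x + 1)) := fun x =>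
      noX _ (hwV x) _ (hwV (x + 1)) (hWW n x) (hWW (n + 1) x)
    have hWu : ∃ r, n ≤ r ∧ r < n + N ∧ w r = u := by
      by_contra hc
      push Not at hc
      have t0 := hpk u hu hc
      rw [fW, fU, ggt hG mm mv mp hu d01 d02 d12 e1 e2 e3, if_pos hI] at t0
      have t1 := Dclosed hG w (n + 2) (n + N) (by omega) mv hu e2 (by
        intro x h1 h2
        refine ⟨hwV x, chainD x h1 h2, ?_⟩
        rcases Nat.lt_or_ge x (n + N) with h | h
        · exact hc x (by omega) h
        · have : x = n + N := by omega
          rw [this, hvm]; exact e1) (fun x _ _ => ⟨dd x, by rw [Xc_comm]; exact noXW x⟩) ndN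
      rw [hvm, if_neg (by rw [Xc_swap1]; exact sm3 _ _ _ _ hI), fW', zero_add] at t1
      rw [t1] at t0
      exact absurd t0 (by decide)
    obtain ⟨r, hr1, hr2, rfl⟩ := hWu
    have hr3 : n + 2 < r := by
      by_contra hc
      have : r = n ∨ r = n + 1 ∨ r = n + 2 := by omega
      rcases this with rfl | rfl | rfl
      · exact e1 rfl
      · exact e2 rfl
      · exact e3 rfl
    have mu := hwV r
    refine ⟨n + 1, r, Or.inr rfl, by omega, by omega, ?_, ?_, ?_⟩
    · intro y z hE
      obtain ⟨hy, hz, hne⟩ := hEV _ _ hE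
      exact noX y hy z hz (hWC n _ _ hE) (hWC (n + 1) _ _ hE)
    · -- Q1
      have base : pq w (n + 1) r (w (n + N)) = 0 := by
        rw [hvm]
        have a1 : pq w (n + 1) r (w n) = (gg (w (n + 1)) (w (n + 2)) (w n) + gg (w (n + 2)) (w r) (w n)
            + gg (w r) (w (n + 1)) (w n)) + pq w (n + 2) r (w n) := by
          unfold pq; rw [pth_first w (n + 1) r (by omega)]
          linear_combination - gg_cancel (w (n + 2)) (w r) (w n)
        rw [a1, ggt hG mv mp mu mm d12 e2 e3 d01.symm d02.symm e1.symm, if_neg (sm4 _ _ _ _ hI), zero_add]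
        have a2 := Dclosed hG w (n + 2) r (by omega) mm mv d01 (by
          intro x h1 h2
          exact ⟨hwV x, (hinj n x (by omega) (by omega)).symm, chainD x h1 (by omega)⟩)
          (fun x _ _ => ⟨dd x, hWW x n⟩) e3
        rw [if_neg (sm1 _ _ _ _ hI), pq_right w _ _ _ hmax, add_zero] at a2
        exact a2
      have step : ∀ d s, s + d = n + N → r < s → pq w (n + 1) r (w s) = 0 := by
        intro d
        induction d with
        | zero => intro s h1 h2; rw [show s = n + N by omega]; exact base
        | succ d ih =>
          intro s h1 h2
          have g := ih (s + 1) (by omega) (by omega)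
          have a2 := Dclosed hG w (n + 1) r (by omega) (hwV s) (hwV (s + 1)) (dd s) (by
            intro x h1 h2
            exact ⟨hwV x, hinj x _ (by omega) (by omega), hinj x _ (by omega) (by omega)⟩)
            (fun x _ _ => ⟨dd x, hWW x s⟩) e2
          rw [if_neg (by rw [Xc_swap1]; exact noXW s)] at a2
          exact zm2 _ _ a2 g
      intro s h1 h2
      exact step (n + N - s) s (by omega) h1
    · have base : pq w r (n + 1 + N) (w (n + 2)) = 0 := by
        have a1 : pq w r (n + 1 + N) (w (n + 2)) = (gg (w n) (w (n + 1)) (w (n + 2)) + gg (w (n + 1)) (w r) (w (n + 2))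
            + gg (w r) (w n) (w (n + 2))) + pq w r (n + N) (w (n + 2)) := by
          unfold pq; rw [show n + 1 + N = (n + N) + 1 by ring, pth_succ w r (n + N) (by omega), hvm,
            show (n + N) + 1 = n + 1 + N by ring, hv1]
          linear_combination - gg_cancel (w n) (w r) (w (n + 2))
        rw [a1, ggt hG mm mv mu mp d01 e1 e2 d02 d12 e3.symm, if_neg (sm5 _ _ _ _ hI), zero_add]
        have a2 := Dclosed hG w r (n + N) (by omega) mp mv d12.symm (by
          intro x h1 h2
          exact ⟨hwV x, (hinj (n + 2) x (by omega) (by omega)).symm, chainD x (by omega) (by omega)⟩)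
          (fun x _ _ => ⟨dd x, by rw [Xc_swap2]; exact hWW x (n + 1)⟩) (by rw [hvm]; exact e1.symm)
        rw [hvm, if_neg (by rw [Xc_swap2, Xc_swap1]; exact sm2 _ _ _ _ hI), pq_right w _ _ _ hmax, add_zero] at a2
        exact a2
      have step : ∀ d, n + 2 + d < r → pq w r (n + 1 + N) (w (n + 2 + d)) = 0 := by
        intro d
        induction d with
        | zero => intro h2; exact base
        | succ d ih =>
          intro h2
          have g := ih (by omega)
          have a2 := Dclosed hG w r (n + 1 + N) (by omega) (hwV (n + 2 + d)) (hwV (n + 2 + d + 1)) (dd _) (by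
            intro x h1 h2
            exact ⟨hwV x, (hinj _ x (by omega) (by omega)).symm, (hinj _ x (by omega) (by omega)).symm⟩)
            (fun x _ _ => ⟨dd x, hWW x _⟩) (by rw [hv1]; exact e2.symm)
          rw [hv1, if_neg (noXW _)] at a2
          exact zm2' _ _ a2 g
      intro s h1 h2
      have := step (s - (n + 2)) (by omega)
      rwa [show n + 2 + (s - (n + 2)) = s by omega] at this

lemma per_mul (w : ℕ → Pt) (N : ℕ) (hper : ∀ x, w (x + N) = w x) (x q : ℕ) : w (x + N * q) = w x := by
  induction q with
  | zero => simp
  | succ q ih => rw [Nat.mul_succ, ← Nat.add_assoc, hper, ih]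

lemma per_rep (w : ℕ → Pt) (N n : ℕ) (hN : 0 < N) (hper : ∀ x, w (x + N) = w x) (x : ℕ) :
    ∃ r, n ≤ r ∧ r < n + N ∧ w r = w x := by
  refine ⟨n + (x + (N - 1) * n) % N, by omega, by have := Nat.mod_lt (x + (N - 1) * n) hN; omega, ?_⟩
  have h := Nat.mod_add_div (x + (N - 1) * n) N
  rw [← per_mul w N hper _ ((x + (N - 1) * n) / N), ← per_mul w N hper x n]
  congr 1
  obtain ⟨M, rfl⟩ : ∃ M, N = M + 1 := ⟨N - 1, by omega⟩
  simp only [Nat.add_sub_cancel] at *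
  rw [Nat.add_assoc, h]; ring

lemma pth_shift (w : ℕ → Pt) (N i j : ℕ) (hper : ∀ x, w (x + N) = w x) (z : Pt) :
    pth w (i + N) (j + N) z = pth w i j z := by
  unfold pth
  rw [← Finset.sum_Ico_add' (fun x => gg (w x) (w (x + 1)) z) i j N]
  apply Finset.sum_congr rfl
  intro x _
  show gg (w (x + N)) (w (x + N + 1)) z = _
  rw [hper, show x + N + 1 = x + 1 + N by ring, hper]

lemma pq_shift (w : ℕ → Pt) (N i j : ℕ) (hper : ∀ x, w (x + N) = w x) (z : Pt) :
    pq w (i + N) (j + N) z = pq w i j z := by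
  unfold pq; rw [pth_shift w N i j hper, hper, hper]

lemma pth_round (w : ℕ → Pt) (N n : ℕ) (hper : ∀ x, w (x + N) = w x) (z : Pt) :
    pth w n (n + N) z = pth w 0 N z := by
  have h1 := pth_add w 0 n (n + N) (by omega) (by omega) z
  have h2 := pth_add w 0 N (n + N) (by omega) (by omega) z
  have h3 := pth_shift w N 0 n hper z
  rw [Nat.zero_add] at h3
  rw [h3, h1] at h2
  linear_combination h2

lemma SplitN {V : Set Pt} (hG : GPs V) (hV : V.Finite) (E : Pt → Pt → Prop) (w : ℕ → Pt) (N : ℕ)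
    (hN : 4 ≤ N) (hwV : ∀ x, w x ∈ V) (hper : ∀ x, w (x + N) = w x)
    (hinj : ∀ x y, x < y → y < x + N → w x ≠ w y)
    (hEV : ∀ y z, E y z → y ∈ V ∧ z ∈ V ∧ y ≠ z) (hEs : ∀ y z, E y z → E z y)
    (hWC : ∀ x y z, E y z → ¬ Xc (w x) (w (x + 1)) y z)
    (hWW : ∀ x y, ¬ Xc (w x) (w (x + 1)) (w y) (w (y + 1)))
    (hEW : ∀ n r, E (w (n + 1)) (w r) → w r = w n ∨ w r = w (n + 2))
    (hpk : ∀ y ∈ V, (∀ r, w r ≠ y) → pth w 0 N y = 0) :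
    ∃ a b, b < N ∧ a + 2 ≤ b ∧ b + 2 ≤ a + N ∧
      (∀ y z, E y z → ¬ Xc (w a) (w b) y z) ∧
      (∀ r, b < r → r < a + N → pq w a b (w r) = 0) ∧
      (∀ r, a < r → r < b → pq w b (a + N) (w r) = 0) := by
  obtain ⟨n, hn, hnm⟩ : ∃ n < N, ∀ x, (w x).1 ≤ (w (n + 1)).1 := by
    obtain ⟨n, hn, h⟩ := Finset.exists_max_image (Finset.range N) (fun i => (w (i + 1)).1)
      ⟨0, Finset.mem_range.2 (by omega)⟩
    refine ⟨n, Finset.mem_range.1 hn, fun x => ?_⟩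
    obtain ⟨r, h1, h2, h3⟩ := per_rep w N 1 (by omega) hper x
    have := h (r - 1) (Finset.mem_range.2 (by omega))
    rw [show r - 1 + 1 = r by omega, h3] at this
    exact this
  obtain ⟨x, y, hx, h1, h2, hC, hA, hB⟩ := Split hG hV E w N n hN hwV hper hinj hEV hEs hWC hWW
    (fun r _ _ h => hEW n r h) (by
      intro y hy h
      rw [pth_round w N n hper]
      apply hpk y hy
      intro r hr
      obtain ⟨s, s1, s2, s3⟩ := per_rep w N n (by omega) hper r
      exact h s s1 s2 (s3.trans hr)) hnm
  rcases Nat.lt_or_ge y N with hy | hy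
  · exact ⟨x, y, hy, h1, h2, hC, hA, hB⟩
  obtain ⟨c, rfl⟩ : ∃ c, y = c + N := ⟨y - N, by omega⟩
  rcases Nat.lt_or_ge x N with hxN | hxN
  · refine ⟨c, x, hxN, by omega, by omega, ?_, ?_, ?_⟩
    · intro p q hE
      rw [Xc_swap1]
      have := hC p q hE
      rwa [hper] at this
    · intro r r1 r2
      have := hB r r1 r2
      rwa [pq_shift w N c x hper] at this
    · intro r r1 r2
      have := hA (r + N) (by omega) (by omega)
      rwa [hper] at this
  · obtain ⟨d, rfl⟩ : ∃ d, x = d + N := ⟨x - N, by omega⟩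
    refine ⟨d, c, by omega, by omega, by omega, ?_, ?_, ?_⟩
    · intro p q hE
      have := hC p q hE
      rwa [hper, hper] at this
    · intro r r1 r2
      have := hA (r + N) (by omega) (by omega)
      rwa [hper, pq_shift w N d c hper] at this
    · intro r r1 r2
      have := hB (r + N) (by omega) (by omega)
      rwa [hper, pq_shift w N c (d + N) hper] at this

structure PolyC (t : ℕ) (p : ℕ → Pt) : Prop where
  ht : 3 ≤ t
  per : ∀ x, p (x + t) = p x
  inj : ∀ x y, x < y → y < x + t → p x ≠ p y
  gp : GPs (Set.range p)
  noX : ∀ x y, ¬ Xc (p x) (p (x + 1)) (p y) (p (y + 1))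

def Clr (p : ℕ → Pt) (P Q : Pt) : Prop := ∀ z, ¬ Xc P Q (p z) (p (z + 1))

lemma Clr_symm {p : ℕ → Pt} {P Q : Pt} (h : Clr p P Q) : Clr p Q P := by
  intro z; rw [Xc_swap1]; exact h z

def ff (p : ℕ → Pt) (o k l : ℕ) (z : Pt) : ZMod 2 :=
  gg (p o) (p k) z + pth p k l z + gg (p l) (p o) z

def JJ (t : ℕ) (p : ℕ → Pt) (o k l : ℕ) : Prop :=
  o < k ∧ k < l ∧ l < o + t ∧ Clr p (p o) (p k) ∧ Clr p (p l) (p o) ∧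
    ∀ z, (o < z ∧ z < k) ∨ (l < z ∧ z < o + t) → ff p o k l (p z) = 0

lemma PolyC.ne {t : ℕ} {p : ℕ → Pt} (P : PolyC t p) (x y : ℕ) (h : x ≠ y) (h1 : x < y + t) (h2 : y < x + t) :
    p x ≠ p y := by
  rcases Nat.lt_or_ge x y with h' | h'
  · exact P.inj x y h' h2
  · exact (P.inj y x (by omega) h1).symm

lemma cst1 {t : ℕ} {p : ℕ → Pt} (P : PolyC t p) {o k l : ℕ} (h1 : o < k) (h2 : k < l) (h3 : l < o + t)
    (c1 : Clr p (p o) (p k)) (c2 : Clr p (p l) (p o)) (z : ℕ)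
    (hz : (o < z ∧ z + 1 < k) ∨ (l < z ∧ z + 1 < o + t)) : ff p o k l (p z) = ff p o k l (p (z + 1)) := by
  have m : ∀ x, p x ∈ Set.range p := fun x => ⟨x, rfl⟩
  have D := Dpath P.gp p k l h2.le (m z) (m (z + 1)) (P.ne _ _ (by omega) (by omega) (by have := P.ht; omega)) (by
    intro x x1 x2
    exact ⟨m x, P.ne _ _ (by omega) (by omega) (by omega), P.ne _ _ (by omega) (by omega) (by omega)⟩)
    (fun x _ _ => ⟨P.ne _ _ (by omega) (by omega) (by have := P.ht; omega), P.noX x z⟩)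
  have f1 := gfour P.gp (m o) (m k) (m z) (m (z + 1)) (P.ne _ _ (by omega) (by omega) (by omega))
    (P.ne _ _ (by omega) (by omega) (by omega)) (P.ne _ _ (by omega) (by omega) (by omega))
    (P.ne _ _ (by omega) (by omega) (by omega)) (P.ne _ _ (by omega) (by omega) (by omega))
    (P.ne _ _ (by omega) (by omega) (by have := P.ht; omega))
  have f2 := gfour P.gp (m l) (m o) (m z) (m (z + 1)) (P.ne _ _ (by omega) (by omega) (by omega))
    (P.ne _ _ (by omega) (by omega) (by omega)) (P.ne _ _ (by omega) (by omega) (by omega))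
    (P.ne _ _ (by omega) (by omega) (by omega)) (P.ne _ _ (by omega) (by omega) (by omega))
    (P.ne _ _ (by omega) (by omega) (by have := P.ht; omega))
  rw [if_neg (c1 z)] at f1
  rw [if_neg (c2 z)] at f2
  unfold ff
  linear_combination D + f1 + f2 - (hh (p z) (p (z + 1)) (p o) + gg (p o) (p k) (p (z + 1)) + pth p k l (p (z + 1))
    + gg (p l) (p o) (p (z + 1))) * two0

lemma cst {t : ℕ} {p : ℕ → Pt} (P : PolyC t p) {o k l : ℕ} (h1 : o < k) (h2 : k < l) (h3 : l < o + t)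
    (c1 : Clr p (p o) (p k)) (c2 : Clr p (p l) (p o)) (z z' : ℕ) (hzz : z ≤ z')
    (hz : (o < z ∧ z' < k) ∨ (l < z ∧ z' < o + t)) : ff p o k l (p z) = ff p o k l (p z') := by
  induction z', hzz using Nat.le_induction with
  | base => rfl
  | succ y hy ih =>
    rw [ih (by omega)]
    exact cst1 P h1 h2 h3 c1 c2 y (by omega)

/-- cyclic wedge sequence -/
def wv (p : ℕ → Pt) (o k L : ℕ) (r : ℕ) : Pt :=
  if r % (L + 2) = 0 then p o else p (k + (r % (L + 2) - 1))

lemma wv_per (p : ℕ → Pt) (o k L r : ℕ) : wv p o k L (r + (L + 2)) = wv p o k L r := by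
  unfold wv; rw [Nat.add_mod_right]

lemma wv_zero (p : ℕ → Pt) (o k L : ℕ) : wv p o k L 0 = p o := by
  unfold wv; simp

lemma wv_N (p : ℕ → Pt) (o k L : ℕ) : wv p o k L (L + 2) = p o := by
  unfold wv; simp

lemma wv_mid (p : ℕ → Pt) (o k L i : ℕ) (h : i ≤ L) : wv p o k L (i + 1) = p (k + i) := by
  unfold wv
  rw [Nat.mod_eq_of_lt (by omega : i + 1 < L + 2)]; simp

lemma wv_pth (p : ℕ → Pt) (o k L i j : ℕ) (hj : j ≤ L) (z : Pt) :
    pth (wv p o k L) (i + 1) (j + 1) z = pth p (k + i) (k + j) z := by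
  unfold pth
  rw [← Finset.sum_Ico_add' _ i j 1, show k + i = i + k by ring, show k + j = j + k by ring,
    ← Finset.sum_Ico_add' _ i j k]
  apply Finset.sum_congr rfl
  intro x hx
  rw [Finset.mem_Ico] at hx
  rw [wv_mid p o k L x (by omega), wv_mid p o k L (x + 1) (by omega)]
  rw [show x + k = k + x by ring, show k + x + 1 = k + (x + 1) by ring]

lemma wv_first (p : ℕ → Pt) (o k L j : ℕ) (hj : j ≤ L) (z : Pt) :
    pth (wv p o k L) 0 (j + 1) z = gg (p o) (p k) z + pth p k (k + j) z := by
  have := wv_pth p o k L 0 j hj z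
  rw [pth_first _ 0 (j + 1) (by omega), this, wv_zero, wv_mid p o k L 0 (by omega)]
  rfl

lemma wv_last (p : ℕ → Pt) (o k L i : ℕ) (hi : i ≤ L) (z : Pt) :
    pth (wv p o k L) (i + 1) (L + 2) z = pth p (k + i) (k + L) z + gg (p (k + L)) (p o) z := by
  rw [pth_succ _ _ (L + 1) (by omega), wv_pth p o k L i L le_rfl, wv_mid p o k L L le_rfl]
  rw [show L + 1 + 1 = L + 2 by ring, wv_N]

lemma wv_full (p : ℕ → Pt) (o k L : ℕ) (z : Pt) :
    pth (wv p o k L) 0 (L + 2) z = ff p o k (k + L) z := by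
  rw [pth_add _ 0 (L + 1) (L + 2) (by omega) (by omega), wv_first p o k L L le_rfl, wv_last p o k L L le_rfl,
    pth_self]
  unfold ff; ring

lemma wv_idx (p : ℕ → Pt) (o k L r : ℕ) :
    (r % (L + 2) = 0 ∧ wv p o k L r = p o) ∨
    (∃ i, i ≤ L ∧ r % (L + 2) = i + 1 ∧ wv p o k L r = p (k + i)) := by
  rcases Nat.eq_zero_or_pos (r % (L + 2)) with h | h
  · left; exact ⟨h, by unfold wv; rw [if_pos h]⟩
  · right
    have := Nat.mod_lt r (by omega : 0 < L + 2)
    exact ⟨r % (L + 2) - 1, by omega, by omega, by unfold wv; rw [if_neg (by omega)]⟩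

lemma mod_succ_cases (r N : ℕ) (hN : 0 < N) :
    (r % N + 1 < N ∧ (r + 1) % N = r % N + 1) ∨ (r % N + 1 = N ∧ (r + 1) % N = 0) := by
  have h := Nat.mod_lt r hN
  have h2 := Nat.mod_add_div r N
  have e : r + 1 = (r % N + 1) + N * (r / N) := by omega
  rcases Nat.lt_or_ge (r % N + 1) N with h' | h'
  · left; refine ⟨h', ?_⟩
    conv_lhs => rw [e]
    rw [Nat.add_mul_mod_self_left, Nat.mod_eq_of_lt h']
  · right
    have h'' : r % N + 1 = N := by omega
    refine ⟨h'', ?_⟩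
    conv_lhs => rw [e]
    rw [h'', Nat.add_mul_mod_self_left, Nat.mod_self]

lemma wv_edge (p : ℕ → Pt) (o k L r : ℕ) (hL : 1 ≤ L) :
    (wv p o k L r = p o ∧ wv p o k L (r + 1) = p k) ∨
    (∃ z, wv p o k L r = p z ∧ wv p o k L (r + 1) = p (z + 1)) ∨
    (wv p o k L r = p (k + L) ∧ wv p o k L (r + 1) = p o) := by
  rcases wv_idx p o k L r with ⟨h, e⟩ | ⟨i, hi, h, e⟩ <;>
  rcases wv_idx p o k L (r + 1) with ⟨h', e'⟩ | ⟨i', hi', h', e'⟩ <;>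
  rcases mod_succ_cases r (L + 2) (by omega) with ⟨m1, m2⟩ | ⟨m1, m2⟩
  all_goals try (exfalso; omega)
  · left; refine ⟨e, ?_⟩
    rw [e']; congr 1; omega
  · right; right
    refine ⟨?_, e'⟩
    rw [e]; congr 1; omega
  · right; left
    refine ⟨k + i, e, ?_⟩
    rw [e']; congr 1; omega

lemma wv_inj {t : ℕ} {p : ℕ → Pt} (P : PolyC t p) {o k L : ℕ} (h1 : o < k) (h3 : k + L < o + t) (x y : ℕ)
    (h : wv p o k L x = wv p o k L y) : x % (L + 2) = y % (L + 2) := by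
  rcases wv_idx p o k L x with ⟨a, e⟩ | ⟨i, hi, a, e⟩ <;>
  rcases wv_idx p o k L y with ⟨b, e'⟩ | ⟨j, hj, b, e'⟩ <;> rw [e, e'] at h
  · rw [a, b]
  · exact absurd h (P.ne _ _ (by omega) (by omega) (by omega))
  · exact absurd h (P.ne _ _ (by omega) (by omega) (by omega))
  · by_cases hij : i = j
    · omega
    · exact absurd h (P.ne _ _ (by omega) (by omega) (by omega))

lemma wv_mod (p : ℕ → Pt) (o k L x y : ℕ) (h : x % (L + 2) = y % (L + 2)) :
    wv p o k L x = wv p o k L y := by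
  unfold wv; rw [h]

lemma wv_next {t : ℕ} {p : ℕ → Pt} (P : PolyC t p) {o k L : ℕ} (hL : 1 ≤ L) (h1 : o < k) (h3 : k + L < o + t)
    (m r s : ℕ) (hm : wv p o k L m = p s) (hr : wv p o k L r = p (s + 1)) :
    wv p o k L r = wv p o k L (m + 1) := by
  -- move s into the index window
  have sh : ∀ a b : ℕ, a < b + t → b < a + t → p a = p b → a = b := by
    intro a b u1 u2 u3
    by_contra hc
    exact P.ne a b hc u1 u2 u3
  have key : ∀ a, p a = p s → p (a + 1) = p (s + 1) := by
    intro a ha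
    have tp : 0 < t := by have := P.ht; omega
    -- compare residues
    have r1 : ∀ c, p (c % t) = p c := by
      intro c
      conv_rhs => rw [← Nat.mod_add_div c t]
      rw [per_mul p t P.per]
    have : a % t = s % t := by
      apply sh
      · have := Nat.mod_lt a tp; omega
      · have := Nat.mod_lt s tp; omega
      · rw [r1, r1, ha]
    rw [← r1 (a + 1), ← r1 (s + 1), Nat.add_mod a, Nat.add_mod s, this]
  rcases wv_edge p o k L m hL with ⟨e, e'⟩ | ⟨z, e, e'⟩ | ⟨e, e'⟩
  · -- idx m = o
    have q := key o (by rw [← e, hm])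
    rw [e', hr, ← q]
    rw [← q] at hr
    rcases wv_idx p o k L r with ⟨a, f⟩ | ⟨i, hi, a, f⟩
    · rw [hr] at f
      exact absurd f (P.ne _ _ (by omega) (by have := P.ht; omega) (by have := P.ht; omega))
    · rw [hr] at f
      have := sh _ _ (by omega) (by omega) f
      congr 1
      omega
  · rw [e', hr]
    exact (key z (by rw [← e, hm])).symm
  · have q := key (k + L) (by rw [← e, hm])
    rw [e']
    rw [← q] at hr
    rcases wv_idx p o k L r with ⟨a, f⟩ | ⟨i, hi, a, f⟩
    · exact f
    · rw [hr] at f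
      have := sh _ _ (by have := P.ht; omega) (by omega) f
      omega

lemma ff_arc (p : ℕ → Pt) (i j : ℕ) (h : i + 1 ≤ j) (z : Pt) : pq p i j z = ff p i (i + 1) j z := by
  unfold pq ff
  rw [pth_first p i j (by omega)]

lemma ff_split (p : ℕ → Pt) (o k j l : ℕ) (h1 : k ≤ j) (h2 : j ≤ l) (z : Pt) :
    ff p o k l z = ff p o k j z + ff p o j l z := by
  unfold ff
  rw [pth_add p k j l h1 h2]
  linear_combination - gg_cancel (p o) (p j) z

lemma Esplit {t : ℕ} {p : ℕ → Pt} (P : PolyC t p) {o k l : ℕ} (J : JJ t p o k l) (hkl : k + 2 ≤ l) :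
    (∃ i j, k ≤ i ∧ i + 2 ≤ j ∧ j ≤ l ∧ JJ t p i (i + 1) j) ∨
    (∃ j, k < j ∧ j < l ∧ JJ t p o k j ∧ JJ t p o j l) := by
  obtain ⟨L, rfl⟩ : ∃ L, l = k + L := ⟨l - k, by omega⟩
  obtain ⟨ok, kl, lt, c1, c2, hp⟩ := J
  have tp : 0 < t := by omega
  have m : ∀ x, p x ∈ Set.range p := fun x => ⟨x, rfl⟩
  have hfin : (Set.range p).Finite := by
    apply (Set.finite_Iio t).image p |>.subset
    rintro _ ⟨x, rfl⟩
    obtain ⟨r, r1, r2, r3⟩ := per_rep p t 0 tp P.per x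
    exact ⟨r, by simpa using r2, r3⟩
  let E : Pt → Pt → Prop := fun y z => ∃ x, (y = p x ∧ z = p (x + 1)) ∨ (z = p x ∧ y = p (x + 1))
  have hE : ∀ A B, Clr p A B → ∀ y z, E y z → ¬ Xc A B y z := by
    rintro A B h y z ⟨x, ⟨rfl, rfl⟩ | ⟨rfl, rfl⟩⟩
    · exact h x
    · rw [Xc_swap2]; exact h x
  have hE' : ∀ A B, (∀ y z, E y z → ¬ Xc A B y z) → Clr p A B := by
    intro A B h z
    exact h _ _ ⟨z, Or.inl ⟨rfl, rfl⟩⟩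
  have nx : ∀ x, p x ≠ p (x + 1) := fun x => P.inj _ _ (by omega) (by have := P.ht; omega)
  obtain ⟨a, b, hb, hab, hba, hC, hA, hB⟩ := SplitN P.gp hfin E (wv p o k L) (L + 2) (by omega)
    (by intro x; unfold wv; split_ifs <;> exact m _) (wv_per p o k L)
    (by
      intro x y h1 h2 h
      have := wv_inj P ok lt x y h
      have e := (Nat.modEq_iff_dvd' h1.le).1 this
      have := Nat.le_of_dvd (by omega) e
      omega)
    (by
      rintro y z ⟨x, ⟨rfl, rfl⟩ | ⟨rfl, rfl⟩⟩
      · exact ⟨m _, m _, nx x⟩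
      · exact ⟨m _, m _, (nx x).symm⟩)
    (by
      rintro y z ⟨x, h⟩
      exact ⟨x, h.symm⟩)
    (by
      intro x
      apply hE
      rcases wv_edge p o k L x (by omega) with ⟨e, e'⟩ | ⟨z, e, e'⟩ | ⟨e, e'⟩ <;> rw [e, e']
      · exact c1
      · exact P.noX z
      · exact c2)
    (by
      intro x y
      rcases wv_edge p o k L x (by omega) with ⟨e, e'⟩ | ⟨z, e, e'⟩ | ⟨e, e'⟩ <;> rw [e, e'] <;>
      rcases wv_edge p o k L y (by omega) with ⟨f, f'⟩ | ⟨u, f, f'⟩ | ⟨f, f'⟩ <;> rw [f, f']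
      · intro h; exact (Xc_ne _ _ _ _ h).1 rfl
      · exact c1 u
      · intro h; exact (Xc_ne _ _ _ _ h).2.1 rfl
      · rw [Xc_comm]; exact c1 z
      · exact P.noX z u
      · rw [Xc_comm]; exact c2 z
      · intro h; exact (Xc_ne _ _ _ _ h).2.2.1 rfl
      · exact c2 u
      · intro h; exact (Xc_ne _ _ _ _ h).1 rfl)
    (by
      rintro n r ⟨x, ⟨h1, h2⟩ | ⟨h1, h2⟩⟩
      · right
        exact wv_next P (by omega) ok lt (n + 1) r x h1 h2
      · left
        have := wv_next P (by omega) ok lt r (n + 1) x h1 h2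
        have := wv_inj P ok lt _ _ this
        apply wv_mod
        exact (Nat.ModEq.add_right_cancel' 1 this).symm)
    (by
      rintro _ ⟨x, rfl⟩ h
      obtain ⟨r, r1, r2, r3⟩ := per_rep p t o tp P.per x
      rw [← r3] at h ⊢
      rw [wv_full]
      apply hp
      have n1 : r ≠ o := by
        rintro rfl
        exact h 0 (wv_zero _ _ _ _)
      have n2 : ¬ (k ≤ r ∧ r ≤ k + L) := by
        rintro ⟨u1, u2⟩
        apply h (r - k + 1)
        rw [wv_mid _ _ _ _ _ (by omega)]
        congr 1; omega
      omega)
  have hC' := hE' _ _ hC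
  clear hC
  obtain ⟨b', rfl⟩ : ∃ b', b = b' + 1 := ⟨b - 1, by omega⟩
  have wb : wv p o k L (b' + 1) = p (k + b') := wv_mid p o k L b' (by omega)
  rcases Nat.eq_zero_or_pos a with rfl | ha
  · right
    rw [wv_zero, wb] at hC'
    have eA : ∀ z, pq (wv p o k L) 0 (b' + 1) z = ff p o k (k + b') z := by
      intro z; unfold pq ff
      rw [wv_first p o k L b' (by omega), wb, wv_zero]
    have eB : ∀ z, pq (wv p o k L) (b' + 1) (0 + (L + 2)) z = ff p o (k + b') (k + L) z := by
      intro z; unfold pq ff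
      rw [Nat.zero_add, wv_last p o k L b' (by omega), wb, wv_N]; ring
    have A1 : ff p o k (k + b') (p (k + L)) = 0 := by
      have := hA (L + 1) (by omega) (by omega)
      rwa [eA, wv_mid p o k L L le_rfl] at this
    have A2 : ∀ z, k ≤ z → z < k + b' → ff p o (k + b') (k + L) (p z) = 0 := by
      intro z z1 z2
      have := hB (z - k + 1) (by omega) (by omega)
      rwa [eB, wv_mid p o k L _ (by omega), show k + (z - k) = z by omega] at this
    have B1 : ∀ z, k + b' < z → z < o + t → ff p o k (k + b') (p z) = 0 := by
      intro z z1 z2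
      rcases Nat.le_total z (k + L) with h | h
      · rw [cst P ok (by omega) (by omega) c1 (Clr_symm hC') z (k + L) h (by omega)]; exact A1
      · rw [← cst P ok (by omega) (by omega) c1 (Clr_symm hC') (k + L) z h (by omega)]; exact A1
    have B2 : ∀ z, o < z → z < k + b' → ff p o (k + b') (k + L) (p z) = 0 := by
      intro z z1 z2
      rcases Nat.le_total z k with h | h
      · rw [cst P (by omega) (by omega) (by omega) hC' c2 z k h (by omega)]; exact A2 k le_rfl (by omega)
      · exact A2 z h z2
    refine ⟨k + b', by omega, by omega, ⟨ok, by omega, by omega, c1, Clr_symm hC', ?_⟩, ⟨by omega, by omega, lt, hC', c2, ?_⟩⟩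
    · rintro z (⟨z1, z2⟩ | ⟨z1, z2⟩)
      · have s := ff_split p o k (k + b') (k + L) (by omega) (by omega) (p z)
        rw [hp z (Or.inl ⟨z1, z2⟩), B2 z z1 (by omega), add_zero] at s
        exact s.symm
      · exact B1 z z1 z2
    · rintro z (⟨z1, z2⟩ | ⟨z1, z2⟩)
      · exact B2 z z1 z2
      · have s := ff_split p o k (k + b') (k + L) (by omega) (by omega) (p z)
        rw [hp z (Or.inr ⟨z1, z2⟩), B1 z (by omega) z2, zero_add] at s
        exact s.symm
  · left
    obtain ⟨a', rfl⟩ : ∃ a', a = a' + 1 := ⟨a - 1, by omega⟩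
    have wa : wv p o k L (a' + 1) = p (k + a') := wv_mid p o k L a' (by omega)
    rw [wa, wb] at hC'
    have eA : ∀ z, pq (wv p o k L) (a' + 1) (b' + 1) z = ff p (k + a') (k + a' + 1) (k + b') z := by
      intro z; rw [← ff_arc _ _ _ (by omega)]
      unfold pq
      rw [wv_pth p o k L a' b' (by omega), wa, wb]
    have A1 : ff p (k + a') (k + a' + 1) (k + b') (p (o + t)) = 0 := by
      have := hA (L + 2) (by omega) (by omega)
      rwa [eA, wv_N, ← P.per o] at this
    refine ⟨k + a', k + b', by omega, by omega, by omega, by omega, by omega, by omega, P.noX _, Clr_symm hC', ?_⟩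
    rintro z (⟨z1, z2⟩ | ⟨z1, z2⟩)
    · omega
    · rcases Nat.le_total z (o + t) with h | h
      · rw [cst P (by omega) (by omega) (by omega) (P.noX _) (Clr_symm hC') z (o + t) h (by omega)]; exact A1
      · rw [← cst P (by omega) (by omega) (by omega) (P.noX _) (Clr_symm hC') (o + t) z h (by omega)]; exact A1

lemma ear {t : ℕ} {p : ℕ → Pt} (P : PolyC t p) (d : ℕ) : ∀ i j, j ≤ i + d → i + 2 ≤ j → JJ t p i (i + 1) j →
    ∃ m, i ≤ m ∧ m + 2 ≤ j ∧ Clr p (p m) (p (m + 2)) := by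
  induction d with
  | zero => intro i j h1 h2; omega
  | succ d ih =>
    intro i j h1 h2 J
    rcases Nat.eq_or_lt_of_le h2 with h | h
    · subst h
      exact ⟨i, le_rfl, le_rfl, Clr_symm J.2.2.2.2.1⟩
    · rcases Esplit P J (by omega) with ⟨i', j', a1, a2, a3, J'⟩ | ⟨j', a1, a2, J', _⟩
      · obtain ⟨m, b1, b2, b3⟩ := ih i' j' (by omega) a2 J'
        exact ⟨m, by omega, by omega, b3⟩
      · obtain ⟨m, b1, b2, b3⟩ := ih i j' (by omega) (by omega) J'
        exact ⟨m, by omega, by omega, b3⟩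

lemma wedge {t : ℕ} {p : ℕ → Pt} (P : PolyC t p)
    (hno : ∀ m, 3 ≤ m → m + 2 ≤ t + 1 → ¬ Clr p (p m) (p (m + 2))) (d : ℕ) :
    ∀ k l, 3 ≤ k → l ≤ t + 1 → l ≤ k + d → JJ t p 2 k l → ∀ x, k ≤ x → x < l → JJ t p 2 x (x + 1) := by
  induction d with
  | zero => intro k l h1 h2 h3 J x; omega
  | succ d ih =>
    intro k l h1 h2 h3 J x x1 x2
    rcases Nat.lt_or_ge l (k + 2) with h | h
    · have e1 : x = k := by omega
      have e2 : l = k + 1 := by have := J.2.1; omega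
      subst e1 e2
      exact J
    · rcases Esplit P J h with ⟨i', j', a1, a2, a3, J'⟩ | ⟨j', a1, a2, J1, J2⟩
      · obtain ⟨m, b1, b2, b3⟩ := ear P (j' - i') i' j' (by omega) a2 J'
        exact absurd b3 (hno m (by omega) (by omega))
      · rcases Nat.lt_or_ge x j' with h' | h'
        · exact ih k j' h1 (by omega) (by omega) J1 x x1 h'
        · exact ih j' l (by omega) h2 (by omega) J2 x h' x2

lemma wedge0 {t : ℕ} {p : ℕ → Pt} (P : PolyC t p) (ht : 4 ≤ t)
    (hno : ∀ m, 3 ≤ m → m + 2 ≤ t + 1 → ¬ Clr p (p m) (p (m + 2))) (x : ℕ) (h1 : 3 ≤ x) (h2 : x ≤ t) :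
    Clr p (p 2) (p x) ∧ Clr p (p 2) (p (x + 1)) ∧ ∀ z, ¬ InT (p 2) (p x) (p (x + 1)) (p z) := by
  have J0 : JJ t p 2 3 (t + 1) := by
    refine ⟨by omega, by omega, by omega, P.noX 2, ?_, ?_⟩
    · rw [← P.per 2, show 2 + t = t + 1 + 1 by ring]; exact P.noX _
    · rintro z (⟨z1, z2⟩ | ⟨z1, z2⟩) <;> omega
  obtain ⟨a1, a2, a3, a4, a5, a6⟩ := wedge P hno t 3 (t + 1) le_rfl le_rfl (by omega) J0 x h1 (by omega)
  refine ⟨a4, Clr_symm a5, ?_⟩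
  intro z hI
  obtain ⟨r, r1, r2, r3⟩ := per_rep p t 2 (by omega) P.per z
  rw [← r3] at hI
  obtain ⟨e1, e2, e3⟩ := InT_ne _ _ _ _ hI
  have n1 : r ≠ 2 := by rintro rfl; exact e1 rfl
  have n2 : r ≠ x := by rintro rfl; exact e2 rfl
  have n3 : r ≠ x + 1 := by rintro rfl; exact e3 rfl
  have f := a6 r (by omega)
  have m : ∀ x, p x ∈ Set.range p := fun x => ⟨x, rfl⟩
  have g := ggt P.gp (m 2) (m x) (m (x + 1)) (m r) (P.ne _ _ (by omega) (by omega) (by omega))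
    (P.ne _ _ (by omega) (by omega) (by omega)) (P.ne _ _ (by omega) (by omega) (by omega)) e1 e2 e3
  rw [if_pos hI] at g
  unfold ff at f
  rw [pth_succ p x x le_rfl, pth_self, zero_add] at f
  rw [f] at g
  exact absurd g (by decide)

lemma cone (O a b w : Pt) (h1 : 0 < sideSign O a b) (h2 : 0 < sideSign O a w) (h3 : 0 < sideSign O w b)
    (h4 : sideSign a b w ≠ 0) : InT O a b w ∨ Xc O w a b := by
  have e1 : sideSign b O w = sideSign O w b := by unfold sideSign; ring
  have e2 : sideSign O w a = - sideSign O a w := by unfold sideSign; ring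
  have e3 : sideSign a b O = sideSign O a b := by unfold sideSign; ring
  rcases lt_or_gt_of_ne h4 with h | h
  · right
    constructor
    · rw [e2]; exact mul_neg_of_neg_of_pos (by linarith) h3
    · rw [e3]; exact mul_neg_of_pos_of_neg h1 h
  · left; left
    exact ⟨h2, h, by rw [e1]; exact h3⟩

/-- no vertex in the cone -/
def NoC (V : Set Pt) (O a b : Pt) : Prop :=
  ∀ w ∈ V, ¬ (0 < sideSign O a b ∧ 0 < sideSign O a w ∧ 0 < sideSign O w b)

lemma ss_ne (O a b : Pt) (h : sideSign O a b ≠ 0) : O ≠ a ∧ O ≠ b ∧ a ≠ b := by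
  refine ⟨?_, ?_, ?_⟩ <;> rintro rfl <;> apply h <;> unfold sideSign <;> ring

lemma noC_of {V : Set Pt} (hG : GPs V) (O a b : Pt) (ha : a ∈ V) (hb : b ∈ V)
    (hT : ∀ w ∈ V, ¬ InT O a b w) (hX : ∀ w ∈ V, w ≠ O → ¬ Xc O w a b) : NoC V O a b := by
  rintro w hw ⟨h1, h2, h3⟩
  have n1 := ss_ne _ _ _ h1.ne'
  have n2 := ss_ne _ _ _ h2.ne'
  have n3 := ss_ne _ _ _ h3.ne'
  rcases cone O a b w h1 h2 h3 (hG _ ha _ hb _ hw n1.2.2 n2.2.2 n3.2.2.symm) with h | h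
  · exact hT w hw h
  · exact hX w hw n2.2.1.symm h

lemma tri13 {V : Set Pt} (hG : GPs V) (O q1 q2 q3 w : Pt) (hO : O ∈ V) (h1 : q1 ∈ V) (h2 : q2 ∈ V) (h3 : q3 ∈ V)
    (hw : w ∈ V) (N12 : NoC V O q1 q2) (N23 : NoC V O q2 q3)
    (p12 : 0 < sideSign O q1 q2) (p23 : 0 < sideSign O q2 q3) (hI : InT q1 q2 q3 w) :
    sideSign O q1 q3 ≤ 0 := by
  by_contra hc
  push Not at hc
  obtain ⟨s1, s2, s3⟩ := InT_sgn _ _ _ _ hI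
  obtain ⟨d1, d2, d3⟩ := InT_ne _ _ _ _ hI
  have T2 : 0 < sideSign q1 q2 q3 ^ 2 := by
    have : sideSign q1 q2 q3 ≠ 0 := by
      intro h; rw [h] at s1; simp at s1
    positivity
  have a1 : 0 < sideSign O q1 w := by
    have e : sideSign q1 q2 q3 ^ 2 * sideSign O q1 w =
      (sideSign q1 q2 q3 * sideSign q3 q1 w) * sideSign O q1 q2 +
      (sideSign q1 q2 q3 * sideSign q1 q2 w) * sideSign O q1 q3 := by unfold sideSign; ring
    have : 0 < sideSign q1 q2 q3 ^ 2 * sideSign O q1 w := by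
      rw [e]; exact add_pos (mul_pos s3 p12) (mul_pos s1 hc)
    exact (mul_pos_iff_of_pos_left T2).1 this
  have a2 : 0 < sideSign O w q3 := by
    have e : sideSign q1 q2 q3 ^ 2 * sideSign O w q3 =
      (sideSign q1 q2 q3 * sideSign q2 q3 w) * sideSign O q1 q3 +
      (sideSign q1 q2 q3 * sideSign q3 q1 w) * sideSign O q2 q3 := by unfold sideSign; ring
    have : 0 < sideSign q1 q2 q3 ^ 2 * sideSign O w q3 := by
      rw [e]; exact add_pos (mul_pos s2 hc) (mul_pos s3 p23)
    exact (mul_pos_iff_of_pos_left T2).1 this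
  have n0 : sideSign O q2 w ≠ 0 := hG _ hO _ h2 _ hw (ss_ne _ _ _ p23.ne').1 (ss_ne _ _ _ a1.ne').2.1 d2
  rcases lt_or_gt_of_ne n0 with h | h
  · exact N12 w hw ⟨p12, a1, by rw [ss_swap2]; linarith⟩
  · exact N23 w hw ⟨p23, h, a2⟩

lemma finPos {V : Set Pt} (hG : GPs V) (O q1 q2 q3 q4 q5 : Pt) (hO : O ∈ V) (h1 : q1 ∈ V) (h2 : q2 ∈ V) (h3 : q3 ∈ V)
    (h4 : q4 ∈ V) (h5 : q5 ∈ V) (n14 : q1 ≠ q4) (n13 : q1 ≠ q3) (n35 : q3 ≠ q5)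
    (N12 : NoC V O q1 q2) (N23 : NoC V O q2 q3) (N34 : NoC V O q3 q4) (N45 : NoC V O q4 q5)
    (p12 : 0 < sideSign O q1 q2) (p23 : 0 < sideSign O q2 q3) (p34 : 0 < sideSign O q3 q4)
    (p45 : 0 < sideSign O q4 q5) (w w' : Pt) (hw : w ∈ V) (hw' : w' ∈ V)
    (hI : InT q1 q2 q3 w) (hI' : InT q3 q4 q5 w') : False := by
  have a1 := tri13 hG O q1 q2 q3 w hO h1 h2 h3 hw N12 N23 p12 p23 hI
  have a2 := tri13 hG O q3 q4 q5 w' hO h3 h4 h5 hw' N34 N45 p34 p45 hI'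
  have o1 := (ss_ne _ _ _ p12.ne').1
  have o3 := (ss_ne _ _ _ p34.ne').1
  have o4 := (ss_ne _ _ _ p45.ne').1
  have o5 := (ss_ne _ _ _ p45.ne').2.1
  have b1 : sideSign O q1 q3 < 0 := lt_of_le_of_ne a1 (hG _ hO _ h1 _ h3 o1 o3 n13)
  have b2 : sideSign O q3 q5 < 0 := lt_of_le_of_ne a2 (hG _ hO _ h3 _ h5 o3 o5 n35)
  have b3 : sideSign O q1 q4 < 0 := by
    rcases lt_or_gt_of_ne (hG _ hO _ h1 _ h4 o1 o4 n14) with h | h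
    · exact h
    · exact absurd ⟨p34, by rw [ss_swap2]; linarith, h⟩ (N34 q1 h1)
  have b4 : 0 < sideSign O q1 q5 := by
    have e : sideSign O q1 q5 * sideSign O q3 q4 = sideSign O q1 q4 * sideSign O q3 q5
      - sideSign O q1 q3 * sideSign O q4 q5 := by unfold sideSign; ring
    have : 0 < sideSign O q1 q5 * sideSign O q3 q4 := by
      rw [e]
      have := mul_pos_of_neg_of_neg b3 b2
      have := mul_neg_of_neg_of_pos b1 p45
      linarith
    exact (mul_pos_iff_of_pos_right p34).1 this
  exact N45 q1 h1 ⟨p45, by rw [ss_swap2]; linarith, b4⟩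

lemma same {V : Set Pt} (hG : GPs V) (O q1 q2 q3 : Pt) (hO : O ∈ V) (h1 : q1 ∈ V) (h3 : q3 ∈ V)
    (n13 : q1 ≠ q3) (N12 : NoC V O q1 q2) (N32 : NoC V O q3 q2) (p12 : 0 < sideSign O q1 q2)
    (p32 : 0 < sideSign O q3 q2) : False := by
  have o1 := (ss_ne _ _ _ p12.ne').1
  have o3 := (ss_ne _ _ _ p32.ne').1
  rcases lt_or_gt_of_ne (hG _ hO _ h1 _ h3 o1 o3 n13) with h | h
  · exact N32 q1 h1 ⟨p32, by rw [ss_swap2]; linarith, p12⟩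
  · exact N12 q3 h3 ⟨p12, h, p32⟩

lemma same' {V : Set Pt} (hG : GPs V) (O q1 q2 q3 : Pt) (hO : O ∈ V) (h1 : q1 ∈ V) (h3 : q3 ∈ V)
    (n13 : q1 ≠ q3) (N21 : NoC V O q2 q1) (N23 : NoC V O q2 q3) (p21 : 0 < sideSign O q2 q1)
    (p23 : 0 < sideSign O q2 q3) : False := by
  have o1 := (ss_ne _ _ _ p21.ne').2.1
  have o3 := (ss_ne _ _ _ p23.ne').2.1
  rcases lt_or_gt_of_ne (hG _ hO _ h1 _ h3 o1 o3 n13) with h | h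
  · exact N21 q3 h3 ⟨p21, p23, by rw [ss_swap2]; linarith⟩
  · exact N23 q1 h1 ⟨p23, p21, h⟩

lemma final {t : ℕ} {p : ℕ → Pt} (P : PolyC t p) (ht : 6 ≤ t)
    (hno : ∀ m, 3 ≤ m → m + 2 ≤ t + 1 → ¬ Clr p (p m) (p (m + 2))) : False := by
  have m : ∀ x, p x ∈ Set.range p := fun x => ⟨x, rfl⟩
  have hT : ∀ x, 3 ≤ x → x ≤ t → ∀ w ∈ Set.range p, ¬ InT (p 2) (p x) (p (x + 1)) w := by
    rintro x h1 h2 _ ⟨z, rfl⟩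
    exact (wedge0 P (by omega) hno x h1 h2).2.2 z
  have hX : ∀ w ∈ Set.range p, w ≠ p 2 → Clr p (p 2) w := by
    rintro _ ⟨z, rfl⟩ h
    obtain ⟨r, r1, r2, r3⟩ := per_rep p t 2 (by omega) P.per z
    rw [← r3] at h ⊢
    have n2 : r ≠ 2 := by rintro rfl; exact h rfl
    rcases Nat.lt_or_ge t r with h' | h'
    · have := (wedge0 P (by omega) hno t (by omega) le_rfl).2.1
      rwa [show r = t + 1 by omega]
    · exact (wedge0 P (by omega) hno r (by omega) h').1
  have N : ∀ x, 3 ≤ x → x ≤ t → NoC (Set.range p) (p 2) (p x) (p (x + 1)) := fun x h1 h2 =>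
    noC_of P.gp _ _ _ (m _) (m _) (hT x h1 h2) (fun w hw h => hX w hw h x)
  have N' : ∀ x, 3 ≤ x → x ≤ t → NoC (Set.range p) (p 2) (p (x + 1)) (p x) := fun x h1 h2 =>
    noC_of P.gp _ _ _ (m _) (m _) (fun w hw h => hT x h1 h2 w hw (by
      rw [← InT_flip, InT_rot]; rw [← InT_rot]; rw [← InT_rot] at h; exact h))
      (fun w hw h h' => hX w hw h x (by rw [← Xc_swap2]; exact h'))
  have W : ∀ x, 3 ≤ x → x + 2 ≤ t + 1 → ∃ w ∈ Set.range p, InT (p x) (p (x + 1)) (p (x + 2)) w := by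
    intro x h1 h2
    have := hno x h1 h2
    unfold Clr at this
    push Not at this
    obtain ⟨z, hz⟩ := this
    by_contra hc
    push Not at hc
    have d01 : p x ≠ p (x + 1) := P.ne _ _ (by omega) (by omega) (by omega)
    have d02 : p x ≠ p (x + 2) := P.ne _ _ (by omega) (by omega) (by omega)
    have d12 : p (x + 1) ≠ p (x + 2) := P.ne _ _ (by omega) (by omega) (by omega)
    obtain ⟨e1, e2, e3, e4⟩ := Xc_ne _ _ _ _ hz
    have key : ∀ a b, p a = p b → p (a + 1) = p (b + 1) := by
      intro a b h
      obtain ⟨r, r1, r2, r3⟩ := per_rep (fun i => p i) t b (by omega) P.per a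
      have hm : a % t = b % t := by
        have q : ∀ c, p (c % t) = p c := by
          intro c
          conv_rhs => rw [← Nat.mod_add_div c t]
          rw [per_mul p t P.per]
        by_contra hcc
        have l1 := Nat.mod_lt a (by omega : 0 < t)
        have l2 := Nat.mod_lt b (by omega : 0 < t)
        exact P.ne (a % t) (b % t) hcc (by omega) (by omega) (by rw [q, q, h])
      have q : ∀ c, p (c % t) = p c := by
        intro c
        conv_rhs => rw [← Nat.mod_add_div c t]
        rw [per_mul p t P.per]
      rw [← q (a + 1), ← q (b + 1), Nat.add_mod a, Nat.add_mod b, hm]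
    refine G2 P.gp (m x) (m (x + 1)) (m (x + 2)) (m z) (m (z + 1)) d01 d02 d12
      (P.ne _ _ (by omega) (by omega) (by omega)) ?_ ?_ hz (P.noX x z) (P.noX (x + 1) z) (hc _ (m z)) (hc _ (m (z + 1)))
    · intro h
      exact e4 (key _ _ h)
    · intro h
      -- p (x+1) = p (z+1) hence p x = p z
      have h2 : p (x + 1 + (t - 1)) = p (z + 1 + (t - 1)) := by
        have : ∀ c, p (x + 1 + c) = p (z + 1 + c) := by
          intro c
          induction c with
          | zero => exact h
          | succ c ih => exact key _ _ ih
        exact this _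
      rw [show x + 1 + (t - 1) = x + t by omega, show z + 1 + (t - 1) = z + t by omega, P.per, P.per] at h2
      exact e1 h2
  obtain ⟨w, hw, hI⟩ := W 3 (by omega) (by omega)
  obtain ⟨w', hw', hI'⟩ := W 5 (by omega) (by omega)
  norm_num at hI hI'
  have D : ∀ x y, 2 ≤ x → x < y → y ≤ 7 → p x ≠ p y := fun x y h1 h2 h3 => P.ne _ _ (by omega) (by omega) (by omega)
  have S : ∀ x y, 3 ≤ x → x < y → y ≤ 7 → sideSign (p 2) (p x) (p y) ≠ 0 := fun x y h1 h2 h3 =>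
    P.gp _ (m _) _ (m _) _ (m _) (D _ _ (by omega) (by omega) (by omega)) (D _ _ (by omega) (by omega) (by omega)) (D _ _ (by omega) (by omega) (by omega))
  have N3 : NoC _ (p 2) (p 3) (p 4) := N 3 (by omega) (by omega)
  have N4 : NoC _ (p 2) (p 4) (p 5) := N 4 (by omega) (by omega)
  have N5 : NoC _ (p 2) (p 5) (p 6) := N 5 (by omega) (by omega)
  have N6 : NoC _ (p 2) (p 6) (p 7) := N 6 (by omega) (by omega)
  have M3 : NoC _ (p 2) (p 4) (p 3) := N' 3 (by omega) (by omega)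
  have M4 : NoC _ (p 2) (p 5) (p 4) := N' 4 (by omega) (by omega)
  have M5 : NoC _ (p 2) (p 6) (p 5) := N' 5 (by omega) (by omega)
  have M6 : NoC _ (p 2) (p 7) (p 6) := N' 6 (by omega) (by omega)
  have st : ∀ x, 3 ≤ x → x + 2 ≤ 7 → 0 < sideSign (p 2) (p x) (p (x + 1)) →
      0 < sideSign (p 2) (p (x + 1)) (p (x + 2)) := by
    intro x h1 h2 h
    rcases lt_or_gt_of_ne (S (x + 1) (x + 2) (by omega) (by omega) (by omega)) with h' | h'
    · exact (same P.gp (p 2) (p x) (p (x + 1)) (p (x + 2)) (m _) (m _) (m _) (D _ _ (by omega) (by omega) (by omega))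
        (N x h1 (by omega)) (N' (x + 1) (by omega) (by omega)) h (by rw [ss_swap2]; linarith)).elim
    · exact h'
  have st' : ∀ x, 3 ≤ x → x + 2 ≤ 7 → sideSign (p 2) (p x) (p (x + 1)) < 0 →
      sideSign (p 2) (p (x + 1)) (p (x + 2)) < 0 := by
    intro x h1 h2 h
    rcases lt_or_gt_of_ne (S (x + 1) (x + 2) (by omega) (by omega) (by omega)) with h' | h'
    · exact h'
    · exact (same' P.gp (p 2) (p x) (p (x + 1)) (p (x + 2)) (m _) (m _) (m _) (D _ _ (by omega) (by omega) (by omega))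
        (N' x h1 (by omega)) (N (x + 1) (by omega) (by omega)) (by rw [ss_swap2]; linarith) h').elim
  rcases lt_or_gt_of_ne (S 3 4 (by omega) (by omega) (by omega)) with k | k
  · have k4 := st' 3 (by omega) (by omega) k
    have k5 := st' 4 (by omega) (by omega) k4
    have k6 := st' 5 (by omega) (by omega) k5
    norm_num at k4 k5 k6
    exact finPos P.gp (p 2) (p 7) (p 6) (p 5) (p 4) (p 3) (m _) (m _) (m _) (m _) (m _) (m _)
      (D 4 7 (by omega) (by omega) (by omega)).symm (D 5 7 (by omega) (by omega) (by omega)).symm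
      (D 3 5 (by omega) (by omega) (by omega)).symm M6 M5 M4 M3 (by rw [ss_swap2]; linarith) (by rw [ss_swap2]; linarith)
      (by rw [ss_swap2]; linarith) (by rw [ss_swap2]; linarith) w' w hw' hw ((InT_flip _ _ _ _).2 hI') ((InT_flip _ _ _ _).2 hI)
  · have k4 := st 3 (by omega) (by omega) k
    have k5 := st 4 (by omega) (by omega) k4
    have k6 := st 5 (by omega) (by omega) k5
    norm_num at k4 k5 k6
    exact finPos P.gp (p 2) (p 3) (p 4) (p 5) (p 6) (p 7) (m _) (m _) (m _) (m _) (m _) (m _)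
      (D 3 6 (by omega) (by omega) (by omega)) (D 3 5 (by omega) (by omega) (by omega))
      (D 5 7 (by omega) (by omega) (by omega)) N3 N4 N5 N6 k k4 k5 k6 w w' hw hw' hI hI'

lemma coll_of (a b c : Pt) (hab : a ≠ b) (h : sideSign a b c = 0) : Collinear ℝ ({a, b, c} : Set Pt) := by
  rw [collinear_iff_of_mem (p₀ := a) (by simp)]
  refine ⟨b - a, ?_⟩
  have hc : ∃ r : ℝ, c = r • (b - a) + a := by
    by_cases h1 : b.1 - a.1 = 0
    · have h2 : b.2 - a.2 ≠ 0 := by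
        intro h2
        apply hab
        ext
        · linarith
        · linarith
      refine ⟨(c.2 - a.2) / (b.2 - a.2), ?_⟩
      have h3 : (b.2 - a.2) * (c.1 - a.1) = 0 := by
        unfold sideSign at h; rw [h1] at h; linarith
      have h4 : c.1 - a.1 = 0 := (mul_eq_zero.1 h3).resolve_left h2
      ext
      · simp [h1]; linarith
      · simp; field_simp; ring
    · refine ⟨(c.1 - a.1) / (b.1 - a.1), ?_⟩
      unfold sideSign at h
      ext
      · simp; field_simp; ring
      · simp; field_simp; linarith
  intro q hq
  simp only [Set.mem_insert_iff, Set.mem_singleton_iff] at hq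
  rcases hq with rfl | rfl | rfl
  · exact ⟨0, by simp⟩
  · exact ⟨1, by simp⟩
  · obtain ⟨r, hr⟩ := hc
    exact ⟨r, by rw [vadd_eq_add]; exact hr⟩

lemma frac01 (x y : ℝ) (h : x * y < 0) : 0 ≤ x / (x - y) ∧ x / (x - y) ≤ 1 := by
  rcases mul_neg_iff.1 h with ⟨a, b⟩ | ⟨a, b⟩
  · exact ⟨div_nonneg a.le (by linarith), (div_le_one (by linarith)).2 (by linarith)⟩
  · exact ⟨div_nonneg_of_nonpos a.le (by linarith), (div_le_one_of_neg (by linarith)).2 (by linarith)⟩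

lemma Xc_inter (a b c d : Pt) (h : Xc a b c d) : (segment ℝ a b ∩ segment ℝ c d).Nonempty := by
  obtain ⟨h1, h2⟩ := h
  have f1 := frac01 _ _ h1
  have f2 := frac01 _ _ h2
  have K : sideSign c d a - sideSign c d b = -(sideSign a b c - sideSign a b d) := by unfold sideSign; ring
  have K0 : sideSign a b c - sideSign a b d ≠ 0 := by
    intro h0
    have : sideSign a b c = sideSign a b d := by linarith
    rw [this] at h1
    nlinarith [sq_nonneg (sideSign a b d)]
  refine ⟨c + (sideSign a b c / (sideSign a b c - sideSign a b d)) • (d - c), ?_, ?_⟩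
  · rw [segment_eq_image']
    refine ⟨sideSign c d a / (sideSign c d a - sideSign c d b), ⟨f2.1, f2.2⟩, ?_⟩
    rw [K]
    have e1 : (sideSign a b c - sideSign a b d) * (c.1 - a.1) + sideSign a b c * (d.1 - c.1)
      + sideSign c d a * (b.1 - a.1) = 0 := by unfold sideSign; ring
    have e2 : (sideSign a b c - sideSign a b d) * (c.2 - a.2) + sideSign a b c * (d.2 - c.2)
      + sideSign c d a * (b.2 - a.2) = 0 := by unfold sideSign; ring
    generalize sideSign a b c - sideSign a b d = k at *
    generalize sideSign a b c = k1 at *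
    generalize sideSign c d a = k2 at *
    ext
    · simp; field_simp; linarith
    · simp; field_simp; linarith
  · rw [segment_eq_image']
    exact ⟨_, ⟨f1.1, f1.2⟩, rfl⟩

lemma oppo (x y s : ℝ) (hx : x ≠ 0) (hy : y ≠ 0) (h0 : 0 ≤ s) (h1 : s ≤ 1) (h : (1 - s) * x + s * y = 0) :
    x * y < 0 := by
  rcases lt_or_gt_of_ne hx with a | a <;> rcases lt_or_gt_of_ne hy with b | b
  · exfalso
    rcases eq_or_lt_of_le h0 with e | e
    · rw [← e] at h; linarith
    · nlinarith [mul_neg_of_pos_of_neg e b, mul_nonneg (sub_nonneg.2 h1) (neg_nonneg.2 a.le)]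
  · exact mul_neg_of_neg_of_pos a b
  · exact mul_neg_of_pos_of_neg a b
  · exfalso
    rcases eq_or_lt_of_le h0 with e | e
    · rw [← e] at h; linarith
    · nlinarith [mul_pos e b, mul_nonneg (sub_nonneg.2 h1) a.le]

lemma share (A B D q : Pt) (h : sideSign A B D ≠ 0) (h1 : q ∈ segment ℝ A B) (h2 : q ∈ segment ℝ A D) : q = A := by
  rw [segment_eq_image'] at h1 h2
  obtain ⟨r, _, rfl⟩ := h1
  obtain ⟨s, _, e⟩ := h2
  have e1 : s * sideSign A B D = 0 := by
    have : sideSign A B (A + s • (D - A)) = s * sideSign A B D := by unfold sideSign; simp; ring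
    rw [← this]
    simp only at e
    rw [e]; unfold sideSign; simp; ring
  have : s = 0 := (mul_eq_zero.1 e1).resolve_right h
  simp only at e ⊢
  rw [← e, this]; simp

lemma meet {V : Set Pt} (hG : GPs V) (A B C D q : Pt) (hA : A ∈ V) (hB : B ∈ V) (hC : C ∈ V) (hD : D ∈ V)
    (hAB : A ≠ B) (hCD : C ≠ D) (n1 : ¬ (A = C ∧ B = D)) (n2 : ¬ (A = D ∧ B = C)) (hX : ¬ Xc A B C D)
    (h1 : q ∈ segment ℝ A B) (h2 : q ∈ segment ℝ C D) : q = A ∨ q = B := by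
  by_cases c1 : A = C
  · subst c1
    left; exact share A B D q (hG _ hA _ hB _ hD hAB hCD (fun h => n1 ⟨rfl, h⟩)) h1 h2
  by_cases c2 : A = D
  · subst c2
    left; rw [segment_symm] at h2
    exact share A B C q (hG _ hA _ hB _ hC hAB c1 (fun h => n2 ⟨rfl, h⟩)) h1 h2
  by_cases c3 : B = C
  · subst c3
    right; rw [segment_symm] at h1
    exact share B A D q (hG _ hB _ hA _ hD hAB.symm hCD c2) h1 h2
  by_cases c4 : B = D
  · subst c4
    right; rw [segment_symm] at h1 h2
    exact share B A C q (hG _ hB _ hA _ hC hAB.symm c3 c1) h1 h2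
  exfalso
  apply hX
  rw [segment_eq_image'] at h1 h2
  obtain ⟨r, ⟨r0, r1⟩, rfl⟩ := h1
  obtain ⟨s, ⟨s0, s1⟩, e⟩ := h2
  simp only at e
  constructor
  · apply oppo _ _ s (hG _ hA _ hB _ hC hAB c1 c3) (hG _ hA _ hB _ hD hAB c2 c4) s0 s1
    have : sideSign A B (C + s • (D - C)) = (1 - s) * sideSign A B C + s * sideSign A B D := by
      unfold sideSign; simp; ring
    rw [← this, e]; unfold sideSign; simp; ring
  · apply oppo _ _ r (hG _ hC _ hD _ hA hCD (Ne.symm c1) (Ne.symm c2)) (hG _ hC _ hD _ hB hCD (Ne.symm c3) (Ne.symm c4)) r0 r1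
    have : sideSign C D (A + r • (B - A)) = (1 - r) * sideSign C D A + r * sideSign C D B := by
      unfold sideSign; simp; ring
    rw [← this, ← e]; unfold sideSign; simp; ring


/-- a plane geometric cycle with vertices in general position which has exactly
three principal points forming a path in the cycle has at most five vertices. -/
theorem stmt_9 (t : ℕ) (γ : ZMod t → Pt)
    (hcyc : IsPlaneCycleGeom t γ) (hgp : GenPos (Set.range γ))
    (a : ZMod t)
    (hpa : IsPrincipal t γ a) (hpb : IsPrincipal t γ (a + 1)) (hpc : IsPrincipal t γ (a + 2))
    (hdist : a ≠ a + 1 ∧ a ≠ a + 2 ∧ a + 1 ≠ a + 2)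
    (honly : ∀ i : ZMod t, IsPrincipal t γ i → i = a ∨ i = a + 1 ∨ i = a + 2) :
    t ≤ 5 := by
  by_contra hc
  obtain ⟨ht3, hinj, hseg⟩ := hcyc
  haveI : NeZero t := ⟨by omega⟩
  let p : ℕ → Pt := fun z => γ (a - 1 + (z : ZMod t))
  have pdef : ∀ z, p z = γ (a - 1 + (z : ZMod t)) := fun z => rfl
  have cast_ne : ∀ x y : ℕ, x < y → y < x + t → (x : ZMod t) ≠ (y : ZMod t) := by
    intro x y h1 h2 h
    rw [ZMod.natCast_eq_natCast_iff] at h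
    have := Nat.le_of_dvd (by omega) ((Nat.modEq_iff_dvd' h1.le).1 h)
    omega
  have pinj : ∀ x y : ℕ, x < y → y < x + t → p x ≠ p y := by
    intro x y h1 h2 h
    exact cast_ne x y h1 h2 (add_left_cancel (hinj h))
  have psucc : ∀ z, p (z + 1) = γ (a - 1 + (z : ZMod t) + 1) := by
    intro z; rw [pdef]; congr 1; push_cast; ring
  have prange : ∀ z, p z ∈ Set.range γ := fun z => ⟨_, rfl⟩
  have P : PolyC t p := by
    refine ⟨ht3, ?_, pinj, ?_, ?_⟩
    · intro x; rw [pdef, pdef]; push_cast; simp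
    · rintro _ ⟨x, rfl⟩ _ ⟨y, rfl⟩ _ ⟨z, rfl⟩ h1 h2 h3 h
      exact hgp _ (prange x) _ (prange y) _ (prange z) h1 h2 h3 (coll_of _ _ _ h1 h)
    · intro x y hX
      obtain ⟨e1, e2, e3, e4⟩ := Xc_ne _ _ _ _ hX
      obtain ⟨q, hq⟩ := Xc_inter _ _ _ _ hX
      rw [psucc, psucc, pdef, pdef] at hq
      have := (hseg (a - 1 + (x : ZMod t)) (a - 1 + (y : ZMod t)) (fun h => e1 (by rw [pdef, pdef, h]))).2
        (fun h => e3 (by rw [psucc, pdef, h])) (fun h => e2 (by rw [psucc, pdef, h]))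
      rw [this] at hq
      exact hq
  apply final P (by omega)
  intro m m1 m2 hclr
  have hpr : IsPrincipal t γ (a - 1 + ((m + 1 : ℕ) : ZMod t)) := by
    have e1 : γ (a - 1 + ((m + 1 : ℕ) : ZMod t) - 1) = p m := by
      rw [pdef]; congr 1; push_cast; ring
    have e2 : γ (a - 1 + ((m + 1 : ℕ) : ZMod t) + 1) = p (m + 2) := by
      rw [pdef]; congr 1; push_cast; ring
    unfold IsPrincipal
    rw [e1, e2]
    rintro q ⟨hq1, hq2⟩
    rw [Set.mem_iUnion] at hq2
    obtain ⟨j, hj⟩ := hq2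
    have ej : j = a - 1 + (((j - (a - 1)).val : ℕ) : ZMod t) := by
      rw [ZMod.natCast_zmod_val]; ring
    rw [ej] at hj
    generalize (j - (a - 1)).val = z at hj
    rw [← psucc, ← pdef] at hj
    have mm : ∀ x, p x ∈ Set.range p := fun x => ⟨x, rfl⟩
    have := meet P.gp (p m) (p (m + 2)) (p z) (p (z + 1)) q (mm _) (mm _) (mm _) (mm _)
      (pinj _ _ (by omega) (by omega)) (pinj _ _ (by omega) (by omega)) ?_ ?_ (hclr z) hq1 hj
    · simpa using this
    · rintro ⟨h1, h2⟩
      rw [pdef, pdef] at h1 h2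
      have h1 := add_left_cancel (hinj h1)
      have h2 := add_left_cancel (hinj h2)
      push_cast at h2
      rw [← h1] at h2
      apply cast_ne (m + 1) (m + 2) (by omega) (by omega)
      push_cast; exact h2.symm
    · rintro ⟨h1, h2⟩
      rw [pdef, pdef] at h1 h2
      have h1 := add_left_cancel (hinj h1)
      have h2 := add_left_cancel (hinj h2)
      push_cast at h1 h2
      rw [← h2] at h1
      apply cast_ne m (m + 3) (by omega) (by omega)
      push_cast; linear_combination h1
  have := honly _ hpr
  have e : a - 1 + ((m + 1 : ℕ) : ZMod t) = a + (m : ZMod t) := by push_cast; ring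
  rw [e] at this
  rcases this with h | h | h
  · have hz : (m : ZMod t) = 0 := by simpa using h
    exact cast_ne 0 m (by omega) (by omega) (by rw [hz, Nat.cast_zero])
  · exact cast_ne 1 m (by omega) (by omega) (by push_cast; exact (add_left_cancel h).symm)
  · exact cast_ne 2 m (by omega) (by omega) (by push_cast; exact (add_left_cancel h).symm)
end
end

section
/- Let H be a geometric complete bipartite graph with n ≥ 2 red vertices and n blue vertices, and suppose that at most one vertex of H is an interior vertex. Let w_1, …, w_m be the boundary vertices of H in counterclockwise order along the convex hull (indices taken cyclically modulo m). Then H contains a plane Hamiltonian cycle if and only if there is at most one index i with φ(w_i) = φ(w_{i+1}). -/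
noncomputable section

/-- The interior vertices of the point set `P`: points of `P` in the interior of the convex
hull of `P`. -/
def interiorVertices (P : Set Pt) : Set Pt :=
  {p ∈ P | p ∈ interior (convexHull ℝ P)}

/-- The boundary vertices of the point set `P`: points of `P` on the boundary of the convex
hull of `P`. -/
def boundaryVertices (P : Set Pt) : Set Pt :=
  {p ∈ P | p ∈ frontier (convexHull ℝ P)}

/-- `w : ZMod m → Pt` lists the boundary vertices of `P` in counterclockwise order along the
convex hull: it is a bijection onto the boundary vertices such that every other point of `P`
lies strictly to the left of each directed hull edge `w i → w (i+1)`. -/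
def IsCCWBoundaryOrder (P : Set Pt) (m : ℕ) (w : ZMod m → Pt) : Prop :=
  Function.Injective w ∧ Set.range w = boundaryVertices P ∧
  ∀ i : ZMod m, ∀ p ∈ P, p ≠ w i → p ≠ w (i + 1) → 0 < sideSign (w i) (w (i + 1)) p

lemma sideSign_comb (u v a b : Pt) (s t : ℝ) (h : s + t = 1) :
    sideSign u v (s • a + t • b) = s * sideSign u v a + t * sideSign u v b := by
  obtain rfl : s = 1 - t := by linarith
  simp only [sideSign, Prod.fst_add, Prod.snd_add, Prod.smul_fst, Prod.smul_snd, smul_eq_mul]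
  ring

lemma sideSign_ne_of_genPos {P : Set Pt} (hgp : GenPos P) {a b c : Pt} (ha : a ∈ P) (hb : b ∈ P)
    (hc : c ∈ P) (hab : a ≠ b) (hac : a ≠ c) (hbc : b ≠ c) : sideSign a b c ≠ 0 := by
  intro h
  apply hgp a ha b hb c hc hab hac hbc
  rw [collinear_iff_of_mem (p₀ := a) (by simp)]
  refine ⟨b - a, ?_⟩
  intro p hp
  simp only [Set.mem_insert_iff, Set.mem_singleton_iff] at hp
  rcases hp with rfl | rfl | rfl
  · exact ⟨0, by simp⟩
  · exact ⟨1, by simp⟩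
  · unfold sideSign at h
    by_cases h1 : b.1 - a.1 = 0
    · have h2 : b.2 - a.2 ≠ 0 := by
        intro h2
        exact hab (Prod.ext (by linarith) (by linarith))
      refine ⟨(p.2 - a.2) / (b.2 - a.2), Prod.ext ?_ ?_⟩
      · simp only [vadd_eq_add, Prod.fst_add, Prod.smul_fst, Prod.fst_sub, smul_eq_mul, h1]
        rw [h1] at h
        have : p.1 - a.1 = 0 := by
          rcases mul_eq_zero.1 (show (b.2 - a.2) * (p.1 - a.1) = 0 by linarith) with h | h
          · exact absurd h h2
          · exact h
        linarith
      · simp only [vadd_eq_add, Prod.snd_add, Prod.smul_snd, Prod.snd_sub, smul_eq_mul]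
        field_simp
        ring
    · refine ⟨(p.1 - a.1) / (b.1 - a.1), Prod.ext ?_ ?_⟩
      · simp only [vadd_eq_add, Prod.fst_add, Prod.smul_fst, Prod.fst_sub, smul_eq_mul]
        field_simp
        ring
      · simp only [vadd_eq_add, Prod.snd_add, Prod.smul_snd, Prod.snd_sub, smul_eq_mul]
        field_simp
        linarith

lemma sideSign_left (u v : Pt) : sideSign u v u = 0 := by simp [sideSign]
lemma sideSign_right (u v : Pt) : sideSign u v v = 0 := by simp [sideSign]; ring

lemma seg_inter_consec {a b c : Pt} (h : sideSign a b c ≠ 0) :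
    segment ℝ a b ∩ segment ℝ b c = {b} := by
  ext p
  simp only [Set.mem_inter_iff, Set.mem_singleton_iff]
  constructor
  · rintro ⟨⟨s, t, hs, ht, hst, rfl⟩, s', t', hs', ht', hst', h'⟩
    have h1 := sideSign_comb a b a b s t hst
    rw [← h', sideSign_comb a b b c s' t' hst'] at h1
    simp only [sideSign_left, sideSign_right, mul_zero, add_zero, zero_add] at h1
    have : t' = 0 := by
      rcases mul_eq_zero.1 h1 with h | h'
      · exact h
      · exact absurd h' h
    subst this
    obtain rfl : s' = 1 := by linarith
    rw [← h']; simp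
  · rintro rfl
    exact ⟨right_mem_segment _ _ _, left_mem_segment _ _ _⟩

lemma seg_disj {a b c d : Pt} (hc : 0 < sideSign a b c) (hd : 0 < sideSign a b d) :
    segment ℝ a b ∩ segment ℝ c d = ∅ := by
  ext p
  simp only [Set.mem_inter_iff, Set.mem_empty_iff_false, iff_false]
  rintro ⟨⟨s, t, hs, ht, hst, rfl⟩, s', t', hs', ht', hst', h'⟩
  have h1 := sideSign_comb a b a b s t hst
  rw [← h', sideSign_comb a b c d s' t' hst'] at h1
  simp only [sideSign_left, sideSign_right, mul_zero, add_zero] at h1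
  rcases hs'.lt_or_eq with h | h
  · nlinarith [mul_pos h hc, mul_nonneg ht' hd.le]
  · subst h
    obtain rfl : t' = 1 := by linarith
    linarith

lemma sideSign_nonneg_hull {P : Set Pt} {u v : Pt} (h : ∀ p ∈ P, 0 ≤ sideSign u v p) :
    ∀ p ∈ convexHull ℝ P, 0 ≤ sideSign u v p := by
  have : convexHull ℝ P ⊆ {p | 0 ≤ sideSign u v p} := by
    apply convexHull_min h
    intro a ha b hb s t hs ht hst
    have ha : 0 ≤ sideSign u v a := ha
    have hb : 0 ≤ sideSign u v b := hb
    change 0 ≤ sideSign u v (s • a + t • b)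
    rw [sideSign_comb _ _ _ _ _ _ hst]
    positivity
  exact this

/-- `a → b` is a hull edge -/
def HullE (P : Set Pt) (a b : Pt) : Prop := ∀ p ∈ P, p ≠ a → p ≠ b → 0 < sideSign a b p

lemma HullE.nonneg {P : Set Pt} {a b : Pt} (h : HullE P a b) :
    ∀ p ∈ convexHull ℝ P, 0 ≤ sideSign a b p := by
  apply sideSign_nonneg_hull
  intro p hp
  by_cases h1 : p = a
  · rw [h1, sideSign_left]
  by_cases h2 : p = b
  · rw [h2, sideSign_right]
  exact (h p hp h1 h2).le

/-- chord lemma -/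
lemma chord_seg {P : Set Pt} {a b a' b' p : Pt} (hab : a ≠ b)
    (ha : HullE P a a') (hb : HullE P b b') (haP : a ∈ P) (hbP : b ∈ P)
    (h1 : b ≠ a') (h2 : a ≠ b') (hp : p ∈ convexHull ℝ P) (h0 : sideSign a b p = 0) :
    p ∈ segment ℝ a b := by
  have hb1 := ha b hbP hab.symm h1
  have ha1 := hb a haP hab h2
  have hp1 := ha.nonneg p hp
  have hp2 := hb.nonneg p hp
  -- p = a + t (b - a)
  obtain ⟨t, ht1, ht2⟩ : ∃ t : ℝ, p.1 = a.1 + t * (b.1 - a.1) ∧ p.2 = a.2 + t * (b.2 - a.2) := by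
    unfold sideSign at h0
    by_cases h1 : b.1 - a.1 = 0
    · have h2 : b.2 - a.2 ≠ 0 := by
        intro h2
        exact hab (Prod.ext (by linarith) (by linarith))
      refine ⟨(p.2 - a.2) / (b.2 - a.2), ?_, ?_⟩
      · rw [h1] at h0 ⊢
        rcases mul_eq_zero.1 (show (b.2 - a.2) * (p.1 - a.1) = 0 by linarith) with h | h
        · exact absurd h h2
        · linarith
      · field_simp; ring
    · refine ⟨(p.1 - a.1) / (b.1 - a.1), ?_, ?_⟩
      · field_simp; ring
      · field_simp; linarith
  have e1 : sideSign a a' p = t * sideSign a a' b := by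
    unfold sideSign; rw [ht1, ht2]; ring
  have e2 : sideSign b b' p = (1 - t) * sideSign b b' a := by
    unfold sideSign; rw [ht1, ht2]; ring
  rw [e1] at hp1
  rw [e2] at hp2
  have t0 : 0 ≤ t := nonneg_of_mul_nonneg_left hp1 hb1
  have t1 : 0 ≤ 1 - t := nonneg_of_mul_nonneg_left hp2 ha1
  refine ⟨1 - t, t, t1, t0, by ring, Prod.ext ?_ ?_⟩
  · simp [ht1]; ring
  · simp [ht2]; ring

/-- an edge of the cycle between hull vertices is a hull edge -/
lemma cycle_edge_hull {P : Set Pt} {φ : Pt → ℕ} (hgp : GenPos P) {t : ℕ} [NeZero t]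
    {γ : ZMod t → Pt} (hγ : IsPlaneCycle φ t γ) (hr : Set.range γ = P)
    (k : ZMod t) {a' b' : Pt} (ha' : a' ∈ P) (hb' : b' ∈ P)
    (ha : HullE P (γ k) a') (hb : HullE P (γ (k+1)) b') (haa : γ k ≠ a') (hbb : γ (k+1) ≠ b') :
    γ (k+1) = a' ∨ γ k = b' := by
  by_contra! hcon
  obtain ⟨h1, h2⟩ := hcon
  obtain ⟨ht, hinj, -, hseg⟩ := hγ
  have hP : ∀ i, γ i ∈ P := fun i => hr ▸ Set.mem_range_self i
  have cast_ne : ∀ s : ℕ, 0 < s → s < t → (s : ZMod t) ≠ 0 := by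
    intro s hs hst h
    rw [ZMod.natCast_eq_zero_iff] at h
    exact absurd (Nat.le_of_dvd hs h) (by omega)
  have hk1 : k ≠ k + 1 := by
    intro h
    have := cast_ne 1 (by omega) (by omega)
    simp at this
    exact this (by simpa using h)
  have hab : γ k ≠ γ (k+1) := fun h => hk1 (hinj h)
  have hnz : ∀ s : ℕ, 2 ≤ s → s < t → sideSign (γ k) (γ (k+1)) (γ (k + s)) ≠ 0 := by
    intro s hs hst
    apply sideSign_ne_of_genPos hgp (hP _) (hP _) (hP _) hab
    · intro h
      have := hinj h
      exact cast_ne s (by omega) hst (by simpa using this)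
    · intro h
      have := hinj h
      apply cast_ne (s-1) (by omega) (by omega)
      rw [Nat.cast_sub (by omega)]
      push_cast
      linear_combination -this
  have hsame : ∀ s : ℕ, 2 ≤ s → s < t →
      0 < sideSign (γ k) (γ (k+1)) (γ (k + (2:ℕ))) * sideSign (γ k) (γ (k+1)) (γ (k + s)) := by
    intro s hs
    induction s, hs using Nat.le_induction with
    | base =>
      intro h
      exact mul_self_pos.2 (hnz 2 le_rfl h)
    | succ s hs ih =>
      intro hst
      have ih := ih (by omega)
      by_contra hneg
      have hz1 := hnz s hs (by omega)
      have hz2 := hnz (s+1) (by omega) hst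
      have hz0 := hnz 2 le_rfl (by omega)
      have hdis := (hseg k (k + s) (by
        intro h
        exact cast_ne s (by omega) (by omega) (by simpa using h))).2 (by
        intro h
        apply cast_ne (s-1) (by omega) (by omega)
        rw [Nat.cast_sub (by omega)]
        push_cast
        linear_combination h) (by
        intro h
        apply cast_ne (s+1) (by omega) (by omega)
        push_cast
        linear_combination -h)
      have e : k + ((s + 1 : ℕ) : ZMod t) = k + s + 1 := by push_cast; ring
      rw [e] at hz2 hneg
      set x := sideSign (γ k) (γ (k+1)) (γ (k + (2:ℕ)))
      set y := sideSign (γ k) (γ (k+1)) (γ (k + s)) with hy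
      set z := sideSign (γ k) (γ (k+1)) (γ (k + s + 1)) with hzz
      have hyz : y * z < 0 := by
        have hxz : x * z < 0 := lt_of_le_of_ne (not_lt.1 hneg) (mul_ne_zero hz0 hz2)
        by_contra hyz
        have h3 : 0 ≤ y * z := not_lt.1 hyz
        have h4 : (x * y) * (x * z) < 0 := mul_neg_of_pos_of_neg ih hxz
        have h5 : (x * y) * (x * z) = x^2 * (y * z) := by ring
        have : 0 ≤ x^2 * (y*z) := by positivity
        linarith
      -- crossing point
      have hd : y - z ≠ 0 := by
        intro h
        have : y = z := by linarith
        rw [this] at hyz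
        nlinarith [mul_self_nonneg z]
      have hs0 : 0 ≤ -z / (y - z) ∧ 0 ≤ y / (y - z) := by
        rcases lt_or_gt_of_ne hz1 with hy0 | hy0
        · have : 0 < z := by
            by_contra hh
            nlinarith [mul_nonneg_of_nonpos_of_nonpos hy0.le (not_lt.1 hh)]
          exact ⟨div_nonneg_of_nonpos (by linarith) (by linarith),
            div_nonneg_of_nonpos (by linarith) (by linarith)⟩
        · have : z < 0 := by
            by_contra hh
            nlinarith [mul_nonneg hy0.le (not_lt.1 hh)]
          exact ⟨div_nonneg (by linarith) (by linarith), div_nonneg (by linarith) (by linarith)⟩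
      have hsum : -z / (y - z) + y / (y - z) = 1 := by field_simp; ring
      set p : Pt := (-z / (y - z)) • γ (k + s) + (y / (y - z)) • γ (k + s + 1) with hp
      have hp1 : p ∈ segment ℝ (γ (k+s)) (γ (k+s+1)) := ⟨_, _, hs0.1, hs0.2, hsum, rfl⟩
      have hp2 : p ∈ convexHull ℝ P := segment_subset_convexHull (hP _) (hP _) hp1
      have hp3 : sideSign (γ k) (γ (k+1)) p = 0 := by
        rw [hp, sideSign_comb _ _ _ _ _ _ hsum, ← hy, ← hzz]
        field_simp; ring
      have hp4 := chord_seg hab ha hb (hP _) (hP _) h1 h2 hp2 hp3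
      have : p ∈ (∅ : Set Pt) := hdis ▸ ⟨hp4, hp1⟩
      exact this
  have hidx : ∀ q ∈ P, q ≠ γ k → q ≠ γ (k+1) → ∃ s : ℕ, 2 ≤ s ∧ s < t ∧ q = γ (k + s) := by
    intro q hq hq1 hq2
    rw [← hr] at hq
    obtain ⟨i, rfl⟩ := hq
    have hi : k + ((i - k).val : ZMod t) = i := by simp
    refine ⟨(i - k).val, ?_, ZMod.val_lt _, by rw [hi]⟩
    by_contra hlt
    have : (i-k).val = 0 ∨ (i-k).val = 1 := by omega
    rcases this with h | h
    · rw [h] at hi; apply hq1; rw [← hi]; simp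
    · rw [h] at hi; apply hq2; rw [← hi]; simp
  obtain ⟨s1, hs1, hs1t, e1⟩ := hidx a' ha' haa.symm h1.symm
  obtain ⟨s2, hs2, hs2t, e2⟩ := hidx b' hb' h2.symm hbb.symm
  have g1 := hsame s1 hs1 hs1t
  have g2 := hsame s2 hs2 hs2t
  rw [← e1] at g1
  rw [← e2] at g2
  have f1 : sideSign (γ k) (γ (k+1)) a' < 0 := by
    have := ha _ (hP (k+1)) hab.symm h1
    have e : sideSign (γ k) (γ (k+1)) a' = - sideSign (γ k) a' (γ (k+1)) := by
      unfold sideSign; ring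
    linarith
  have f2 : 0 < sideSign (γ k) (γ (k+1)) b' := by
    have := hb _ (hP k) hab h2
    have e : sideSign (γ k) (γ (k+1)) b' = sideSign (γ (k+1)) b' (γ k) := by
      unfold sideSign; ring
    linarith
  have := pos_of_mul_pos_left g2 f2.le
  nlinarith

/-- planarity criterion -/
lemma plane_of_hull {P : Set Pt} {φ : Pt → ℕ} (hgp : GenPos P) {t : ℕ} (ht : 3 ≤ t)
    {γ : ZMod t → Pt} (hinj : Function.Injective γ) (hP : ∀ i, γ i ∈ P)
    (hcol : ∀ i, φ (γ i) ≠ φ (γ (i+1)))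
    (hh : ∀ i j : ZMod t, i ≠ j → j ≠ i + 1 → i ≠ j + 1 →
      HullE P (γ i) (γ (i+1)) ∨ HullE P (γ j) (γ (j+1))) : IsPlaneCycle φ t γ := by
  have : NeZero t := ⟨by omega⟩
  have c1 : (1 : ZMod t) ≠ 0 := by
    intro h
    have : ((1:ℕ) : ZMod t) = 0 := by simpa using h
    rw [ZMod.natCast_eq_zero_iff] at this
    exact absurd (Nat.le_of_dvd one_pos this) (by omega)
  have c2 : (2 : ZMod t) ≠ 0 := by
    intro h
    have : ((2:ℕ) : ZMod t) = 0 := by simpa using h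
    rw [ZMod.natCast_eq_zero_iff] at this
    exact absurd (Nat.le_of_dvd two_pos this) (by omega)
  refine ⟨ht, hinj, hcol, ?_⟩
  intro i j hij
  constructor
  · rintro rfl
    apply seg_inter_consec
    apply sideSign_ne_of_genPos hgp (hP _) (hP _) (hP _)
    · exact fun h => hij (hinj h)
    · intro h
      apply c2
      linear_combination -(hinj h)
    · intro h
      apply c1
      linear_combination -(hinj h)
  · intro h1 h2
    have h3 : j + 1 ≠ i + 1 := fun h => hij (by linear_combination -h)
    rcases hh i j hij h1 h2 with h | h
    · apply seg_disj
      · exact h _ (hP _) (hinj.ne hij.symm) (hinj.ne h1)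
      · exact h _ (hP _) (hinj.ne h2.symm) (hinj.ne h3)
    · rw [Set.inter_comm]
      apply seg_disj
      · exact h _ (hP _) (hinj.ne hij) (hinj.ne h2)
      · exact h _ (hP _) (hinj.ne h1.symm) (hinj.ne h3.symm)

/-- a geometric complete bipartite graph with `n ≥ 2` red and `n` blue vertices
and at most one interior vertex contains a plane Hamiltonian cycle iff at most one pair of
consecutive boundary vertices has equal colors. -/
theorem stmt_10 (P : Set Pt) (φ : Pt → ℕ) (hfin : P.Finite) (hgp : GenPos P)
    (n : ℕ) (hn : 2 ≤ n) (red blue : ℕ) (hrb : red ≠ blue)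
    (hcover : ∀ p ∈ P, φ p = red ∨ φ p = blue)
    (hR : {p ∈ P | φ p = red}.ncard = n) (hB : {p ∈ P | φ p = blue}.ncard = n)
    (hint : (interiorVertices P).ncard ≤ 1)
    (m : ℕ) (w : ZMod m → Pt) (hw : IsCCWBoundaryOrder P m w) :
    (∃ γ : ZMod (2 * n) → Pt, IsPlaneCycle φ (2 * n) γ ∧ Set.range γ = P) ↔
      {i : ZMod m | φ (w i) = φ (w (i + 1))}.ncard ≤ 1 := by
  classical
  obtain ⟨winj, wr, wh⟩ := hw
  -- partition
  have hcl : IsClosed (convexHull ℝ P) := hfin.isClosed_convexHull (𝕜 := ℝ)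
  have hun : boundaryVertices P ∪ interiorVertices P = P := by
    ext p
    constructor
    · rintro (h | h)
      · exact h.1
      · exact h.1
    · intro hp
      by_cases h : p ∈ interior (convexHull ℝ P)
      · exact Or.inr ⟨hp, h⟩
      · exact Or.inl ⟨hp, subset_closure (subset_convexHull ℝ P hp), h⟩
  have hdisj : Disjoint (boundaryVertices P) (interiorVertices P) := by
    rw [Set.disjoint_left]
    rintro p ⟨_, hp⟩ ⟨_, hp'⟩
    exact hp.2 hp'
  have hbfin : (boundaryVertices P).Finite := hfin.subset (fun p h => h.1)
  have hifin : (interiorVertices P).Finite := hfin.subset (fun p h => h.1)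
  have hm0 : NeZero m := by
    refine ⟨?_⟩
    rintro rfl
    have : Infinite (ZMod 0) := (inferInstance : Infinite ℤ)
    exact (wr ▸ Set.infinite_range_of_injective winj) hbfin
  have hmcard : (boundaryVertices P).ncard = m := by
    rw [← wr, ← Set.image_univ, Set.ncard_image_of_injective _ winj, Set.ncard_univ, Nat.card_zmod]
  have hPcard : P.ncard = 2 * n := by
    have e : P = {p ∈ P | φ p = red} ∪ {p ∈ P | φ p = blue} := by
      ext p
      constructor
      · intro hp
        rcases hcover p hp with h | h
        · exact Or.inl ⟨hp, h⟩
        · exact Or.inr ⟨hp, h⟩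
      · rintro (h | h)
        · exact h.1
        · exact h.1
    rw [e, Set.ncard_union_eq _ (hfin.subset fun p h => h.1) (hfin.subset fun p h => h.1), hR, hB]
    · omega
    · rw [Set.disjoint_left]
      rintro p ⟨_, hp⟩ ⟨_, hp'⟩
      exact hrb (hp.symm.trans hp')
  have hmi : m + (interiorVertices P).ncard = 2 * n := by
    rw [← hPcard, ← hmcard, ← Set.ncard_union_eq hdisj hbfin hifin, hun]
  have hm3 : 3 ≤ m := by omega
  have cne : ∀ t : ℕ, 3 ≤ t → (1 : ZMod t) ≠ 0 ∧ (2 : ZMod t) ≠ 0 := by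
    intro t ht
    constructor
    · intro h
      have : ((1:ℕ) : ZMod t) = 0 := by simpa using h
      rw [ZMod.natCast_eq_zero_iff] at this
      exact absurd (Nat.le_of_dvd one_pos this) (by omega)
    · intro h
      have : ((2:ℕ) : ZMod t) = 0 := by simpa using h
      rw [ZMod.natCast_eq_zero_iff] at this
      exact absurd (Nat.le_of_dvd two_pos this) (by omega)
  have hwB : ∀ i, w i ∈ boundaryVertices P := fun i => wr ▸ Set.mem_range_self i
  have hwP : ∀ i, w i ∈ P := fun i => (hwB i).1
  have hwH : ∀ i, HullE P (w i) (w (i+1)) := fun i => wh i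
  have hwne : ∀ i, w i ≠ w (i+1) := by
    intro i h
    exact (cne m hm3).1 (by simpa using winj h)
  have hn0 : NeZero (2 * n) := ⟨by omega⟩
  have hMc : {i : ZMod m | φ (w i) = φ (w (i + 1))}.ncard =
      (Finset.univ.filter fun i : ZMod m => φ (w i) = φ (w (i + 1))).card := by
    rw [← Set.ncard_coe_finset]
    congr 1
    ext i
    simp
  rw [hMc]
  constructor
  · rintro ⟨γ, hγ, hr⟩
    have key : ∀ k, γ k ∈ boundaryVertices P → γ (k+1) ∈ boundaryVertices P →
        ∃ j, (γ k = w j ∧ γ (k+1) = w (j+1)) ∨ (γ (k+1) = w j ∧ γ k = w (j+1)) := by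
      intro k h1 h2
      rw [← wr] at h1 h2
      obtain ⟨i, hi⟩ := h1
      obtain ⟨j, hj⟩ := h2
      rcases cycle_edge_hull hgp hγ hr k (hwP (i+1)) (hwP (j+1)) (hi ▸ hwH i) (hj ▸ hwH j)
        (hi ▸ hwne i) (hj ▸ hwne j) with h | h
      · exact ⟨i, Or.inl ⟨hi.symm, h⟩⟩
      · exact ⟨j, Or.inr ⟨hj.symm, h⟩⟩
    obtain ⟨ht, hinj, hcol, -⟩ := hγ
    set K : Finset (ZMod (2*n)) := Finset.univ.filter fun k =>
      γ k ∈ boundaryVertices P ∧ γ (k+1) ∈ boundaryVertices P with hK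
    set M : Finset (ZMod m) := Finset.univ.filter fun i : ZMod m => φ (w i) = φ (w (i + 1)) with hM
    have hKc : m ≤ K.card + 1 := by
      have hc : K.card + Kᶜ.card = 2 * n := by
        rw [Finset.card_add_card_compl, ZMod.card]
      have hcov : ∀ k, γ k ∈ boundaryVertices P ∨ γ k ∈ interiorVertices P := by
        intro k
        have : γ k ∈ boundaryVertices P ∪ interiorVertices P := by
          rw [hun, ← hr]; exact Set.mem_range_self k
        exact this
      rcases Nat.le_one_iff_eq_zero_or_eq_one.1 hint with h0 | h1
      · have he : interiorVertices P = ∅ := (Set.ncard_eq_zero hifin).1 h0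
        have : K = Finset.univ := by
          ext k
          have a := hcov k
          have b := hcov (k+1)
          simp only [he, Set.mem_empty_iff_false, or_false] at a b
          simp [hK, a, b]
        rw [this, Finset.card_univ, ZMod.card]
        omega
      · obtain ⟨x, hx⟩ := Set.ncard_eq_one.1 h1
        have hxP : x ∈ P := by
          have : x ∈ interiorVertices P := by rw [hx]; rfl
          exact this.1
        rw [← hr] at hxP
        obtain ⟨k0, hk0⟩ := hxP
        have hsub : Kᶜ ⊆ {k0, k0 - 1} := by
          intro k hk
          simp only [hK, Finset.mem_compl, Finset.mem_filter, Finset.mem_univ, true_and,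
            not_and_or] at hk
          simp only [Finset.mem_insert, Finset.mem_singleton]
          rcases hk with hk | hk
          · left
            have := (hcov k).resolve_left hk
            rw [hx] at this
            have : γ k = x := this
            exact hinj (this.trans hk0.symm)
          · right
            have := (hcov (k+1)).resolve_left hk
            rw [hx] at this
            have : γ (k+1) = x := this
            exact eq_sub_of_add_eq (hinj (this.trans hk0.symm))
        have := (Finset.card_le_card hsub).trans Finset.card_le_two
        omega
    choose! f hf using key
    have hfi : Set.InjOn f K := by
      intro k hk l hl hkl
      simp only [hK, Finset.coe_filter, Finset.mem_univ, true_and] at hk hl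
      have a := hf k hk.1 hk.2
      have b := hf l hl.1 hl.2
      rw [hkl] at a
      rcases a with ⟨a1, a2⟩ | ⟨a1, a2⟩ <;> rcases b with ⟨b1, b2⟩ | ⟨b1, b2⟩
      · exact hinj (a1.trans b1.symm)
      · have e1 := hinj (a1.trans b1.symm)
        have e2 := hinj (a2.trans b2.symm)
        exact absurd (by linear_combination e2 - e1) (cne _ ht).2
      · have e1 := hinj (a1.trans b1.symm)
        have e2 := hinj (a2.trans b2.symm)
        exact absurd (by linear_combination e1 - e2) (cne _ ht).2
      · exact hinj (a2.trans b2.symm)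
    have hd : Disjoint (K.image f) M := by
      rw [Finset.disjoint_left]
      intro j hj hj'
      simp only [Finset.mem_image, hK, hM, Finset.mem_filter, Finset.mem_univ, true_and] at hj hj'
      obtain ⟨k, hk, rfl⟩ := hj
      rcases hf k hk.1 hk.2 with ⟨a1, a2⟩ | ⟨a1, a2⟩
      · apply hcol k; rw [a1, a2, hj']
      · apply hcol k; rw [a1, a2, hj']
    have hle : (K.image f ∪ M).card ≤ m := by
      have := Finset.card_le_univ (K.image f ∪ M)
      rwa [ZMod.card] at this
    rw [Finset.card_union_of_disjoint hd, Finset.card_image_of_injOn hfi] at hle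
    omega
  · intro hM1
    set M : Finset (ZMod m) := Finset.univ.filter fun i : ZMod m => φ (w i) = φ (w (i + 1)) with hM
    let s : Pt → ℤ := fun p => if φ p = red then 1 else -1
    have s1 : ∀ p, s p = 1 ∨ s p = -1 := by
      intro p
      by_cases h : φ p = red <;> simp [s, h]
    have sne : ∀ p ∈ P, ∀ q ∈ P, φ p ≠ φ q → s p + s q = 0 := by
      intro p hp q hq h
      rcases hcover p hp with h1 | h1 <;> rcases hcover q hq with h2 | h2 <;>
        simp [s, h1, h2, hrb.symm] at h ⊢
    have seq : ∀ p q, φ p = φ q → s p = s q := by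
      intro p q h
      simp [s, h]
    have hsumP : ∑ p ∈ hfin.toFinset, s p = 0 := by
      have e1 : (hfin.toFinset.filter fun p => φ p = red).card = n := by
        rw [← hR, ← Set.ncard_coe_finset]
        congr 1
        ext p
        simp
      have e2 : (hfin.toFinset.filter fun p => ¬ φ p = red).card = n := by
        rw [← hB, ← Set.ncard_coe_finset]
        congr 1
        ext p
        simp only [Finset.coe_filter, Set.Finite.mem_toFinset]
        constructor
        · rintro ⟨h1, h2⟩
          exact ⟨h1, (hcover p h1).resolve_left h2⟩
        · rintro ⟨h1, h2⟩
          exact ⟨h1, fun h => hrb (h.symm.trans h2)⟩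
      simp only [s]
      rw [Finset.sum_ite, Finset.sum_const, Finset.sum_const, e1, e2]
      simp
    have hsum2 : 2 * ∑ i, s (w i) = ∑ i ∈ M, 2 * s (w i) := by
      have e1 : ∑ i, s (w (i+1)) = ∑ i, s (w i) :=
        Equiv.sum_comp (Equiv.addRight (1 : ZMod m)) (fun i => s (w i))
      have e2 : ∑ i, (s (w i) + s (w (i+1))) = ∑ i ∈ M, 2 * s (w i) := by
        rw [hM, Finset.sum_filter]
        apply Finset.sum_congr rfl
        intro i _
        split_ifs with h
        · rw [← seq _ _ h]; ring
        · exact sne _ (hwP _) _ (hwP _) h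
      rw [← e2, Finset.sum_add_distrib, e1]; ring
    have himg : ∑ p ∈ Finset.univ.image w, s p = ∑ i, s (w i) :=
      Finset.sum_image (fun a _ b _ h => winj h)
    rcases Nat.le_one_iff_eq_zero_or_eq_one.1 hint with h0 | h1
    · have he : interiorVertices P = ∅ := (Set.ncard_eq_zero hifin).1 h0
      rw [he, Set.union_empty] at hun
      have hmn : m = 2 * n := by omega
      subst hmn
      have e : Finset.univ.image w = hfin.toFinset := by
        ext p
        simp only [Finset.mem_image, Finset.mem_univ, true_and, Set.Finite.mem_toFinset]
        conv_rhs => rw [← hun, ← wr]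
        rfl
      rw [e, hsumP] at himg
      rw [← himg] at hsum2
      have hMe : M = ∅ := by
        rcases Nat.le_one_iff_eq_zero_or_eq_one.1 hM1 with h | h
        · exact Finset.card_eq_zero.1 h
        · obtain ⟨i, hi⟩ := Finset.card_eq_one.1 h
          rw [hi, Finset.sum_singleton] at hsum2
          rcases s1 (w i) with h | h <;> rw [h] at hsum2 <;> norm_num at hsum2
      refine ⟨w, plane_of_hull hgp hm3 winj hwP ?_ ?_, wr.trans hun⟩
      · intro i h
        have : i ∈ M := by simp [hM, h]
        rw [hMe] at this
        simp at this
      · intro i j _ _ _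
        exact Or.inl (hwH i)
    · obtain ⟨x, hx⟩ := Set.ncard_eq_one.1 h1
      have hxi : x ∈ interiorVertices P := by rw [hx]; rfl
      have hxP : x ∈ P := hxi.1
      have hxw : ∀ i, x ≠ w i := by
        intro i h
        exact Set.disjoint_left.1 hdisj (hwB i) (h ▸ hxi)
      have hmn : m + 1 = 2 * n := by omega
      have e : insert x (Finset.univ.image w) = hfin.toFinset := by
        ext p
        simp only [Finset.mem_insert, Finset.mem_image, Finset.mem_univ, true_and,
          Set.Finite.mem_toFinset]
        conv_rhs => rw [← hun, ← wr, hx]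
        rw [or_comm]
        rfl
      have hsx : s x + ∑ i, s (w i) = 0 := by
        rw [← hsumP, ← e, Finset.sum_insert, himg]
        simp only [Finset.mem_image, Finset.mem_univ, true_and, not_exists]
        exact fun i h => hxw i h.symm
      obtain ⟨i, hi⟩ : ∃ i, M = {i} := by
        rcases Nat.le_one_iff_eq_zero_or_eq_one.1 hM1 with h | h
        · rw [Finset.card_eq_zero.1 h, Finset.sum_empty] at hsum2
          rcases s1 x with h | h <;> rw [h] at hsx <;> omega
        · exact Finset.card_eq_one.1 h
      rw [hi, Finset.sum_singleton] at hsum2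
      have hsxi : s x + s (w i) = 0 := by omega
      have hmem : ∀ j, φ (w j) = φ (w (j+1)) ↔ j = i := by
        intro j
        have : j ∈ M ↔ j = i := by rw [hi]; simp
        rw [← this, hM]; simp
      have hxc : φ x ≠ φ (w i) := by
        intro h
        rw [seq _ _ h] at hsxi
        rcases s1 (w i) with h | h <;> rw [h] at hsxi <;> norm_num at hsxi
      let γ : ZMod (2*n) → Pt := fun k => if k.val = m then x else w (i + 1 + (k.val : ZMod m))
      have hv : ∀ k : ZMod (2*n), k.val < m + 1 := by
        intro k; rw [hmn]; exact ZMod.val_lt k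
      have hγP : ∀ k, γ k ∈ P := by
        intro k
        by_cases h : k.val = m
        · simp [γ, h, hxP]
        · simp [γ, h, hwP]
      have hγinj : Function.Injective γ := by
        intro k l hkl
        have hk := hv k
        have hl := hv l
        apply ZMod.val_injective
        by_cases h : k.val = m <;> by_cases h' : l.val = m
        · rw [h, h']
        · simp only [γ, h, h', if_true, if_false] at hkl
          exact absurd hkl (hxw _)
        · simp only [γ, h, h', if_true, if_false] at hkl
          exact absurd hkl.symm (hxw _)
        · simp only [γ, h, h', if_false] at hkl
          have := add_left_cancel (winj hkl)
          rw [ZMod.natCast_eq_natCast_iff'] at this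
          rwa [Nat.mod_eq_of_lt (by omega), Nat.mod_eq_of_lt (by omega)] at this
      have hγr : Set.range γ = P := by
        apply Set.eq_of_subset_of_ncard_le _ _ hfin
        · rintro _ ⟨k, rfl⟩; exact hγP k
        · rw [← Set.image_univ, Set.ncard_image_of_injective _ hγinj, Set.ncard_univ,
            Nat.card_zmod, hPcard]
      -- edges
      have hsucc : ∀ k : ZMod (2*n), k.val < m → (k+1).val = k.val + 1 := by
        intro k hk
        have := ZMod.val_add_of_lt (a := k) (b := 1) (by
          rw [ZMod.val_one'' (by omega)]; omega)
        rw [this, ZMod.val_one'' (by omega)]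
      have hlast : ∀ k : ZMod (2*n), k.val = m → k + 1 = 0 := by
        intro k hk
        have : ((k.val + 1 : ℕ) : ZMod (2*n)) = 0 := by
          rw [hk, hmn]; simp
        simpa using this
      have edge1 : ∀ k : ZMod (2*n), k.val + 1 < m →
          γ k = w (i + 1 + (k.val : ZMod m)) ∧ γ (k+1) = w (i + 1 + (k.val : ZMod m) + 1) := by
        intro k hk
        constructor
        · simp only [γ]; rw [if_neg (by omega)]
        · simp only [γ]
          rw [hsucc k (by omega), if_neg (by omega)]
          push_cast
          rw [add_assoc (i + 1)]
      have edge2 : ∀ k : ZMod (2*n), k.val + 1 = m → γ k = w i ∧ γ (k+1) = x := by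
        intro k hk
        constructor
        · simp only [γ]; rw [if_neg (by omega)]
          congr 1
          have : ((k.val + 1 : ℕ) : ZMod m) = 0 := by rw [hk]; simp
          push_cast at this
          linear_combination this
        · simp only [γ]
          rw [hsucc k (by omega), if_pos hk]
      have edge3 : ∀ k : ZMod (2*n), k.val = m → γ k = x ∧ γ (k+1) = w (i+1) := by
        intro k hk
        constructor
        · simp only [γ]; rw [if_pos hk]
        · simp only [γ]
          rw [hlast k hk, ZMod.val_zero, if_neg (by omega)]
          simp
      have htri : ∀ k : ZMod (2*n), k.val + 1 < m ∨ k.val + 1 = m ∨ k.val = m := by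
        intro k; have := hv k; omega
      refine ⟨γ, plane_of_hull hgp (by omega) hγinj hγP ?_ ?_, hγr⟩
      · intro k
        rcases htri k with h | h | h
        · rw [(edge1 k h).1, (edge1 k h).2]
          intro hc
          have h2 := (hmem _).1 hc
          have h3 : ((k.val + 1 : ℕ) : ZMod m) = 0 := by
            push_cast
            linear_combination h2
          rw [ZMod.natCast_eq_zero_iff] at h3
          exact absurd (Nat.le_of_dvd (by omega) h3) (by omega)
        · rw [(edge2 k h).1, (edge2 k h).2]
          exact hxc.symm
        · rw [(edge3 k h).1, (edge3 k h).2, ← (hmem i).2 rfl]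
          exact hxc
      · have good : ∀ k : ZMod (2*n), k.val + 1 < m → HullE P (γ k) (γ (k+1)) := by
          intro k hk
          rw [(edge1 k hk).1, (edge1 k hk).2]
          exact hwH _
        intro k l hkl h1 h2
        rcases htri k with h | h | h
        · exact Or.inl (good k h)
        · rcases htri l with h' | h' | h'
          · exact Or.inr (good l h')
          · exact absurd (ZMod.val_injective _ (by omega)) hkl
          · exact absurd (ZMod.val_injective _ (by rw [hsucc k (by omega)]; omega)) h1
        · rcases htri l with h' | h' | h'
          · exact Or.inr (good l h')
          · exact absurd (ZMod.val_injective _ (by rw [hsucc l (by omega)]; omega)) h2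
          · exact absurd (ZMod.val_injective _ (by omega)) hkl
end
end

section
/- Let H be a geometric complete bipartite graph with n red vertices and n blue vertices, let k be the number of interior vertices of H, and let w_1, …, w_m be the boundary vertices of H in counterclockwise order along the convex hull (indices taken cyclically modulo m). If H contains a plane Hamiltonian cycle, then the number of indices i with φ(w_i) = φ(w_{i−1}) is at most k. -/
noncomputable section

theorem aux_sign (f : ℕ → ℝ) (a : ℕ) (ha : f a ≠ 0) : ∀ d : ℕ,
    (∀ s, a ≤ s → s < a + d → 0 < f s * f (s + 1)) → 0 < f a * f (a + d) := by
  intro d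
  induction d with
  | zero => intro _; exact mul_self_pos.2 ha
  | succ d ih =>
    intro h
    have h1 := ih (fun s hs hs' => h s hs (by omega))
    have h2 := h (a + d) (by omega) (by omega)
    have h3 : 0 < (f a * f (a + d)) * (f (a + d) * f (a + d + 1)) := mul_pos h1 h2
    have h4 : (f a * f (a + d)) * (f (a + d) * f (a + d + 1))
      = (f a * f (a + d + 1)) * (f (a+d))^2 := by ring
    rw [h4] at h3
    exact pos_of_mul_pos_left h3 (sq_nonneg _)

theorem aux_zero (p q : ℝ) (h : p * q ≤ 0) :
    ∃ c d : ℝ, 0 ≤ c ∧ 0 ≤ d ∧ c + d = 1 ∧ c * p + d * q = 0 := by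
  by_cases hpq : p - q = 0
  · refine ⟨1, 0, by norm_num, by norm_num, by norm_num, ?_⟩
    have : p = q := by linarith
    subst this
    nlinarith [mul_self_nonneg p]
  · have h1 : 0 < (p - q)^2 := by positivity
    refine ⟨-q * (p-q)/(p-q)^2, p * (p-q)/(p-q)^2, ?_, ?_, ?_, ?_⟩
    · apply div_nonneg _ h1.le; nlinarith [sq_nonneg q]
    · apply div_nonneg _ h1.le; nlinarith [sq_nonneg p]
    · field_simp; ring
    · field_simp; ring

/-- key geometric fact: edge `p q` crossing the line `u v` meets the segment `u v`. -/
theorem aux_cross (u v a b p q : Pt)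
    (hv : 0 < sideSign u a v) (hu : 0 < sideSign v b u)
    (hp : 0 ≤ sideSign u a p) (hq : 0 ≤ sideSign u a q)
    (hp' : 0 ≤ sideSign v b p) (hq' : 0 ≤ sideSign v b q)
    (h : sideSign u v p * sideSign u v q ≤ 0) :
    (segment ℝ u v ∩ segment ℝ p q).Nonempty := by
  obtain ⟨c, d, hc, hd, hcd, hx⟩ := aux_zero _ _ h
  set x : Pt := c • p + d • q with hxdef
  have hd' : d = 1 - c := by linarith
  have x1 : x.1 = c * p.1 + d * q.1 := by simp [hxdef]
  have x2 : x.2 = c * p.2 + d * q.2 := by simp [hxdef]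
  have hA : ∀ y z, sideSign y z x = c * sideSign y z p + d * sideSign y z q := by
    intro y z
    simp only [sideSign, x1, x2, hd']; ring
  have h0 : sideSign u v x = 0 := by rw [hA]; exact hx
  have h1 : 0 ≤ sideSign u a x := by rw [hA]; positivity
  have h2 : 0 ≤ sideSign v b x := by rw [hA]; positivity
  set A := sideSign u a v with hAdef
  have e1 : A * (x.1 - u.1) = sideSign u a x * (v.1 - u.1) := by
    have : A * (x.1 - u.1) - sideSign u a x * (v.1 - u.1) = -(a.1 - u.1) * sideSign u v x := by
      simp only [hAdef, sideSign]; ring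
    rw [h0] at this; linarith
  have e2 : A * (x.2 - u.2) = sideSign u a x * (v.2 - u.2) := by
    have : A * (x.2 - u.2) - sideSign u a x * (v.2 - u.2) = -(a.2 - u.2) * sideSign u v x := by
      simp only [hAdef, sideSign]; ring
    rw [h0] at this; linarith
  obtain ⟨t, ht⟩ : ∃ t, t = sideSign u a x / A := ⟨_, rfl⟩
  have ht0 : 0 ≤ t := by rw [ht]; exact div_nonneg h1 hv.le
  have f1 : x.1 = u.1 + t * (v.1 - u.1) := by
    rw [ht]; field_simp; linarith
  have f2 : x.2 = u.2 + t * (v.2 - u.2) := by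
    rw [ht]; field_simp; linarith
  have h3 : sideSign v b x = (1 - t) * sideSign v b u := by
    simp only [sideSign, f1, f2]; ring
  have ht1 : 0 ≤ 1 - t := by
    rw [h3] at h2; exact nonneg_of_mul_nonneg_left h2 hu
  refine ⟨x, ⟨1 - t, t, ht1, ht0, by ring, ?_⟩, ⟨c, d, hc, hd, hcd, rfl⟩⟩
  ext
  · simp [f1]; ring
  · simp [f2]; ring

theorem aux_side (P : Set Pt) (m : ℕ) (w : ZMod m → Pt) (hw : IsCCWBoundaryOrder P m w)
    (i : ZMod m) (p : Pt) (hp : p ∈ P) : 0 ≤ sideSign (w i) (w (i + 1)) p := by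
  by_cases h1 : p = w i
  · subst h1; simp [sideSign]
  by_cases h2 : p = w (i + 1)
  · subst h2; simp only [sideSign]; apply le_of_eq; ring
  exact (hw.2.2 i p hp h1 h2).le

theorem aux_hull (P : Set Pt) (φ : Pt → ℕ) (N : ℕ)
    (m : ℕ) (w : ZMod m → Pt) (hw : IsCCWBoundaryOrder P m w)
    (γ : ZMod N → Pt) (hγ : IsPlaneCycle φ N γ) (hr : Set.range γ = P)
    (j : ZMod N) (a b : ZMod m) (ha : γ j = w a) (hb : γ (j + 1) = w b) :
    b = a + 1 ∨ a = b + 1 := by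
  by_contra hcon
  push Not at hcon
  obtain ⟨hba, hab⟩ := hcon
  obtain ⟨hN, hinj, hcol, hdis⟩ := hγ
  haveI : NeZero N := ⟨by omega⟩
  haveI : Fact (1 < N) := ⟨by omega⟩
  have wP : ∀ i, w i ∈ P := fun i => by
    have : w i ∈ boundaryVertices P := hw.2.1 ▸ Set.mem_range_self i
    exact this.1
  have hne : b ≠ a := by
    rintro rfl
    have := hinj (ha.trans hb.symm)
    simp at this
  have hba' : b ≠ a - 1 := fun h => hab (by rw [h]; ring)
  have s1 : 0 < sideSign (w a) (w (a + 1)) (w b) :=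
    hw.2.2 a _ (wP b) (fun h => hne (hw.1 h)) (fun h => hba (hw.1 h))
  have s2 : 0 < sideSign (w (a - 1)) (w a) (w b) := by
    have := hw.2.2 (a - 1) _ (wP b) (fun h => hba' (hw.1 h))
    rw [sub_add_cancel] at this
    exact this (fun h => hne (hw.1 h))
  have s3 : 0 < sideSign (w b) (w (b + 1)) (w a) :=
    hw.2.2 b _ (wP a) (fun h => hne (hw.1 h).symm) (fun h => hab (hw.1 h))
  have n1 : sideSign (w a) (w b) (w (a + 1)) < 0 := by
    have : sideSign (w a) (w b) (w (a + 1)) = - sideSign (w a) (w (a + 1)) (w b) := by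
      simp only [sideSign]; ring
    linarith
  have n2 : 0 < sideSign (w a) (w b) (w (a - 1)) := by
    have : sideSign (w a) (w b) (w (a - 1)) = sideSign (w (a - 1)) (w a) (w b) := by
      simp only [sideSign]; ring
    linarith
  have idx : ∀ p ∈ P, sideSign (w a) (w b) p ≠ 0 → ∃ s : ℕ, 2 ≤ s ∧ s < N ∧ p = γ (j + s) := by
    intro p hp hs
    rw [← hr] at hp
    obtain ⟨c, rfl⟩ := hp
    have hc : j + (((c - j).val : ℕ) : ZMod N) = c := by
      rw [ZMod.natCast_zmod_val]; ring
    refine ⟨(c - j).val, ?_, ZMod.val_lt _, by rw [hc]⟩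
    by_contra hlt
    have : (c - j).val = 0 ∨ (c - j).val = 1 := by omega
    rcases this with h | h
    · rw [h] at hc
      apply hs; rw [← hc]; simp [ha, sideSign]
    · rw [h] at hc
      apply hs; rw [← hc]
      simp only [Nat.cast_one, hb, sideSign]; ring
  have cast_ne : ∀ s : ℕ, 0 < s → s < N → (s : ZMod N) ≠ 0 := by
    intro s h0 h1 h
    rw [ZMod.natCast_eq_zero_iff] at h
    exact absurd (Nat.le_of_dvd h0 h) (by omega)
  have noc : ∀ s : ℕ, 2 ≤ s → s + 1 < N →
      0 < sideSign (w a) (w b) (γ (j + s)) * sideSign (w a) (w b) (γ (j + (s + 1 : ℕ))) := by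
    intro s hs hs'
    by_contra hle
    have gP : ∀ i, γ i ∈ P := fun i => hr ▸ Set.mem_range_self i
    have := aux_cross (w a) (w b) (w (a+1)) (w (b+1)) (γ (j + s)) (γ (j + (s + 1 : ℕ))) s1 s3
      (aux_side P m w hw a _ (gP _)) (aux_side P m w hw a _ (gP _))
      (aux_side P m w hw b _ (gP _)) (aux_side P m w hw b _ (gP _)) (not_lt.1 hle)
    have h0 : j ≠ j + s := fun h => cast_ne s (by omega) (by omega) (by simpa using h.symm)
    have h1 : j + s ≠ j + 1 := fun h => cast_ne (s - 1) (by omega) (by omega) (by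
      rw [Nat.cast_sub (by omega)]
      have := add_left_cancel h
      rw [this]; simp)
    have h2 : j ≠ j + s + 1 := fun h => cast_ne (s + 1) (by omega) (by omega) (by
      push_cast
      have h' : j + ((s : ZMod N) + 1) = j + 0 := by rw [← add_assoc, ← h, add_zero]
      exact add_left_cancel h')
    have h3 := (hdis j (j + s) h0).2 h1 h2
    rw [ha, hb] at h3
    push_cast at this
    rw [← add_assoc, h3] at this
    exact Set.not_nonempty_empty this
  obtain ⟨x, hx2, hxN, hx⟩ := idx _ (wP (a + 1)) n1.ne
  obtain ⟨y, hy2, hyN, hy⟩ := idx _ (wP (a - 1)) n2.ne'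
  rw [hx] at n1
  rw [hy] at n2
  set f : ℕ → ℝ := fun s => sideSign (w a) (w b) (γ (j + s)) with hf
  have n1' : f x < 0 := n1
  have n2' : 0 < f y := n2
  have noc' : ∀ s : ℕ, 2 ≤ s → s + 1 < N → 0 < f s * f (s + 1) := noc
  rcases le_total x y with h | h
  · have := aux_sign f x n1'.ne (y - x) (fun s h1 h2 => noc' s (by omega) (by omega))
    rw [show x + (y - x) = y by omega] at this
    nlinarith
  · have := aux_sign f y n2'.ne' (x - y) (fun s h1 h2 => noc' s (by omega) (by omega))
    rw [show y + (x - y) = x by omega] at this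
    nlinarith

/-- if a geometric complete bipartite graph with `n` red and `n` blue vertices
and `k` interior vertices contains a plane Hamiltonian cycle, then the number of boundary
positions `i` with `φ (w i) = φ (w (i-1))` is at most `k`. -/
theorem stmt_11 (P : Set Pt) (φ : Pt → ℕ) (hfin : P.Finite) (hgp : GenPos P)
    (n : ℕ) (red blue : ℕ) (hrb : red ≠ blue)
    (hcover : ∀ p ∈ P, φ p = red ∨ φ p = blue)
    (hR : {p ∈ P | φ p = red}.ncard = n) (hB : {p ∈ P | φ p = blue}.ncard = n)
    (k : ℕ) (hk : (interiorVertices P).ncard = k)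
    (m : ℕ) (w : ZMod m → Pt) (hw : IsCCWBoundaryOrder P m w)
    (hham : ∃ γ : ZMod (2 * n) → Pt, IsPlaneCycle φ (2 * n) γ ∧ Set.range γ = P) :
    {i : ZMod m | φ (w i) = φ (w (i - 1))}.ncard ≤ k := by
  classical
  obtain ⟨γ, hγ, hr⟩ := hham
  have hN := hγ.1
  have hinj := hγ.2.1
  have hcol := hγ.2.2.1
  haveI : NeZero (2 * n) := ⟨by omega⟩
  haveI : Fact (1 < 2 * n) := ⟨by omega⟩
  have hbP : boundaryVertices P ⊆ P := fun p hp => hp.1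
  have hiP : interiorVertices P ⊆ P := fun p hp => hp.1
  haveI : Finite (ZMod m) := by
    have : (Set.range w).Finite := by rw [hw.2.1]; exact hfin.subset hbP
    exact Set.finite_range_iff hw.1 |>.1 this
  set I : Set (ZMod (2 * n)) :=
    {j | γ j ∈ boundaryVertices P ∧ γ (j + 1) ∈ boundaryVertices P} with hI
  set B : Set (ZMod (2 * n)) := γ ⁻¹' boundaryVertices P with hBd
  set K : Set (ZMod (2 * n)) := {j | γ (j + 1) ∈ interiorVertices P} with hK
  have cB : B.ncard = Nat.card (ZMod m) := by
    rw [hBd, Set.ncard_preimage_of_injective_subset_range hinj (by rw [hr]; exact hbP),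
      ← hw.2.1, ← Set.image_univ, Set.ncard_image_of_injective _ hw.1, Set.ncard_univ]
  have cK : K.ncard = k := by
    have hinj' : Function.Injective (fun j => γ (j + 1)) := fun x y h => by
      simpa using hinj h
    have : K = (fun j => γ (j + 1)) ⁻¹' interiorVertices P := rfl
    rw [this, Set.ncard_preimage_of_injective_subset_range hinj', hk]
    intro p hp
    have : p ∈ Set.range γ := hr ▸ hiP hp
    obtain ⟨c, rfl⟩ := this
    exact ⟨c - 1, by simp⟩
  have hsub : B ⊆ I ∪ K := by
    intro j hj
    have hp : γ (j + 1) ∈ P := hr ▸ Set.mem_range_self _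
    by_cases h : γ (j + 1) ∈ interior (convexHull ℝ P)
    · right; exact ⟨hp, h⟩
    · left; exact ⟨hj, hp, subset_closure (subset_convexHull ℝ P hp), h⟩
  have c1 : B.ncard ≤ I.ncard + K.ncard :=
    (Set.ncard_le_ncard hsub (Set.toFinite _)).trans (Set.ncard_union_le _ _)
  have hex : ∀ j : ZMod (2 * n), ∃ i : ZMod m, j ∈ I →
      (γ j = w i ∧ γ (j + 1) = w (i - 1)) ∨ (γ j = w (i - 1) ∧ γ (j + 1) = w i) := by
    intro j
    by_cases hj : j ∈ I
    · obtain ⟨h1, h2⟩ := hj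
      rw [← hw.2.1] at h1 h2
      obtain ⟨a, ha⟩ := h1
      obtain ⟨b, hb⟩ := h2
      rcases aux_hull P φ (2 * n) m w hw γ hγ hr j a b ha.symm hb.symm with h | h
      · exact ⟨b, fun _ => Or.inr ⟨by rw [h]; simp [ha], hb.symm⟩⟩
      · exact ⟨a, fun _ => Or.inl ⟨ha.symm, by rw [h]; simp [hb]⟩⟩
    · exact ⟨0, fun h => absurd h hj⟩
  choose g hg using hex
  set M : Set (ZMod m) := {i : ZMod m | φ (w i) = φ (w (i - 1))} with hM
  have c2 : I.ncard ≤ Mᶜ.ncard := by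
    refine Set.ncard_le_ncard_of_injOn g ?_ ?_ (Set.toFinite _)
    · intro j hj hm
      have hm' : φ (w (g j)) = φ (w (g j - 1)) := hm
      have := hcol j
      rcases hg j hj with ⟨h1, h2⟩ | ⟨h1, h2⟩ <;> rw [h1, h2] at this
      · exact this hm'
      · exact this hm'.symm
    · intro x hx y hy hxy
      have two : ∀ z z' : ZMod (2 * n), z = z' + 1 → z + 1 = z' → False := by
        intro z z' h1 h2
        have h3 : ((2 : ℕ) : ZMod (2 * n)) = 0 := by
          push_cast
          have : z' + 2 = z' + 0 := by
            calc z' + 2 = (z' + 1) + 1 := by ring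
              _ = z' + 0 := by rw [← h1, h2, add_zero]
          exact add_left_cancel this
        rw [ZMod.natCast_eq_zero_iff] at h3
        have := Nat.le_of_dvd (by norm_num) h3
        omega
      have e1 := hg x hx
      have e2 := hg y hy
      rw [← hxy] at e2
      rcases e1 with ⟨h1, h2⟩ | ⟨h1, h2⟩ <;> rcases e2 with ⟨h3, h4⟩ | ⟨h3, h4⟩
      · exact hinj (h1.trans h3.symm)
      · exact (two x y (hinj (h1.trans h4.symm)) (hinj (h2.trans h3.symm))).elim
      · exact (two x y (hinj (h1.trans h4.symm)) (hinj (h2.trans h3.symm))).elim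
      · exact hinj (h1.trans h3.symm)
  have c3 : M.ncard + Mᶜ.ncard = Nat.card (ZMod m) := Set.ncard_add_ncard_compl M
  omega
end
end

section
/- Let H be a geometric complete bipartite graph, let w_1, …, w_m be the boundary vertices of H in counterclockwise order along the convex hull, and let C be a plane Hamiltonian cycle in H. Then C visits the boundary vertices in cyclic order along the convex hull: there is a traversal of C (choosing a suitable starting vertex and direction) in which the boundary vertices occur as the subsequence w_1, w_2, …, w_m. -/
noncomputable section

def sgB (p : ℝ) : Bool := decide (0 < p)

theorem sgB_pos {p : ℝ} (h : 0 < p) : sgB p = true := by simp [sgB, h]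

theorem sgB_neg {p : ℝ} (h : p < 0) : sgB p = false := by simp [sgB, h.le]

theorem sgB_mul {p q : ℝ} (hp : p ≠ 0) (hq : q ≠ 0) : sgB (p * q) = (sgB p == sgB q) := by
  rcases lt_or_gt_of_ne hp with h | h <;> rcases lt_or_gt_of_ne hq with h' | h'
  · simp [sgB_pos (mul_pos_of_neg_of_neg h h'), sgB_neg h, sgB_neg h']
  · simp [sgB_neg (mul_neg_of_neg_of_pos h h'), sgB_neg h, sgB_pos h']
  · simp [sgB_neg (mul_neg_of_pos_of_neg h h'), sgB_pos h, sgB_neg h']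
  · simp [sgB_pos (mul_pos h h'), sgB_pos h, sgB_pos h']

theorem sgB_sub {a b c : ℝ} (ha : a ≠ 0) (hb : b ≠ 0)
    (h : c = a - b) : (sgB a = !sgB b → sgB c = sgB a) := by
  rcases lt_or_gt_of_ne ha with h1 | h1 <;> rcases lt_or_gt_of_ne hb with h2 | h2
  · simp [sgB_neg h1, sgB_neg h2]
  · simp [sgB_neg h1, sgB_neg (show c < 0 by linarith)]
  · simp [sgB_pos h1, sgB_pos (show 0 < c by linarith)]
  · simp [sgB_pos h1, sgB_pos h2]

theorem sgB_add3 {a b c d : ℝ} (ha : a ≠ 0) (hb : b ≠ 0) (hc : c ≠ 0)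
    (h : d = a + b + c) (hab : sgB a = sgB b) (hbc : sgB b = sgB c) : sgB d = sgB a := by
  rcases lt_or_gt_of_ne ha with h1 | h1 <;> rcases lt_or_gt_of_ne hb with h2 | h2 <;>
    rcases lt_or_gt_of_ne hc with h3 | h3
  · rw [sgB_neg h1, sgB_neg (show d < 0 by linarith)]
  · simp [sgB_neg h2, sgB_pos h3] at hbc
  · simp [sgB_neg h1, sgB_pos h2] at hab
  · simp [sgB_neg h1, sgB_pos h2] at hab
  · simp [sgB_pos h1, sgB_neg h2] at hab
  · simp [sgB_pos h1, sgB_neg h2] at hab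
  · simp [sgB_pos h2, sgB_neg h3] at hbc
  · rw [sgB_pos h1, sgB_pos (show 0 < d by linarith)]

theorem sgB_zero3 {a b c : ℝ} (ha : a ≠ 0) (hb : b ≠ 0) (hc : c ≠ 0)
    (h : a + b + c = 0) : ¬ (sgB a = sgB b ∧ sgB b = sgB c) := by
  rintro ⟨hab, hbc⟩
  rcases lt_or_gt_of_ne ha with h1 | h1 <;> rcases lt_or_gt_of_ne hb with h2 | h2 <;>
    rcases lt_or_gt_of_ne hc with h3 | h3
  · linarith
  · simp [sgB_neg h2, sgB_pos h3] at hbc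
  · simp [sgB_neg h1, sgB_pos h2] at hab
  · simp [sgB_neg h1, sgB_pos h2] at hab
  · simp [sgB_pos h1, sgB_neg h2] at hab
  · simp [sgB_pos h1, sgB_neg h2] at hab
  · simp [sgB_pos h2, sgB_neg h3] at hbc
  · linarith

/-- combinatorial core -/
theorem bool_core : ∀ S s1 s2 s3 t1 t2 t3 r1 r2 r3 : Bool,
    (s1 = s2 → s2 = s3 → S = s1) → (t1 = t2 → t2 = t3 → S = t1) →
    ((s2 == t3) = !(s3 == t2) → (r1 == S) = (s2 == t3)) →
    ((s3 == t1) = !(s1 == t3) → (r2 == S) = (s3 == t1)) →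
    ((s1 == t2) = !(s2 == t1) → (r3 == S) = (s1 == t2)) →
    ¬ ((s1 == r1) = (s2 == r2) ∧ (s2 == r2) = (s3 == r3)) →
    ¬ ((t1 == r1) = (t2 == r2) ∧ (t2 == r2) = (t3 == r3)) →
    ((((s3 != t3) && (r1 != r2)) ^^ ((s1 != t1) && (r2 != r3))) ^^ ((s2 != t2) && (r1 != r3)))
      = (((s1 == s2) && (s2 == s3)) ^^ ((t1 == t2) && (t2 == t3))) := by
  decide +kernel

theorem sgB_neg_eq {p : ℝ} (hp : p ≠ 0) : sgB (-p) = !sgB p := by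
  rcases lt_or_gt_of_ne hp with h | h
  · rw [sgB_neg h, sgB_pos (by linarith)]; rfl
  · rw [sgB_pos h, sgB_neg (by linarith)]; rfl

/-- crossing indicator of two segments -/
def crB (x y u v : Pt) : Bool :=
  (sgB (sideSign x y u) != sgB (sideSign x y v)) && (sgB (sideSign u v x) != sgB (sideSign u v y))

def inTB (x y z u : Pt) : Bool :=
  (sgB (sideSign y z u) == sgB (sideSign z x u)) && (sgB (sideSign z x u) == sgB (sideSign x y u))

theorem crB_symm (x y u v : Pt) : crB x y u v = crB u v x y := by
  unfold crB; rw [Bool.and_comm]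

theorem crB_self (x u v : Pt) : crB x x u v = false := by
  simp [crB]

theorem triangle_lemma (x y z u v : Pt) (hS : sideSign x y z ≠ 0)
    (s1 : sideSign y z u ≠ 0) (s2 : sideSign z x u ≠ 0) (s3 : sideSign x y u ≠ 0)
    (t1 : sideSign y z v ≠ 0) (t2 : sideSign z x v ≠ 0) (t3 : sideSign x y v ≠ 0)
    (r1 : sideSign u v x ≠ 0) (r2 : sideSign u v y ≠ 0) (r3 : sideSign u v z ≠ 0) :
    ((crB x y u v ^^ crB y z u v) ^^ crB x z u v) = (inTB x y z u ^^ inTB x y z v) := by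
  have e1 : sideSign x z u = - sideSign z x u := by unfold sideSign; ring
  have e2 : sideSign x z v = - sideSign z x v := by unfold sideSign; ring
  have key := bool_core (sgB (sideSign x y z)) (sgB (sideSign y z u)) (sgB (sideSign z x u))
    (sgB (sideSign x y u)) (sgB (sideSign y z v)) (sgB (sideSign z x v))
    (sgB (sideSign x y v)) (sgB (sideSign u v x)) (sgB (sideSign u v y)) (sgB (sideSign u v z))
    (sgB_add3 s1 s2 s3 (by unfold sideSign; ring)) (sgB_add3 t1 t2 t3 (by unfold sideSign; ring))
    (by
      rw [← sgB_mul s2 t3, ← sgB_mul s3 t2, ← sgB_mul r1 hS]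
      exact sgB_sub (mul_ne_zero s2 t3) (mul_ne_zero s3 t2) (by unfold sideSign; ring))
    (by
      rw [← sgB_mul s3 t1, ← sgB_mul s1 t3, ← sgB_mul r2 hS]
      exact sgB_sub (mul_ne_zero s3 t1) (mul_ne_zero s1 t3) (by unfold sideSign; ring))
    (by
      rw [← sgB_mul s1 t2, ← sgB_mul s2 t1, ← sgB_mul r3 hS]
      exact sgB_sub (mul_ne_zero s1 t2) (mul_ne_zero s2 t1) (by unfold sideSign; ring))
    (by
      rw [← sgB_mul s1 r1, ← sgB_mul s2 r2, ← sgB_mul s3 r3]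
      exact sgB_zero3 (mul_ne_zero s1 r1) (mul_ne_zero s2 r2) (mul_ne_zero s3 r3)
        (by unfold sideSign; ring))
    (by
      rw [← sgB_mul t1 r1, ← sgB_mul t2 r2, ← sgB_mul t3 r3]
      exact sgB_zero3 (mul_ne_zero t1 r1) (mul_ne_zero t2 r2) (mul_ne_zero t3 r3)
        (by unfold sideSign; ring))
  rw [show crB x z u v = ((sgB (sideSign z x u) != sgB (sideSign z x v)) &&
    (sgB (sideSign u v x) != sgB (sideSign u v z))) by
      unfold crB; rw [e1, e2, sgB_neg_eq s2, sgB_neg_eq t2]; simp]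
  exact key

theorem sgB_ne {p q : ℝ} (h : (sgB p != sgB q) = true) (hp : p ≠ 0) (hq : q ≠ 0) :
    (p < 0 ∧ 0 < q) ∨ (0 < p ∧ q < 0) := by
  rcases lt_or_gt_of_ne hp with h1 | h1 <;> rcases lt_or_gt_of_ne hq with h2 | h2
  · simp [sgB_neg h1, sgB_neg h2] at h
  · exact Or.inl ⟨h1, h2⟩
  · exact Or.inr ⟨h1, h2⟩
  · simp [sgB_pos h1, sgB_pos h2] at h

theorem mem_seg_aux {u v : Pt} {s t : ℝ} (h : (s < 0 ∧ 0 < t) ∨ (0 < s ∧ t < 0)) :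
    ((s / (s - t)) • v + (-t / (s - t)) • u) ∈ segment ℝ u v := by
  have hD : s - t ≠ 0 := by
    rcases h with h | h
    · have : s - t < 0 := by linarith [h.1, h.2]
      exact this.ne
    · have : 0 < s - t := by linarith [h.1, h.2]
      exact this.ne'
  refine ⟨-t / (s - t), s / (s - t), ?_, ?_, ?_, ?_⟩
  · rcases h with h | h
    · exact div_nonneg_of_nonpos (by linarith) (by linarith)
    · exact div_nonneg (by linarith) (by linarith)
  · rcases h with h | h
    · exact div_nonneg_of_nonpos (by linarith) (by linarith)
    · exact div_nonneg (by linarith) (by linarith)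
  · field_simp; ring
  · rw [add_comm]

theorem crB_inter (x y u v : Pt) 
    (s : sideSign x y u ≠ 0) (t : sideSign x y v ≠ 0)
    (p : sideSign u v x ≠ 0) (q : sideSign u v y ≠ 0) (h : crB x y u v = true) :
    (segment ℝ x y ∩ segment ℝ u v).Nonempty := by
  unfold crB at h
  rw [Bool.and_eq_true] at h
  have h1 := sgB_ne h.1 s t
  have h2 := sgB_ne h.2 p q
  have m1 := mem_seg_aux (u := u) (v := v) h1
  have m2 := mem_seg_aux (u := x) (v := y) h2
  refine ⟨_, m2, ?_⟩
  convert m1 using 1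
  have hD : sideSign u v x - sideSign u v y = -(sideSign x y u - sideSign x y v) := by
    unfold sideSign; ring
  have hD0 : sideSign x y u - sideSign x y v ≠ 0 := by
    rcases h1 with h | h
    · have : sideSign x y u - sideSign x y v < 0 := by linarith [h.1, h.2]
      exact this.ne
    · have : 0 < sideSign x y u - sideSign x y v := by linarith [h.1, h.2]
      exact this.ne'
  rw [hD]
  have hD1 : -(sideSign x y u - sideSign x y v) ≠ 0 := neg_ne_zero.mpr hD0
  ext
  · simp only [Prod.fst_add, Prod.smul_fst, smul_eq_mul]
    rw [div_neg, div_neg]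
    field_simp
    unfold sideSign; ring
  · simp only [Prod.snd_add, Prod.smul_snd, smul_eq_mul]
    rw [div_neg, div_neg]
    field_simp
    unfold sideSign; ring

theorem side_ne {P : Set Pt} (h : GenPos P) {a b c : Pt} (ha : a ∈ P) (hb : b ∈ P) (hc : c ∈ P)
    (hab : a ≠ b) (hac : a ≠ c) (hbc : b ≠ c) : sideSign a b c ≠ 0 := by
  intro h0
  apply h a ha b hb c hc hab hac hbc
  rw [collinear_iff_of_mem (p₀ := a) (by simp)]
  refine ⟨b - a, ?_⟩
  unfold sideSign at h0
  have hc' : ∃ r : ℝ, c = r • (b - a) +ᵥ a := by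
    by_cases h1 : b.1 - a.1 = 0
    · have h2 : b.2 - a.2 ≠ 0 := by
        intro h2
        exact hab (Prod.ext (by linarith) (by linarith))
      refine ⟨(c.2 - a.2) / (b.2 - a.2), ?_⟩
      ext
      · simp
        field_simp
        nlinarith
      · simp
        field_simp
        ring
    · refine ⟨(c.1 - a.1) / (b.1 - a.1), ?_⟩
      ext
      · simp
        field_simp
        ring
      · simp
        field_simp
        linarith
  intro p hp
  rcases hp with rfl | rfl | hp
  · exact ⟨0, by simp⟩
  · exact ⟨1, by simp⟩
  · rw [Set.mem_singleton_iff] at hp; rw [hp]; exact hc'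

/-- extremality -/
def ExtP (P : Set Pt) (b : Pt) : Prop :=
  ∃ α β δ : ℝ, α * b.1 + β * b.2 + δ = 0 ∧ ∀ p ∈ P, p ≠ b → 0 < α * p.1 + β * p.2 + δ

theorem ext_not_inT {P : Set Pt} (hg : GenPos P) {x y z b : Pt} (he : ExtP P b)
    (hx : x ∈ P) (hy : y ∈ P) (hz : z ∈ P) (hb : b ∈ P) (hxy : x ≠ y) (hxz : x ≠ z) (hyz : y ≠ z)
    (bx : x ≠ b) (by' : y ≠ b) (bz : z ≠ b) : inTB x y z b = false := by
  obtain ⟨α, β, δ, h0, hp⟩ := he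
  have lx := hp x hx bx
  have ly := hp y hy by'
  have lz := hp z hz bz
  have s1 := side_ne hg hy hz hb hyz by' bz
  have s2 := side_ne hg hz hx hb hxz.symm bz bx
  have s3 := side_ne hg hx hy hb hxy bx by'
  have hsum : sideSign y z b * (α * x.1 + β * x.2 + δ) + sideSign z x b * (α * y.1 + β * y.2 + δ)
      + sideSign x y b * (α * z.1 + β * z.2 + δ) = 0 := by
    have : sideSign y z b * (α * x.1 + β * x.2 + δ) + sideSign z x b * (α * y.1 + β * y.2 + δ)
      + sideSign x y b * (α * z.1 + β * z.2 + δ) = sideSign x y z * (α * b.1 + β * b.2 + δ) := by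
      unfold sideSign; ring
    rw [this, h0, mul_zero]
  have := sgB_zero3 (mul_ne_zero s1 lx.ne') (mul_ne_zero s2 ly.ne') (mul_ne_zero s3 lz.ne') hsum
  rw [sgB_mul s1 lx.ne', sgB_mul s2 ly.ne', sgB_mul s3 lz.ne', sgB_pos lx, sgB_pos ly,
    sgB_pos lz] at this
  unfold inTB
  simpa using this

def bz (b : Bool) : ZMod 2 := if b then 1 else 0

theorem bz_xor (a b : Bool) : bz (a ^^ b) = bz a + bz b := by
  cases a <;> cases b <;> decide

theorem tele (g : ℕ → ZMod 2) (K : ℕ) :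
    ∑ j ∈ Finset.range K, (g j + g (j + 1)) = g 0 + g K := by
  induction K with
  | zero => simp [CharTwo.add_self_eq_zero]
  | succ n ih =>
    rw [Finset.sum_range_succ, ih]
    have := CharTwo.add_self_eq_zero (g n)
    linear_combination this

theorem path_red {P : Set Pt} (hg : GenPos P) (a b : ℕ → Pt) (K n : ℕ)
    (haP : ∀ i ≤ n, a i ∈ P) (hbP : ∀ j ≤ K, b j ∈ P)
    (hai : ∀ i ≤ n, ∀ j ≤ n, a i = a j → i = j) (hbi : ∀ i ≤ K, ∀ j ≤ K, b i = b j → i = j)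
    (hab : ∀ i ≤ n, ∀ j ≤ K, a i ≠ b j) (e0 : ExtP P (b 0)) (eK : ExtP P (b K)) :
    ∑ i ∈ Finset.range n, ∑ j ∈ Finset.range K, bz (crB (a i) (a (i + 1)) (b j) (b (j + 1))) =
      ∑ j ∈ Finset.range K, bz (crB (a 0) (a n) (b j) (b (j + 1))) := by
  induction n with
  | zero => simp [crB_self, bz]
  | succ n ih =>
    rw [Finset.sum_range_succ, ih (fun i hi => haP i (by omega))
      (fun i hi j hj => hai i (by omega) j (by omega)) (fun i hi => hab i (by omega))]
    rcases Nat.eq_zero_or_pos n with rfl | hn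
    · simp [crB_self, bz]
    have n1 : a 0 ≠ a n := fun h => by have := hai _ (by omega) _ (by omega) h; omega
    have n2 : a 0 ≠ a (n + 1) := fun h => by have := hai _ (by omega) _ (by omega) h; omega
    have n3 : a n ≠ a (n + 1) := fun h => by have := hai _ (by omega) _ (by omega) h; omega
    have p1 := haP 0 (by omega)
    have p2 := haP n (by omega)
    have p3 := haP (n + 1) (by omega)
    have d1 := hab 0 (by omega)
    have d2 := hab n (by omega)
    have d3 := hab (n + 1) (by omega)
    have hT : ∀ j ∈ Finset.range K, bz (crB (a 0) (a n) (b j) (b (j + 1))) +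
        bz (crB (a n) (a (n + 1)) (b j) (b (j + 1))) =
        bz (crB (a 0) (a (n + 1)) (b j) (b (j + 1))) +
        (bz (inTB (a 0) (a n) (a (n + 1)) (b j)) +
          bz (inTB (a 0) (a n) (a (n + 1)) (b (j + 1)))) := by
      intro j hj
      rw [Finset.mem_range] at hj
      have q1 := hbP j (by omega)
      have q2 := hbP (j + 1) (by omega)
      have m1 : b j ≠ b (j + 1) := fun h => by have := hbi _ (by omega) _ (by omega) h; omega
      have k1 := d1 j (by omega)
      have k2 := d2 j (by omega)
      have k3 := d3 j (by omega)
      have l1 := d1 (j + 1) (by omega)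
      have l2 := d2 (j + 1) (by omega)
      have l3 := d3 (j + 1) (by omega)
      have := triangle_lemma (a 0) (a n) (a (n + 1)) (b j) (b (j + 1))
        (side_ne hg p1 p2 p3 n1 n2 n3)
        (side_ne hg p2 p3 q1 n3 k2 k3) (side_ne hg p3 p1 q1 n2.symm k3 k1)
        (side_ne hg p1 p2 q1 n1 k1 k2)
        (side_ne hg p2 p3 q2 n3 l2 l3) (side_ne hg p3 p1 q2 n2.symm l3 l1)
        (side_ne hg p1 p2 q2 n1 l1 l2)
        (side_ne hg q1 q2 p1 m1 k1.symm l1.symm) (side_ne hg q1 q2 p2 m1 k2.symm l2.symm)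
        (side_ne hg q1 q2 p3 m1 k3.symm l3.symm)
      have h2 := congrArg bz this
      rw [bz_xor, bz_xor, bz_xor] at h2
      have h3 := CharTwo.add_self_eq_zero (bz (crB (a 0) (a (n + 1)) (b j) (b (j + 1))))
      linear_combination h2 - h3
    rw [← Finset.sum_add_distrib, Finset.sum_congr rfl hT, Finset.sum_add_distrib,
      tele (fun j => bz (inTB (a 0) (a n) (a (n + 1)) (b j)))]
    rw [ext_not_inT hg e0 p1 p2 p3 (hbP 0 (by omega)) n1 n2 n3 (d1 0 (by omega)) (d2 0 (by omega))
      (d3 0 (by omega)), ext_not_inT hg eK p1 p2 p3 (hbP K le_rfl) n1 n2 n3 (d1 K le_rfl)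
      (d2 K le_rfl) (d3 K le_rfl)]
    simp [bz]

theorem path_cross {P : Set Pt} (hg : GenPos P) (a b : ℕ → Pt) (K n : ℕ) (hn : 0 < n)
    (haP : ∀ i ≤ n, a i ∈ P) (hbP : ∀ j ≤ K, b j ∈ P)
    (hai : ∀ i ≤ n, ∀ j ≤ n, a i = a j → i = j) (hbi : ∀ i ≤ K, ∀ j ≤ K, b i = b j → i = j)
    (hab : ∀ i ≤ n, ∀ j ≤ K, a i ≠ b j) (e0 : ExtP P (b 0)) (eK : ExtP P (b K))
    (f0 : ExtP P (a 0)) (fn : ExtP P (a n))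
    (hpl : ∀ i < n, ∀ j < K,
      segment ℝ (a i) (a (i + 1)) ∩ segment ℝ (b j) (b (j + 1)) = (∅ : Set Pt)) :
    crB (a 0) (a n) (b 0) (b K) = false := by
  have h1 := path_red hg a b K n haP hbP hai hbi hab e0 eK
  have n0 : a 0 ≠ a n := fun h => by have := hai _ (by omega) _ (by omega) h; omega
  obtain ⟨b', hb0, hb1⟩ : ∃ b' : ℕ → Pt, b' 0 = a 0 ∧ b' 1 = a n :=
    ⟨fun i => if i = 0 then a 0 else a n, by simp, by simp⟩
  have h2 := path_red hg b b' 1 K hbP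
    (by
      intro j hj
      rcases (show j = 0 ∨ j = 1 by omega) with rfl | rfl
      · rw [hb0]; exact haP 0 (by omega)
      · rw [hb1]; exact haP n le_rfl) hbi
    (by
      intro i hi j hj h
      rcases (show i = 0 ∨ i = 1 by omega) with rfl | rfl <;>
        rcases (show j = 0 ∨ j = 1 by omega) with rfl | rfl
      · rfl
      · rw [hb0, hb1] at h; exact absurd h n0
      · rw [hb0, hb1] at h; exact absurd h.symm n0
      · rfl)
    (by
      intro i hi j hj
      rcases (show j = 0 ∨ j = 1 by omega) with rfl | rfl
      · rw [hb0]; exact (hab 0 (by omega) i hi).symm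
      · rw [hb1]; exact (hab n le_rfl i hi).symm) (by rw [hb0]; exact f0) (by rw [hb1]; exact fn)
  simp only [Finset.sum_range_one, Nat.zero_add, hb0, hb1] at h2
  have h3 : ∑ j ∈ Finset.range K, bz (crB (a 0) (a n) (b j) (b (j + 1))) =
      bz (crB (a 0) (a n) (b 0) (b K)) := by
    rw [crB_symm (a 0) (a n), ← h2]
    exact Finset.sum_congr rfl fun j _ => by rw [crB_symm]
  rw [h3] at h1
  have h4 : ∑ i ∈ Finset.range n, ∑ j ∈ Finset.range K,
      bz (crB (a i) (a (i + 1)) (b j) (b (j + 1))) = 0 := by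
    refine Finset.sum_eq_zero fun i hi => Finset.sum_eq_zero fun j hj => ?_
    rw [Finset.mem_range] at hi hj
    by_cases hc : crB (a i) (a (i + 1)) (b j) (b (j + 1)) = true
    · exfalso
      have m1 : b j ≠ b (j + 1) := fun h => by have := hbi _ (by omega) _ (by omega) h; omega
      have m2 : a i ≠ a (i + 1) := fun h => by have := hai _ (by omega) _ (by omega) h; omega
      have p1 := haP i (by omega)
      have p2 := haP (i + 1) (by omega)
      have q1 := hbP j (by omega)
      have q2 := hbP (j + 1) (by omega)
      have k1 := hab i (by omega) j (by omega)
      have k2 := hab (i + 1) (by omega) j (by omega)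
      have l1 := hab i (by omega) (j + 1) (by omega)
      have l2 := hab (i + 1) (by omega) (j + 1) (by omega)
      have := crB_inter _ _ _ _ (side_ne hg p1 p2 q1 m2 k1 k2) (side_ne hg p1 p2 q2 m2 l1 l2)
        (side_ne hg q1 q2 p1 m1 k1.symm l1.symm) (side_ne hg q1 q2 p2 m1 k2.symm l2.symm) hc
      rw [hpl i hi j hj] at this
      exact Set.not_nonempty_empty this
    · simp [bz, hc]
  rw [h4] at h1
  by_contra hne
  rw [Bool.not_eq_false] at hne
  rw [hne] at h1
  simp [bz] at h1

theorem convex_order (m : ℕ) (v : ℕ → Pt)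
    (hv : ∀ i, i + 1 < m → ∀ j < m, j ≠ i → j ≠ i + 1 → 0 < sideSign (v i) (v (i + 1)) (v j))
    (i j : ℕ) (hij : i < j) : ∀ k, j < k → k < m → 0 < sideSign (v i) (v j) (v k) := by
  intro k hjk
  induction k, hjk using Nat.le_induction with
  | base =>
    intro hm
    have := hv j hm i (by omega) (by omega) (by omega)
    have e : sideSign (v i) (v j) (v (j + 1)) = sideSign (v j) (v (j + 1)) (v i) := by
      unfold sideSign; ring
    rw [Nat.succ_eq_add_one, e]; exact this
  | succ c hc ih =>
    intro hm
    have h1 := ih (by omega)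
    have h2 := hv c hm i (by omega) (by omega) (by omega)
    have e : sideSign (v i) (v c) (v (c + 1)) = sideSign (v c) (v (c + 1)) (v i) := by
      unfold sideSign; ring
    rw [← e] at h2
    have h3 := hv i (by omega) c (by omega) (by omega) (by omega)
    have h4 := hv i (by omega) (c + 1) (by omega) (by omega) (by omega)
    have h5 : 0 ≤ sideSign (v i) (v (i + 1)) (v j) := by
      by_cases h : j = i + 1
      · subst h; unfold sideSign; apply le_of_eq; ring
      · exact (hv i (by omega) j (by omega) (by omega) h).le
    have gp : sideSign (v i) (v (i + 1)) (v c) * sideSign (v i) (v j) (v (c + 1)) =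
        sideSign (v i) (v (i + 1)) (v j) * sideSign (v i) (v c) (v (c + 1)) +
        sideSign (v i) (v (i + 1)) (v (c + 1)) * sideSign (v i) (v j) (v c) := by
      unfold sideSign; ring
    have : 0 < sideSign (v i) (v (i + 1)) (v c) * sideSign (v i) (v j) (v (c + 1)) := by
      rw [gp]; positivity
    exact (mul_pos_iff_of_pos_left h3).mp this

theorem convex_cross (m : ℕ) (v : ℕ → Pt)
    (hv : ∀ i, i + 1 < m → ∀ j < m, j ≠ i → j ≠ i + 1 → 0 < sideSign (v i) (v (i + 1)) (v j))
    (i j k l : ℕ) (hij : i < j) (hjk : j < k) (hkl : k < l) (hl : l < m) :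
    crB (v i) (v k) (v j) (v l) = true ∧ crB (v k) (v i) (v j) (v l) = true ∧
    crB (v i) (v k) (v l) (v j) = true ∧ crB (v k) (v i) (v l) (v j) = true := by
  have h1 := convex_order m v hv i j hij k hjk (by omega)
  have h2 := convex_order m v hv i k (by omega) l hkl hl
  have h3 := convex_order m v hv i j hij l (by omega) hl
  have h4 := convex_order m v hv j k hjk l hkl hl
  have e1 : sideSign (v i) (v k) (v j) < 0 := by unfold sideSign at *; linarith
  have e2 : 0 < sideSign (v j) (v l) (v i) := by unfold sideSign at *; linarith
  have e3 : sideSign (v j) (v l) (v k) < 0 := by unfold sideSign at *; linarith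
  have e4 : 0 < sideSign (v k) (v i) (v j) := by unfold sideSign at *; linarith
  have e5 : sideSign (v k) (v i) (v l) < 0 := by unfold sideSign at *; linarith
  have e6 : sideSign (v l) (v j) (v i) < 0 := by unfold sideSign at *; linarith
  have e7 : 0 < sideSign (v l) (v j) (v k) := by unfold sideSign at *; linarith
  unfold crB
  rw [sgB_neg e1, sgB_pos h2, sgB_pos e2, sgB_neg e3, sgB_pos e4, sgB_neg e5, sgB_neg e6,
    sgB_pos e7]
  decide

/-- betweenness on 1..m-1 implies monotone or antitone -/
theorem mono_of_between (m : ℕ) (g : ℕ → ℕ)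
    (hinj : ∀ i < m, ∀ j < m, g i = g j → i = j)
    (hb : ∀ j k l, 0 < j → j < k → k < l → l < m →
      (g j < g k ∧ g k < g l) ∨ (g l < g k ∧ g k < g j)) :
    (∀ j k, 0 < j → j < k → k < m → g j < g k) ∨ (∀ j k, 0 < j → j < k → k < m → g k < g j) := by
  by_cases hm : m ≤ 2
  · left; intro j k; omega
  have h12 : g 1 ≠ g 2 := fun h => by have := hinj 1 (by omega) 2 (by omega) h; omega
  rcases lt_or_gt_of_ne h12 with h | h
  · left
    have h1 : ∀ k, 1 < k → k < m → g 1 < g k := by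
      intro k h1 h2
      rcases (show k = 2 ∨ 2 < k by omega) with rfl | h3
      · exact h
      · have := hb 1 2 k (by omega) (by omega) h3 h2; omega
    intro j k h2 h3 h4
    rcases (show j = 1 ∨ 1 < j by omega) with rfl | h5
    · exact h1 k h3 h4
    · have := hb 1 j k (by omega) h5 h3 h4
      have := h1 j h5 (by omega)
      omega
  · right
    have h1 : ∀ k, 1 < k → k < m → g k < g 1 := by
      intro k h1 h2
      rcases (show k = 2 ∨ 2 < k by omega) with rfl | h3
      · exact h
      · have := hb 1 2 k (by omega) (by omega) h3 h2; omega
    intro j k h2 h3 h4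
    rcases (show j = 1 ∨ 1 < j by omega) with rfl | h5
    · exact h1 k h3 h4
    · have := hb 1 j k (by omega) h5 h3 h4
      have := h1 j h5 (by omega)
      omega

theorem sep_lemma {P : Set Pt} (hg : GenPos P) (c : ℕ → Pt) (N : ℕ) (hcP : ∀ i, c i ∈ P)
    (hinj : ∀ i j, i ≤ N → j ≤ N → c i = c j → i = j ∨ (i = 0 ∧ j = N) ∨ (i = N ∧ j = 0))
    (hseg : ∀ i j, i + 1 < j → j < N → ¬ (i = 0 ∧ j + 1 = N) →
      segment ℝ (c i) (c (i + 1)) ∩ segment ℝ (c j) (c (j + 1)) = (∅ : Set Pt))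
    (p q p' q' : ℕ) (h1 : p < q) (h2 : q < p') (h3 : p' < q') (h4 : q' ≤ N)
    (h5 : ¬ (p = 0 ∧ q' = N)) (e1 : ExtP P (c p)) (e2 : ExtP P (c q)) (e3 : ExtP P (c p'))
    (e4 : ExtP P (c q')) : crB (c p) (c q) (c p') (c q') = false := by
  have hq : p + (q - p) = q := by omega
  have hq' : p' + (q' - p') = q' := by omega
  have := path_cross hg (fun i => c (p + i)) (fun j => c (p' + j)) (q' - p') (q - p) (by omega)
    (fun i _ => hcP _) (fun i _ => hcP _)
    (fun i hi j hj h => by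
      have := hinj _ _ (by omega) (by omega) h; omega)
    (fun i hi j hj h => by
      have := hinj _ _ (by omega) (by omega) h; omega)
    (fun i hi j hj h => by
      have := hinj _ _ (by omega) (by omega) h; omega)
    (by simpa using e3) (by simpa [hq'] using e4) (by simpa using e1) (by simpa [hq] using e2)
    (fun i hi j hj => by
      exact hseg (p + i) (p' + j) (by omega) (by omega) (by omega))
  simpa [hq, hq'] using this

theorem ext_w {P : Set Pt} {m : ℕ} {w : ZMod m → Pt} (hw : IsCCWBoundaryOrder P m w)
    (h2 : (1 + 1 : ZMod m) ≠ 0) (i : ZMod m) : ExtP P (w i) := by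
  obtain ⟨hi, -, hs⟩ := hw
  have key : ∀ p ∈ P, p ≠ w i →
      0 < sideSign (w i) (w (i + 1)) p + sideSign (w (i - 1)) (w i) p := by
    intro p hp hne
    have hs2 := hs (i - 1) p hp
    rw [sub_add_cancel] at hs2
    by_cases h : p = w (i + 1)
    · have h3 : p ≠ w (i - 1) := by
        rw [h]
        intro h3
        apply h2
        have := hi h3
        linear_combination this
      have h4 := hs2 h3 hne
      have h5 : sideSign (w i) (w (i + 1)) p = 0 := by rw [h]; unfold sideSign; ring
      linarith
    · have h4 := hs i p hp hne h
      by_cases h6 : p = w (i - 1)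
      · have h5 : sideSign (w (i - 1)) (w i) p = 0 := by rw [h6]; unfold sideSign; ring
        linarith
      · have := hs2 h6 hne
        linarith
  have hlin : ∀ p : Pt, sideSign (w i) (w (i + 1)) p + sideSign (w (i - 1)) (w i) p =
      (-((w (i + 1)).2 - (w i).2) - ((w i).2 - (w (i - 1)).2)) * p.1 +
      (((w (i + 1)).1 - (w i).1) + ((w i).1 - (w (i - 1)).1)) * p.2 +
      (((w (i + 1)).2 - (w i).2) * (w i).1 - ((w (i + 1)).1 - (w i).1) * (w i).2 +
       ((w i).2 - (w (i - 1)).2) * (w (i - 1)).1 - ((w i).1 - (w (i - 1)).1) * (w (i - 1)).2) := by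
    intro p; unfold sideSign; ring
  refine ⟨_, _, _, (hlin (w i)).symm.trans ?_, fun p hp hne => (hlin p) ▸ key p hp hne⟩
  unfold sideSign; ring

/-- a plane Hamiltonian cycle `γ` in a geometric complete bipartite graph
visits the boundary vertices in cyclic order along the convex hull: there is a traversal of
`γ` (suitable start `s` and direction `ε = ±1`) in which the boundary vertices occur as the
subsequence `w 1, w 2, …, w m`. -/
theorem stmt_12 (P : Set Pt) (φ : Pt → ℕ) (hfin : P.Finite) (hgp : GenPos P)
    (hbip : ∃ c₁ c₂ : ℕ, c₁ ≠ c₂ ∧ φ '' P = {c₁, c₂})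
    (m : ℕ) (w : ZMod m → Pt) (hw : IsCCWBoundaryOrder P m w)
    (N : ℕ) (hN : N = P.ncard)
    (γ : ZMod N → Pt) (hcyc : IsPlaneCycle φ N γ) (hham : Set.range γ = P) :
    ∃ s : ZMod N, ∃ ε : ℤ, (ε = 1 ∨ ε = -1) ∧
      ∃ f : Fin m → ℕ, StrictMono f ∧ (∀ k : Fin m, f k < N) ∧
        ∀ k : Fin m, γ (s + ((ε * (f k : ℤ) : ℤ) : ZMod N)) = w (((k : ℕ) : ZMod m) + 1) := by
  obtain ⟨hN3, hγi, -, hpl⟩ := hcyc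
  have hw' := hw
  obtain ⟨hwi, hwr, hws⟩ := hw'
  have hwP : ∀ i, w i ∈ P := fun i => by
    have : w i ∈ boundaryVertices P := hwr ▸ Set.mem_range_self i
    exact this.1
  haveI : NeZero N := ⟨by omega⟩
  have hm0 : m ≠ 0 := by
    rintro rfl
    have : (Set.range w).Finite := hfin.subset (by rintro _ ⟨i, rfl⟩; exact hwP i)
    have h2 := Set.infinite_range_of_injective (α := ℤ) hwi
    exact h2 this
  haveI : NeZero m := ⟨hm0⟩
  have h2 : (1 + 1 : ZMod m) ≠ 0 := by
    intro h
    obtain ⟨p, hp, hne⟩ : ∃ p ∈ P, p ∉ ({w 0, w (0 + 1)} : Set Pt) := by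
      by_contra hcon
      push Not at hcon
      have h1 : P.ncard ≤ ({w 0, w (0 + 1)} : Set Pt).ncard := Set.ncard_le_ncard hcon (by simp)
      have h3 := Set.ncard_insert_le (w 0) {w (0 + 1)}
      rw [Set.ncard_singleton] at h3
      omega
    simp only [Set.mem_insert_iff, Set.mem_singleton_iff, not_or] at hne
    have a1 := hws 0 p hp hne.1 hne.2
    have a2 := hws (0 + 1) p hp hne.2 (by rw [zero_add, h]; exact hne.1)
    rw [show (0 + 1 + 1 : ZMod m) = 0 by rw [zero_add, h]] at a2
    unfold sideSign at a1 a2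
    linarith
  have hext := ext_w hw h2
  have castN : ∀ i j : ℕ, i < N → j < N → (i : ZMod N) = j → i = j := by
    intro i j hi hj h
    have := congrArg ZMod.val h
    rwa [ZMod.val_natCast_of_lt hi, ZMod.val_natCast_of_lt hj] at this
  have castM : ∀ i j : ℕ, i < m → j < m → (i : ZMod m) = j → i = j := by
    intro i j hi hj h
    have := congrArg ZMod.val h
    rwa [ZMod.val_natCast_of_lt hi, ZMod.val_natCast_of_lt hj] at this
  obtain ⟨v, hvdef⟩ : ∃ v : ℕ → Pt, ∀ k, v k = w ((k : ZMod m) + 1) := ⟨_, fun _ => rfl⟩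
  have hvP : ∀ k, v k ∈ P := fun k => hvdef k ▸ hwP _
  have hve : ∀ k, ExtP P (v k) := fun k => hvdef k ▸ hext _
  have hvi : ∀ i < m, ∀ j < m, v i = v j → i = j := by
    intro i hi j hj h
    rw [hvdef, hvdef] at h
    exact castM i j hi hj (add_right_cancel (hwi h))
  have hvs : ∀ i, i + 1 < m → ∀ j < m, j ≠ i → j ≠ i + 1 →
      0 < sideSign (v i) (v (i + 1)) (v j) := by
    intro i hi j hj h1 h3
    have n1 : v j ≠ v i := fun h => h1 (hvi j hj i (by omega) h)
    have n2 : v j ≠ v (i + 1) := fun h => h3 (hvi j hj (i + 1) hi h)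
    have hc : v (i + 1) = w ((i : ZMod m) + 1 + 1) := by rw [hvdef]; push_cast; rfl
    have := hws ((i : ZMod m) + 1) (v j) (hvP j) (by rw [← hvdef]; exact n1)
      (by rw [← hc]; exact n2)
    rwa [← hc, ← hvdef] at this
  have hex : ∀ k, ∃ i : ZMod N, γ i = v k := fun k => by
    have := hvP k
    rw [← hham] at this
    exact this
  choose p hp using hex
  obtain ⟨s, hs⟩ : ∃ s, s = p 0 := ⟨_, rfl⟩
  obtain ⟨g, hgdef⟩ : ∃ g : ℕ → ℕ, ∀ k, g k = (p k - s).val := ⟨_, fun _ => rfl⟩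
  obtain ⟨c, hcdef⟩ : ∃ c : ℕ → Pt, ∀ i : ℕ, c i = γ (s + i) := ⟨_, fun _ => rfl⟩
  have hcg : ∀ k, c (g k) = v k := fun k => by
    rw [hcdef, hgdef, ZMod.natCast_zmod_val, add_sub_cancel, hp]
  have hg0 : g 0 = 0 := by rw [hgdef, hs, sub_self, ZMod.val_zero]
  have hgN : ∀ k, g k < N := fun k => by rw [hgdef]; exact ZMod.val_lt _
  have hcN : c N = v 0 := by rw [← hcg 0, hg0, hcdef, hcdef]; simp
  have hgi : ∀ i < m, ∀ j < m, g i = g j → i = j := by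
    intro i hi j hj h
    apply hvi i hi j hj
    rw [← hcg, ← hcg, h]
  have hcP : ∀ i, c i ∈ P := fun i => by rw [hcdef, ← hham]; exact Set.mem_range_self _
  have hci : ∀ i j, i < N → j < N → c i = c j → i = j := by
    intro i j hi hj h
    rw [hcdef, hcdef] at h
    exact castN i j hi hj (add_left_cancel (hγi h))
  have hcN0 : c N = c 0 := by rw [hcN, ← hcg 0, hg0]
  have hcinj : ∀ i j, i ≤ N → j ≤ N → c i = c j → i = j ∨ (i = 0 ∧ j = N) ∨ (i = N ∧ j = 0) := by
    intro i j hi hj h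
    rcases Nat.lt_or_eq_of_le hi with hi | rfl <;> rcases Nat.lt_or_eq_of_le hj with hj | rfl
    · exact Or.inl (hci i j hi hj h)
    · rw [hcN0] at h
      exact Or.inr (Or.inl ⟨hci i 0 hi (by omega) h, rfl⟩)
    · rw [hcN0] at h
      exact Or.inr (Or.inr ⟨rfl, (hci 0 j (by omega) hj h).symm⟩)
    · exact Or.inl rfl
  have hseg : ∀ i j, i + 1 < j → j < N → ¬ (i = 0 ∧ j + 1 = N) →
      segment ℝ (c i) (c (i + 1)) ∩ segment ℝ (c j) (c (j + 1)) = (∅ : Set Pt) := by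
    intro i j hij hj hne
    have e1 : ∀ i : ℕ, c (i + 1) = γ (s + i + 1) := fun i => by
      rw [hcdef]; push_cast; rw [add_assoc]
    have q1 : s + (i : ZMod N) ≠ s + j := fun h => by
      have := castN i j (by omega) hj (add_left_cancel h); omega
    have q2 : s + (j : ZMod N) ≠ s + i + 1 := fun h => by
      rw [add_assoc] at h
      have h' := add_left_cancel h
      have := castN j (i + 1) hj (by omega) (by rw [h']; push_cast; rfl); omega
    have q3 : s + (i : ZMod N) ≠ s + j + 1 := fun h => by
      rw [add_assoc] at h
      have h' := add_left_cancel h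
      by_cases hjN : j + 1 = N
      · have h3 : (i : ZMod N) = ((0 : ℕ) : ZMod N) := by
          rw [h', ← Nat.cast_add_one, hjN]; simp
        have := castN i 0 (by omega) (by omega) h3
        exact hne ⟨this, hjN⟩
      · have := castN i (j + 1) (by omega) (by omega) (by rw [h']; push_cast; rfl); omega
    have := (hpl _ _ q1).2 q2 q3
    rw [e1, e1, hcdef, hcdef]
    exact this
  have hsep := sep_lemma hgp c N hcP hcinj hseg
  have hbt : ∀ j k l, 0 < j → j < k → k < l → l < m →
      (g j < g k ∧ g k < g l) ∨ (g l < g k ∧ g k < g j) := by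
    intro j k l h0 hjk hkl hl
    obtain ⟨x1, x2, x3, x4⟩ := convex_cross m v hvs 0 j k l h0 hjk hkl hl
    have d0 : g 0 ≠ g j := fun h => by have := hgi _ (by omega) _ (by omega) h; omega
    have d1 : g 0 ≠ g k := fun h => by have := hgi _ (by omega) _ (by omega) h; omega
    have d2 : g 0 ≠ g l := fun h => by have := hgi _ (by omega) _ (by omega) h; omega
    have d3 : g j ≠ g k := fun h => by have := hgi _ (by omega) _ (by omega) h; omega
    have d4 : g k ≠ g l := fun h => by have := hgi _ (by omega) _ (by omega) h; omega
    have d5 : g j ≠ g l := fun h => by have := hgi _ (by omega) _ (by omega) h; omega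
    have E : ∀ k, ExtP P (c (g k)) := fun k => by rw [hcg]; exact hve k
    have EN : ExtP P (c N) := by rw [hcN]; exact hve 0
    have bj := hgN j
    have bk := hgN k
    have bl := hgN l
    by_contra hcon
    rcases (show (g j < g l ∧ g l < g k) ∨ (g l < g j ∧ g j < g k) ∨ (g k < g j ∧ g j < g l) ∨
      (g k < g l ∧ g l < g j) by omega) with h | h | h | h
    · have := hsep (g j) (g l) (g k) N h.1 h.2 bk le_rfl (by omega) (E j) (E l) (E k) EN
      rw [hcg, hcg, hcg, hcN, crB_symm, x2] at this
      exact absurd this (by decide)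
    · have := hsep (g l) (g j) (g k) N h.1 h.2 bk le_rfl (by omega) (E l) (E j) (E k) EN
      rw [hcg, hcg, hcg, hcN, crB_symm, x4] at this
      exact absurd this (by decide)
    · have := hsep (g 0) (g k) (g j) (g l) (by omega) h.1 h.2 bl.le (by omega) (E 0) (E k) (E j) (E l)
      rw [hcg, hcg, hcg, hcg, x1] at this
      exact absurd this (by decide)
    · have := hsep (g 0) (g k) (g l) (g j) (by omega) h.1 h.2 bj.le (by omega) (E 0) (E k) (E l) (E j)
      rw [hcg, hcg, hcg, hcg, x3] at this
      exact absurd this (by decide)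
  have hgpos : ∀ k, 0 < k → k < m → 0 < g k := by
    intro k h0 hk
    have : g k ≠ g 0 := fun h => by have := hgi _ hk _ (by omega) h; omega
    omega
  rcases mono_of_between m g hgi hbt with hmon | hanti
  · refine ⟨s, 1, Or.inl rfl, fun k => g k, ?_, fun k => hgN k, ?_⟩
    · intro a b hab
      have hab' : (a : ℕ) < b := hab
      have := b.2
      show g a < g b
      rcases Nat.eq_zero_or_pos (a : ℕ) with h | h
      · rw [h, hg0]; exact hgpos _ (by omega) b.2
      · exact hmon _ _ h hab' b.2
    · intro k
      rw [← hvdef, ← hcg k, hcdef]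
      simp
  · refine ⟨s, -1, Or.inr rfl, fun k => if (k : ℕ) = 0 then 0 else N - g k, ?_, fun k => ?_, ?_⟩
    · intro a b hab
      have hab' : (a : ℕ) < b := hab
      have := b.2
      have h1 := hgN a
      have h3 := hgN b
      show (if (a : ℕ) = 0 then 0 else N - g a) < (if (b : ℕ) = 0 then 0 else N - g b)
      rw [if_neg (show ¬ ((b : ℕ) = 0) by omega)]
      split_ifs with h
      · omega
      · have := hanti _ _ (by omega) hab' b.2
        omega
    · dsimp only
      split_ifs with h
      · omega
      · have := hgpos k (by omega) k.2
        omega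
    · intro k
      rw [← hvdef, ← hcg k, hcdef]
      congr 2
      dsimp only
      split_ifs with h
      · rw [h, hg0]; simp
      · rw [Nat.cast_sub (hgN k).le]
        push_cast
        simp
end
end
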